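/- Let G be a canonical plumbing graph containing none of the seventeen forbidden configurations as an induced subgraph, and let Γ be its dual. Then for every positive integer N, every embedding of Γ into ℤ^N is either standard or semi-standard. -/

import Mathlib

namespace LensPaper

/-- A finite weighted simple graph: the combinatorial data underlying a configuration
(a disjoint union of weighted linear graphs).  The fact that every connected component
is a path is recorded separately by `Config.IsLinear`. -/
structure Config where
  V : Type
  fin : Fintype V
  deq : DecidableEq V
  graph : SimpleGraph V
  adjDec : DecidableRel graph.Adj
  w : V → ℤ

attribute [instance] Config.fin Config.deq Config.adjDec

namespace Config

/-- The degree of a vertex. -/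
noncomputable def deg (C : Config) (v : C.V) : ℕ := (C.graph.neighborSet v).ncard

/-- A configuration: every component is a path, i.e. all degrees are at most `2` and the
graph is acyclic. -/
def IsLinear (C : Config) : Prop :=
  (∀ v : C.V, C.deg v ≤ 2) ∧ C.graph.IsAcyclic

/-- The adjusted weight `w'(v) = w(v) - deg(v)`. -/
noncomputable def adjw (C : Config) (v : C.V) : ℤ := C.w v - C.deg v

/-- A vertex is bad if it is adjacent to two distinct vertices of positive adjusted
weight. -/
def IsBad (C : Config) (x : C.V) : Prop :=
  ∃ u v : C.V, u ≠ v ∧ C.graph.Adj x u ∧ C.graph.Adj x v ∧ 0 < C.adjw u ∧ 0 < C.adjw v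

/-- A leaf: a vertex of degree at most one. -/
def IsLeaf (C : Config) (v : C.V) : Prop := C.deg v ≤ 1

/-- `v 0, v 1, …, v m` is a chain of consecutive (distinct) vertices. -/
def IsChain (C : Config) (m : ℕ) (v : ℕ → C.V) : Prop :=
  (∀ i ≤ m, ∀ j ≤ m, v i = v j → i = j) ∧ ∀ i < m, C.graph.Adj (v i) (v (i + 1))

/-- The chain `v 0, …, v m` has the list `p` as its sequence of adjusted weights. -/
def ChainPattern (C : Config) (m : ℕ) (v : ℕ → C.V) (p : List ℤ) : Prop :=
  C.IsChain m v ∧ m + 1 = p.length ∧ ∀ i : Fin p.length, C.adjw (v i) = p.get i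

/-- `Γ` contains a chain of consecutive vertices whose adjusted weights, read in order,
form the list `p`. -/
def HasPattern (C : Config) (p : List ℤ) : Prop := ∃ m v, C.ChainPattern m v p

/-- A chain realizing a bad-part pattern `p` (each entry of `p` is an adjusted weight
together with a flag marking the bad positions): the chain has the prescribed adjusted
weights, and the bad vertices of the configuration are exactly the vertices of the chain
in the flagged positions. -/
def IsBadPartChain (C : Config) (p : List (ℤ × Bool)) (m : ℕ) (v : ℕ → C.V) : Prop :=
  C.IsChain m v ∧ m + 1 = p.length ∧
  (∀ i : Fin p.length, C.adjw (v i) = (p.get i).1) ∧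
  (∀ x : C.V, C.IsBad x ↔ ∃ i : Fin p.length, (p.get i).2 = true ∧ v i = x)

end Config

/-- The chains of adjusted weights forbidden by Working Condition VI. -/
def forbiddenPatterns : List (List ℤ) :=
  [[1, 0, 0, 2], [1, 0, 0, 3], [1, 0, 0, 0, 3], [1, 1, 0, 0, 1, 2], [3, 1, 0, 0, 1],
   [1, 0, 1, 2], [1, 0, 1, 3], [1, 1, 0, 2], [1, 1, 0, 1, 1, 2]]

/-- The bad-part patterns of Working Condition VII; `true` marks the bad positions. -/
def badPatterns : List (List (ℤ × Bool)) :=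
  [[(1, false), (0, true), (1, false)],
   [(1, false), (0, true), (2, false)],
   [(1, false), (0, true), (3, false)],
   [(1, false), (1, true), (1, false)],
   [(1, false), (1, true), (2, false)],
   [(1, false), (2, true), (1, false)],
   [(1, false), (0, true), (1, false), (0, true), (1, false)],
   [(1, false), (0, true), (1, false), (0, true), (2, false)],
   [(1, false), (0, true), (1, false), (1, true), (1, false)],
   [(1, false), (0, true), (1, false), (1, true), (2, false)],
   [(1, false), (1, true), (1, true), (1, false)],
   [(1, false), (1, true), (1, true), (1, true), (1, false)],
   [(1, false), (1, true), (2, true), (1, false)]]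

namespace Config

/-- The Working Conditions (I)–(VII). -/
def WorkingConditions (C : Config) : Prop :=
  (∀ v : C.V, 2 ≤ C.w v) ∧
  (∀ v : C.V, C.adjw v ≤ 3) ∧
  (∀ u v : C.V, 1 < C.adjw u → 1 < C.adjw v → u = v) ∧
  (∀ v x : C.V, 1 < C.adjw v → C.IsBad x → C.adjw x = 1 → C.graph.Adj x v) ∧
  ((∃ v : C.V, C.adjw v = 3) →
     ∀ u u' : C.V, C.graph.Adj u u' → C.adjw u = 1 → C.adjw u' = 1 → False) ∧
  (∀ u v x : C.V, C.graph.Adj u v → C.adjw u = 1 → C.adjw v = 1 →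
     C.IsBad x → C.adjw x = 2 → C.graph.Adj x u ∨ C.graph.Adj x v) ∧
  (∀ p ∈ forbiddenPatterns, ¬ C.HasPattern p) ∧
  ((∃ x : C.V, C.IsBad x) → ∃ p ∈ badPatterns, ∃ m v, C.IsBadPartChain p m v)

end Config

/-- The standard inner product on `ℤ^N`. -/
def dot {N : ℕ} (x y : Fin N → ℤ) : ℤ := ∑ i, x i * y i

/-- The support of a vector of `ℤ^N` with respect to the standard orthonormal basis. -/
def supp {N : ℕ} (x : Fin N → ℤ) : Finset (Fin N) :=
  Finset.univ.filter fun i => x i ≠ 0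

namespace Config

/-- An embedding of a configuration into `ℤ^N`. -/
def IsEmbedding (C : Config) (N : ℕ) (φ : C.V → Fin N → ℤ) : Prop :=
  ∀ u v : C.V, dot (φ u) (φ v) =
    if u = v then C.w u else if C.graph.Adj u v then -1 else 0

/-- The restriction of `φ` to `S` is standard. -/
def IsStandardOn (C : Config) (N : ℕ) (φ : C.V → Fin N → ℤ) (S : Set C.V) : Prop :=
  ∀ u ∈ S, ∀ v ∈ S,
    ((supp (φ u) ∩ supp (φ v)).card : ℤ) =
      if u = v then C.w v else if C.graph.Adj u v then 1 else 0

/-- A standard embedding. -/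
def IsStandard (C : Config) (N : ℕ) (φ : C.V → Fin N → ℤ) : Prop :=
  C.IsStandardOn N φ Set.univ

/-- The restriction of `φ` to `S` is semi-standard at `x`. -/
def IsSemiStandardAtOn (C : Config) (N : ℕ) (φ : C.V → Fin N → ℤ) (x : C.V)
    (S : Set C.V) : Prop :=
  (∀ u ∈ S, ∀ v ∈ S,
    ((supp (φ u) ∩ supp (φ v)).card : ℤ) =
      if u = v then C.w v
      else if C.graph.Adj u v then 1
      else if C.graph.Adj x u ∧ C.graph.Adj x v then 2
      else 0) ∧
  (∀ u ∈ S, ∀ v ∈ S, u ≠ v → C.graph.Adj x u → C.graph.Adj x v →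
    (supp (φ u) ∩ supp (φ x) ∩ supp (φ v)).card = 1)

/-- A semi-standard embedding: semi-standard at some bad vertex. -/
def IsSemiStandard (C : Config) (N : ℕ) (φ : C.V → Fin N → ℤ) : Prop :=
  ∃ x : C.V, C.IsBad x ∧ C.IsSemiStandardAtOn N φ x Set.univ

/-- A candidate for the extended bad part: a chain containing the bad part whose two
ends are either leaves or preceded by two consecutive vertices of vanishing adjusted
weight. -/
def IsEBPCand (C : Config) (m : ℕ) (v : ℕ → C.V) : Prop :=
  C.IsChain m v ∧
  (∀ p ∈ badPatterns, ∀ mb vb, C.IsBadPartChain p mb vb →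
     ∀ i ≤ mb, ∃ j ≤ m, v j = vb i) ∧
  (C.IsLeaf (v 0) ∨ (2 ≤ m ∧ C.adjw (v 1) = 0 ∧ C.adjw (v 2) = 0)) ∧
  (C.IsLeaf (v m) ∨ (2 ≤ m ∧ C.adjw (v (m - 1)) = 0 ∧ C.adjw (v (m - 2)) = 0))

/-- The extended bad part: a candidate with the fewest vertices. -/
def IsExtBadPart (C : Config) (m : ℕ) (v : ℕ → C.V) : Prop :=
  C.IsEBPCand m v ∧ ∀ m' v', C.IsEBPCand m' v' → m ≤ m'

/-- The set of vertices of the chain `v 0, …, v m`. -/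
def ebpSet (C : Config) (m : ℕ) (v : ℕ → C.V) : Set C.V := {y | ∃ i ≤ m, v i = y}

/-- The outside part of `Γ` relative to the extended bad part `v 0, …, v m`. -/
def OutsidePart (C : Config) (m : ℕ) (v : ℕ → C.V) : Set C.V :=
  {x | ∀ i ≤ m, v i ≠ x}
  ∪ {x | ¬ C.IsLeaf (v 0) ∧ (x = v 0 ∨ x = v 1 ∨ x = v 2)}
  ∪ {x | ¬ C.IsLeaf (v m) ∧ (x = v m ∨ x = v (m - 1) ∨ x = v (m - 2))}

/-- A screw at the front end of the extended bad part. -/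
def IsFrontScrew (C : Config) (N : ℕ) (φ : C.V → Fin N → ℤ) (m : ℕ) (v : ℕ → C.V)
    (e : Fin N) : Prop :=
  ¬ C.IsLeaf (v 0) ∧ 3 ≤ m ∧ φ (v 2) e ≠ 0 ∧ φ (v 3) e ≠ 0

/-- A screw at the back end of the extended bad part. -/
def IsBackScrew (C : Config) (N : ℕ) (φ : C.V → Fin N → ℤ) (m : ℕ) (v : ℕ → C.V)
    (e : Fin N) : Prop :=
  ¬ C.IsLeaf (v m) ∧ 3 ≤ m ∧ φ (v (m - 2)) e ≠ 0 ∧ φ (v (m - 3)) e ≠ 0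

/-- All screws of `Γ` (with respect to `φ`) are clean. -/
def AllScrewsClean (C : Config) (N : ℕ) (φ : C.V → Fin N → ℤ) (m : ℕ)
    (v : ℕ → C.V) : Prop :=
  (∀ e : Fin N, C.IsFrontScrew N φ m v e →
    ∀ u : C.V, u ≠ v 2 → u ≠ v 3 → φ u e = 0) ∧
  (∀ e : Fin N, C.IsBackScrew N φ m v e →
    ∀ u : C.V, u ≠ v (m - 2) → u ≠ v (m - 3) → φ u e = 0)

end Config
/-- The path graph on the disjoint union of the components encoded by a list of lists:
two vertices are adjacent iff they lie in the same component in consecutive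
positions. -/
def ofListGraph (L : List (List ℤ)) :
    SimpleGraph ((i : Fin L.length) × Fin (L.get i).length) where
  Adj a b := a.1 = b.1 ∧ ((a.2 : ℕ) + 1 = (b.2 : ℕ) ∨ (b.2 : ℕ) + 1 = (a.2 : ℕ))
  symm := ⟨fun a b h => ⟨h.1.symm, h.2.symm⟩⟩
  loopless := by
    refine ⟨?_⟩
    intro a h
    rcases h with ⟨-, h | h⟩ <;> omega

instance ofListGraphDec (L : List (List ℤ)) : DecidableRel (ofListGraph L).Adj :=
  fun a b => decidable_of_iff
    (a.1 = b.1 ∧ ((a.2 : ℕ) + 1 = (b.2 : ℕ) ∨ (b.2 : ℕ) + 1 = (a.2 : ℕ))) Iff.rfl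

/-- The configuration (disjoint union of weighted paths) encoded by a list of
components, each component being the list of its weights read along the path. -/
def ofList (L : List (List ℤ)) : Config where
  V := (i : Fin L.length) × Fin (L.get i).length
  fin := inferInstance
  deq := inferInstance
  graph := ofListGraph L
  adjDec := ofListGraphDec L
  w := fun a => (L.get a.1).get a.2

/-- `A` occurs as an induced subgraph of `B`: an injective, weight-preserving map
that preserves and reflects adjacency. -/
def IsInducedSubgraph (A B : Config) : Prop :=
  ∃ f : A.V → B.V, Function.Injective f ∧
    (∀ v, B.w (f v) = A.w v) ∧
    (∀ u v, A.graph.Adj u v ↔ B.graph.Adj (f u) (f v))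

/-- `A` is (isomorphic to) the subgraph of `B` induced by the vertex set `S`. -/
def IsInducedOn (A B : Config) (S : Set B.V) : Prop :=
  ∃ f : A.V → B.V, Function.Injective f ∧
    (∀ v, B.w (f v) = A.w v) ∧
    (∀ u v, A.graph.Adj u v ↔ B.graph.Adj (f u) (f v)) ∧
    Set.range f = S

/-- Negative continued fraction `[a₁,…,aₙ]⁻ = a₁ - 1/[a₂,…,aₙ]⁻` (the empty list is
sent to `0`; with the junk value `1/0 = 0` this gives `[aₙ]⁻ = aₙ`). -/
def negCF : List ℤ → ℚ
  | [] => 0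
  | a :: l => (a : ℚ) - 1 / negCF l

/-- The (positive) sequences `a` and `b` are dual: for some coprime `p > q > 0`,
`[a]⁻ = p/q` and `[b]⁻ = p/(p-q)`. -/
def DualSeqs (a b : List ℤ) : Prop :=
  a ≠ [] ∧ b ≠ [] ∧ (∀ x ∈ a, 2 ≤ x) ∧ (∀ x ∈ b, 2 ≤ x) ∧
  ∃ p q : ℤ, 0 < q ∧ q < p ∧ Int.gcd p q = 1 ∧
    negCF a = (p : ℚ) / (q : ℚ) ∧ negCF b = (p : ℚ) / ((p : ℚ) - (q : ℚ))

/-- `P` encodes a canonical plumbing graph (weights `≤ -2`) and `D` encodes its dual: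
the components correspond to each other and each pair of weight sequences is dual. -/
def IsDualPair (P D : List (List ℤ)) : Prop :=
  ∃ h : P.length = D.length,
    ∀ i : Fin P.length,
      DualSeqs ((P.get i).map fun x => -x) (D.get (Fin.cast h i))

/-- The total number of vertices encoded by a list of components. -/
def totalLen (L : List (List ℤ)) : ℕ := (L.map List.length).sum

/-- The canonical plumbing graph encoded by `P`, with dual encoded by `D`, fails
Property `X_k`: its dual admits an embedding into `ℤ^(n-k)`, where
`n = |V(G)| + |V(Γ)|`. -/
def FailsX (k : ℕ) (P D : List (List ℤ)) : Prop :=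
  k ≤ totalLen P + totalLen D ∧
  ∃ φ : (ofList D).V → Fin (totalLen P + totalLen D - k) → ℤ,
    (ofList D).IsEmbedding (totalLen P + totalLen D - k) φ

/-- The seventeen forbidden configurations of Theorem B (iii), encoded as lists of
path components. -/
def forbidden17 : List (List (List ℤ)) :=
  [[[-5, -2]], [[-6, -2, -2]], [[-2], [-2]], [[-3], [-2, -2]], [[-3, -2, -2, -3]],
   [[-3, -5, -3, -2]], [[-2, -2, -3, -5]], [[-4, -3, -2]], [[-3, -4, -2]],
   [[-4, -4, -2, -2]], [[-3, -4, -3, -3, -2]], [[-3, -3], [-2]], [[-3, -2, -3], [-3]],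
   [[-4], [-4]], [[-4], [-3, -3]], [[-4], [-3, -2, -3]], [[-3, -3], [-3, -3]]]

namespace Config

/-- A shallow vertex of a canonical plumbing graph. -/
def IsShallow (C : Config) (v : C.V) : Prop :=
  C.w v = -2 ∨ C.w v = -4 ∨
  (C.w v = -3 ∧ ∃ u, C.graph.Adj v u ∧ C.w u = -2) ∨
  (C.w v = -3 ∧ ∃ u, C.graph.Adj v u ∧ C.w u = -3)

/-- A deep vertex of a canonical plumbing graph. -/
def IsDeep (C : Config) (v : C.V) : Prop :=
  (5 ≤ |C.w v| ∧ ∀ u, C.graph.Adj v u → ¬ C.IsShallow u) ∨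
  (C.w v = -3 ∧ ∀ u, ¬ C.graph.Adj v u)

end Config

namespace Search

/-- Items to be given a coefficient; `T` bounds the residual target below this item. -/
inductive Items
  | nil
  | cons (a T : Nat) (l : Items)

noncomputable section

def listBEq : List Nat → List Nat → Bool :=
  List.rec (List.rec true (fun _ _ _ => false))
    (fun a _ ih => List.rec false (fun b m _ => Bool.rec false (ih m) (Nat.beq a b)))

def memB (a : List Nat) : List (List Nat) → Bool :=
  List.rec false (fun b _ ih => Bool.rec ih true (listBEq a b))

def addNew (a : List Nat) (l : List (List Nat)) : List (List Nat) :=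
  Bool.rec (List.cons a l) l (memB a l)

def ones : Nat → List Nat → List Nat :=
  Nat.rec (fun l => l) (fun _ ih l => ih (List.cons 1 l))

def merge : List Nat → List Nat → List Nat :=
  List.rec (fun l => l) (fun a l ih =>
    List.rec (List.cons a l) (fun b m ih2 =>
      Bool.rec (List.cons b ih2) (List.cons a (ih (List.cons b m))) (Nat.ble a b)))

def leaf (two : Bool) (bn : List Nat) (m : Nat) (path : List Nat) (acc : List (List Nat)) :
    List (List Nat) :=
  Bool.rec (addNew (ones m (merge path bn)) acc)
    (Bool.rec (addNew (ones m (merge path bn)) acc)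
      (addNew (ones (Nat.sub m 4) (List.cons 2 (merge path bn)))
        (addNew (ones m (merge path bn)) acc))
      (Nat.ble 4 m)) two

def branch (ih : Nat → Nat → Nat → List Nat → List (List Nat) → List (List Nat))
    (T x prev m r : Nat) (path : List Nat) (acc : List (List Nat)) : List (List Nat) :=
  Bool.rec acc (Bool.rec acc (ih m r x (List.cons x path) acc) (Nat.ble r T)) (Nat.ble x prev)

/-- Pairs of a shifted coefficient and its square. -/
def choices : Bool → List (Nat × Nat) :=
  Bool.rec [(2, 1), (1, 0), (0, 1)] [(4, 4), (3, 1), (2, 0), (1, 1), (0, 4)]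

def step (ih : Nat → Nat → Nat → List Nat → List (List Nat) → List (List Nat))
    (e a T m r prev : Nat) (path : List Nat) (acc : List (List Nat)) :
    List (Nat × Nat) → List (List Nat) :=
  List.rec acc (fun c _ ihc => Prod.rec (fun j k => Bool.rec ihc (Bool.rec ihc
    (branch ih T (Nat.sub (Nat.add (Nat.mul 8 a) j) e) prev (Nat.sub m k)
      (Nat.sub r (Nat.mul j a)) path ihc) (Nat.ble (Nat.mul j a) r)) (Nat.ble k m)) c)

def bound : Bool → Nat := Bool.rec 1 2

def enum (two : Bool) (bn : List Nat) :
    Items → Nat → Nat → Nat → List Nat → List (List Nat) → List (List Nat) :=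
  Items.rec (fun m _ _ path acc => leaf two bn m path acc)
    (fun a T _ ih m r prev path acc =>
      step ih (bound two) a T m r prev path acc (choices two))

/-- Enumerate the coefficients with weighted sum `p - q`. -/
def start (two : Bool) (it : Items) (S m p q : Nat) (bn : List Nat) (acc : List (List Nat)) :
    List (List Nat) :=
  Bool.rec acc (Bool.rec acc
    (enum two bn it m (Nat.sub (Nat.add S p) q) (Nat.add (Nat.mul 8 S) 8) List.nil acc)
    (Nat.ble p (Nat.add q S))) (Nat.ble q (Nat.add p S))

/-- Coordinates in the support of a neighbour, with the sign there (`true` if positive). -/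
abbrev Nbrs := List (Nat × Bool)

def eights : Nbrs → List Nat :=
  List.rec List.nil (fun s _ ih => List.cons (Nat.mul 8 (Prod.fst s)) ih)

def pick (two : Bool) (it : Items) (S k m : Nat) :
    Nbrs → (List Nat → List Nat) → List (List Nat) → List (List Nat) :=
  List.rec (fun _ acc => acc)
    (fun s l ih pr acc => Prod.rec (fun a sg =>
      ih (fun t => pr (List.cons (Nat.mul 8 a) t))
        (Bool.rec
          (start two it S m 0 (Nat.add k a) (pr (List.cons (Nat.succ (Nat.mul 8 a)) (eights l)))
            acc)
          (start two it S m a k (pr (List.cons (Nat.pred (Nat.mul 8 a)) (eights l))) acc) sg)) s)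

structure Prep where
  it : Items
  S : Nat
  b : List Nat
  ns : Nbrs

/-- Add `4` to each of the lowest twenty base 8 digits, so that signed digits of absolute value at
most `2` become digits that can be read off with `Nat.land`. -/
@[irreducible] def shift (a : Nat) : Nat := Nat.add a 658812288346769700

def notB : Bool → Bool := Bool.rec true false

def prepWith (e : Nat) (f g h : Nat → Bool) :
    List Nat → Nat → Items → (List Nat → List Nat) → Prep :=
  List.rec (fun S it b => Prep.mk it S (b List.nil) List.nil)
    (fun a _ ih S it b =>
      Bool.rec (ih S it (fun t => b (List.cons (Nat.mul 8 a) t)))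
        (Bool.rec
          (Prep.rec (fun it S b ns => Prep.mk it S b (List.cons (Prod.mk a (h a)) ns)) (ih S it b))
          (ih (Nat.add S (Nat.mul e a)) (Items.cons a (Nat.add S S) it) b) (g a)) (f a))

/-- Classify the coordinates into blocked ones, free ones and those of the neighbour. -/
def prep (e bm bh nk nh : Nat) : List Nat → Nat → Items → (List Nat → List Nat) → Prep :=
  prepWith e (fun a => Nat.beq (Nat.land (shift a) bm) bh)
    (fun a => Nat.beq (Nat.land (shift a) nk) nh)
    (fun a => notB (Nat.ble (Nat.land (shift a) nk) nh))

def sols1 (two : Bool) (P : Prep) (k w : Nat) (nb : Bool) (acc : List (List Nat)) :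
    List (List Nat) :=
  Prep.rec (fun it S b ns => Bool.rec (start two it S w 0 k b acc)
    (Nat.rec acc (fun m _ => pick two it S k m ns (fun t => merge t b) acc) w) nb) P

def sols (two : Bool) (k w : Nat) (nb : Bool) : List Prep → List (List Nat) :=
  List.rec List.nil (fun P _ ih => sols1 two P k w nb ih)

def preps (e bm bh nk nh : Nat) : List (List Nat) → List Prep :=
  List.rec List.nil (fun M _ ih => List.cons (prep e bm bh nk nh M 0 Items.nil (fun t => t)) ih)

/-- A window of consecutive vertices: adjusted weights, the times at which the vertices were
added, and whether the window can be extended before its head and after its last vertex. -/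
structure Seg where
  ws : List Nat
  ts : List Nat
  lo : Bool
  ro : Bool

def app : List Nat → List Nat → List Nat :=
  List.rec (fun m => m) (fun a _ ih m => List.cons a (ih m))

def lead : List Nat → Nat :=
  List.rec 0 (fun w _ ih => Nat.rec (Nat.rec 0 (fun _ _ => Nat.succ ih) ih) (fun _ _ => 3) w)

def consLead (g : Nat) (l : List Nat) : List Nat := Nat.rec l (fun _ _ => List.cons g l) g

/-- The weights of the plumbing graph determined by a window of adjusted weights of the dual. -/
def rows : List Nat → List Nat :=
  List.rec List.nil (fun w t ih =>
    Nat.rec ih (fun w _ => Nat.rec (consLead (lead t) ih) (fun _ ih2 => List.cons 2 ih2) w) w)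

def startsWithB : List Nat → List Nat → Bool :=
  List.rec (fun _ => true)
    (fun a _ ih R => List.rec false (fun b m _ => Bool.rec false (ih m) (Nat.beq a b)) R)

def containedB (a : List Nat) : List Nat → Bool :=
  List.rec (startsWithB a List.nil) (fun b m ih => Bool.rec ih true (startsWithB a (List.cons b m)))

def dropLen : List Nat → List Nat → List Nat :=
  List.rec (fun R => R) (fun _ _ ih R => List.rec List.nil (fun _ m _ => ih m) R)

def hitIn (R : List Nat) : List (List Nat × List Nat) → Bool :=
  List.rec false (fun p _ ih => Prod.rec (fun a b =>
    Bool.rec ih (Bool.rec ih true (containedB b (List.tail (dropLen a R)))) (startsWithB a R)) p)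

/-- The forbidden configurations, sorted by the first entry of the first component. -/
def table : List (List (List Nat × List Nat)) :=
  [[], [],
   [([], [2]), ([], [3, 3]), ([2], [3]), ([5], []), ([2, 6], []), ([3, 5, 3], []),
    ([2, 3, 5], []), ([3, 4], []), ([4, 3], []), ([2, 4, 4], []), ([3, 3, 4, 3], [])],
   [([], [2, 2]), ([], [3, 2, 3]), ([3], [2]), ([3], [4]), ([3], [3, 3]), ([2, 3], [3]),
    ([2, 3], [4]), ([2, 2, 3], []), ([5, 3, 2], []), ([4, 2], []), ([4, 3, 3, 2], [])],
   [([], [4]), ([], [3, 3]), ([], [3, 2, 3]), ([3, 2], []), ([4, 2, 2], [])],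
   [([2], []), ([3, 2, 2], [])],
   [([2, 2], [])]]

def nth : List (List (List Nat × List Nat)) → Nat → List (List Nat × List Nat) :=
  List.rec (fun _ => []) (fun a _ ih n => Nat.rec a (fun m _ => ih m) n)

def hit : List Nat → Bool := List.rec false (fun a R _ => hitIn R (nth table a))

def emptySeg : Seg := ⟨[], [], false, false⟩

def revOnto {α : Type} : List α → List α → List α :=
  List.rec (fun l => l) (fun a _ ih l => ih (List.cons a l))

def Seg.rev (A : Seg) : Seg :=
  Seg.rec (fun ws ts lo ro => ⟨revOnto ws List.nil, revOnto ts List.nil, ro, lo⟩) A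

/-- The sum of `8 ^ (n - t)` over the first `k` elements of a list. -/
def mask (n : Nat) : List Nat → Nat → Nat :=
  List.rec (fun _ => 0)
    (fun t _ ih k => Nat.rec 0 (fun k _ => Nat.add (Nat.pow 8 (Nat.sub n t)) (ih k)) k)

def orB (a b : Bool) : Bool := Bool.rec b true a

def andB (a b : Bool) : Bool := Bool.rec false b a

/-- Continue unless no embedding is left. -/
def unlessNil (M : List (List Nat)) (k : List (List Nat) → Bool) : Bool :=
  List.rec true (fun a l _ => k (List.cons a l)) M

def options (S : Nat → List (List Nat)) (k : Nat → Bool → List (List Nat) → Bool)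
    (base : List Nat) : Bool :=
  andB (unlessNil (S 2) (fun M => andB (k 0 true M) (orB (hit base) (k 1 false M))))
    (orB (hit base)
      (andB (unlessNil (S 3) (fun M =>
          andB (k 1 true M) (orB (hit (List.cons 2 base)) (k 2 false M))))
        (orB (hit (List.cons 2 base))
          (andB (unlessNil (S 4) (fun M =>
              andB (k 2 true M) (orB (hit (List.cons 2 (List.cons 2 base))) (k 3 false M))))
            (orB (hit (List.cons 2 (List.cons 2 base)))
              (unlessNil (S 5) (fun M => k 3 true M)))))))

def two (D : Nat) : Bool := Nat.beq D 0

/-- Extend the window `A` by a vertex before its head, in all possible ways. -/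
def extend (D n : Nat) (A B : Seg) (Ms : List (List Nat))
    (k : Seg → List (List Nat) → Bool) : Bool :=
  Seg.rec (fun ws ts _ ro =>
    options (fun w => sols (two D) (mask n ts 1) w
        (Bool.rec false (List.rec false (fun _ _ _ => true) ts) (Nat.ble 2 D))
        ((fun bm nk => preps (bound (two D)) (Nat.mul 7 bm) (Nat.mul 4 bm) (Nat.mul 7 nk)
            (Nat.mul 4 nk) Ms)
          (mask n (List.tail (List.tail ts)) (Nat.sub D 3))
          (Bool.rec 0 (mask n ts 1) (Nat.ble 2 D))))
      (fun wp c M => k (Seg.mk (List.cons wp ws) (List.cons (Nat.succ n) ts) c ro) M)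
      (consLead (lead ws) (app (rows ws) (List.cons 0 (rows (Seg.ws B)))))) A

def refute (D : Nat) : Nat → Nat → Seg → Seg → List (List Nat) → Bool :=
  Nat.rec (fun _ _ _ M => unlessNil M (fun _ => false))
    (fun _ ih n A B M => unlessNil M (fun M => Bool.rec (ih n B (Seg.rev A) M)
      (extend D n A B M (fun A' M' => ih (Nat.succ n) B (Seg.rev A') M')) (Seg.lo A)))

def filterB (p : List Nat → Bool) : List (List Nat) → List (List Nat) :=
  List.rec List.nil (fun a _ ih => Bool.rec ih (List.cons a ih) (p a))

def digitNZ (m a : Nat) : Bool :=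
  notB (Nat.beq (Nat.land (shift a) (Nat.mul 7 m)) (Nat.mul 4 m))

def countB (p : Nat → Bool) : List Nat → Nat :=
  List.rec 0 (fun a _ ih => Bool.rec ih (Nat.succ ih) (p a))

/-- The number of coordinates with three given digits nonzero. -/
def overlap (m1 m2 m3 : Nat) : List Nat → Nat :=
  countB fun a => andB (digitNZ m1 a) (andB (digitNZ m2 a) (digitNZ m3 a))

def build (D : Nat) (viol : List Nat → List Nat → Bool) :
    Nat → Nat → Seg → List (List Nat) → Bool :=
  Nat.rec (fun n A Ms => refute D (Nat.sub 19 n) n A emptySeg (filterB (viol (Seg.ws A)) Ms))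
    (fun _ ih n A Ms => Bool.rec true
      (extend D n A emptySeg Ms (fun A' M' => ih (Nat.succ n) A' M')) (Seg.lo A))

def starts : List (Nat × Bool × Bool) :=
  [(0, true, true), (1, true, true), (2, true, true), (3, true, true), (1, true, false),
   (2, true, false), (3, true, false), (1, false, true), (2, false, true), (3, false, true),
   (2, false, false), (3, false, false)]

def boolNat : Bool → Nat := Bool.rec 0 1

def single (D d : Nat) (viol : List Nat → List Nat → Bool) (i : Nat → List (List Nat)) : Bool :=
  starts.all fun o =>
    build D viol d 0 ⟨[o.1], [0], o.2.1, o.2.2⟩ (i (o.1 + boolNat o.2.1 + boolNat o.2.2))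

def unitStart (w : Nat) : List (List Nat) := [ones w []]

def bigStart : Nat → List (List Nat)
  | 4 => [[2]]
  | 5 => [[1, 2]]
  | _ => []

/-- Violation of the expected overlap of the first and last vertex of a window. -/
def viol : Nat → List Nat → List Nat → Bool
  | 0, _, _ => true
  | 1, _, M => !(Nat.beq (overlap 1 8 1 M) 1)
  | 2, 0 :: _, M => Nat.ble 1 (overlap 1 64 1 M)
  | 2, [_, _, 0], M => Nat.ble 1 (overlap 1 64 1 M)
  | 2, _, M =>
    !(Nat.beq (overlap 1 64 1 M) 0 ||
      (Nat.beq (overlap 1 64 1 M) 2 && Nat.beq (overlap 1 64 8 M) 1))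
  | d, _, M => Nat.ble 1 (overlap 1 (Nat.pow 8 d) 1 M)

def violAdjacent (_ : List Nat) (M : List Nat) : Bool :=
  Nat.ble 1 (overlap 1 64 64 M) && Nat.ble 1 (overlap 8 512 512 M)

def violNear (_ : List Nat) (M : List Nat) : Bool :=
  Nat.ble 1 (overlap 1 64 64 M) && Nat.ble 1 (overlap 64 4096 4096 M)

def double : Bool :=
  starts.all fun o => starts.all fun o' =>
    orB (orB (Bool.rec false (hit (rows [o.1] ++ 0 :: rows [o'.1])) (Nat.ble 1 o.1))
        (Bool.rec false (hit ((rows [o.1]).tail ++ 0 :: rows [o'.1])) (Nat.ble 2 o.1)))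
      (refute 8 12 1 ⟨[o'.1], [1], o'.2.1, o'.2.2⟩ ⟨[o.1], [0], o.2.1, o.2.2⟩
        (filterB (fun M => Nat.ble 1 (overlap 1 8 8 M))
          (sols false 0 (o'.1 + boolNat o'.2.1 + boolNat o'.2.2) false
            (preps 1 0 0 0 0 (unitStart (o.1 + boolNat o.2.1 + boolNat o.2.2))))))

end

theorem single_zero : single 0 0 (viol 0) bigStart = true := by decide +kernel
theorem single_one : single 1 1 (viol 1) unitStart = true := by decide +kernel
theorem single_two : single 2 2 (viol 2) unitStart = true := by decide +kernel
theorem single_three : single 3 3 (viol 3) unitStart = true := by decide +kernel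
theorem single_four : single 4 4 (viol 4) unitStart = true := by decide +kernel
theorem single_five : single 5 5 (viol 5) unitStart = true := by decide +kernel
theorem single_six : single 6 6 (viol 6) unitStart = true := by decide +kernel
theorem single_seven : single 7 7 (viol 7) unitStart = true := by decide +kernel
theorem single_adjacent : single 3 3 violAdjacent unitStart = true := by decide +kernel
theorem single_near : single 4 4 violNear unitStart = true := by decide +kernel
theorem double_eq_true : double = true := by decide +kernel

theorem two_windows_hit : ((List.range 12).all fun i => (List.range 36).all fun j =>
    (rows [1, i / 3, i % 3 + 1] ++
      0 :: rows [1 + j / 12, j / 3 % 4, j % 3 + 1]).tails.any hit) = true := by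
  decide +kernel

theorem listBEq_eq_true : ∀ {a b : List ℕ}, listBEq a b = true → a = b
  | [], [], _ => rfl
  | [], _ :: _, h => absurd h (by simp [listBEq])
  | _ :: _, [], h => absurd h (by simp [listBEq])
  | a :: l, b :: m, h => by
    change (Bool.rec false (listBEq l m) (Nat.beq a b) : Bool) = true at h
    cases hab : Nat.beq a b with
    | false => rw [hab] at h; exact absurd h (by simp)
    | true => rw [hab] at h; rw [Nat.eq_of_beq_eq_true hab, listBEq_eq_true (a := l) (b := m) h]

theorem memB_eq_true {a : List ℕ} : ∀ {l : List (List ℕ)}, memB a l = true → a ∈ l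
  | [], h => absurd h (by simp [memB])
  | b :: l, h => by
    change (Bool.rec (memB a l) true (listBEq a b) : Bool) = true at h
    cases hab : listBEq a b with
    | false => rw [hab] at h; exact List.mem_cons_of_mem _ (memB_eq_true h)
    | true => rw [listBEq_eq_true hab]; exact List.mem_cons_self

theorem mem_addNew_self (a : List ℕ) (l : List (List ℕ)) : a ∈ addNew a l := by
  unfold addNew
  cases h : memB a l with
  | false => exact List.mem_cons_self
  | true => exact memB_eq_true h

theorem mem_addNew_of_mem (a : List ℕ) {l : List (List ℕ)} {b : List ℕ} (h : b ∈ l) :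
    b ∈ addNew a l := by
  unfold addNew
  cases memB a l with
  | false => exact List.mem_cons_of_mem _ h
  | true => exact h

theorem ones_eq (m : ℕ) (l : List ℕ) : ones m l = List.replicate m 1 ++ l := by
  induction m generalizing l with
  | zero => rfl
  | succ m ih =>
    change ones m (1 :: l) = _
    rw [ih, List.replicate_succ', List.append_assoc]; rfl

theorem merge_nil (l : List ℕ) : merge l [] = l := by cases l <;> rfl

theorem merge_cons_cons (a : ℕ) (l : List ℕ) (b : ℕ) (m : List ℕ) :
    merge (a :: l) (b :: m) =
      if a ≤ b then a :: merge l (b :: m) else b :: merge (a :: l) m := by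
  change (Bool.rec (b :: merge (a :: l) m) (a :: merge l (b :: m)) (Nat.ble a b) : List ℕ) = _
  by_cases h : a ≤ b
  · rw [if_pos h, Nat.ble_eq_true_of_le h]
  · rw [if_neg h]
    cases h' : Nat.ble a b with
    | false => rfl
    | true => exact absurd (Nat.le_of_ble_eq_true h') h

theorem merge_perm : ∀ l m : List ℕ, (merge l m).Perm (l ++ m)
  | [], _ => List.Perm.refl _
  | a :: l, [] => by rw [merge_nil, List.append_nil]
  | a :: l, b :: m => by
    rw [merge_cons_cons]
    split
    · exact (merge_perm l (b :: m)).cons a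
    · exact ((merge_perm (a :: l) m).cons b).trans List.perm_middle.symm
  termination_by l m => l.length + m.length

theorem merge_sorted : ∀ l m : List ℕ, l.Pairwise (· ≤ ·) → m.Pairwise (· ≤ ·) →
    (merge l m).Pairwise (· ≤ ·)
  | [], _, _, hm => hm
  | a :: l, [], hl, _ => by rwa [merge_nil]
  | a :: l, b :: m, hl, hm => by
    rw [merge_cons_cons]
    rw [List.pairwise_cons] at hl hm
    split
    · rename_i h
      refine List.pairwise_cons.2 ⟨fun x hx => ?_,
        merge_sorted l (b :: m) hl.2 (List.pairwise_cons.2 hm)⟩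
      rcases List.mem_append.1 ((merge_perm _ _).subset hx) with hx | hx
      · exact hl.1 x hx
      · rcases List.mem_cons.1 hx with rfl | hx
        · exact h
        · exact h.trans (hm.1 x hx)
    · rename_i h
      refine List.pairwise_cons.2 ⟨fun x hx => ?_,
        merge_sorted (a :: l) m (List.pairwise_cons.2 hl) hm.2⟩
      rcases List.mem_append.1 ((merge_perm _ _).subset hx) with hx | hx
      · rcases List.mem_cons.1 hx with rfl | hx
        · omega
        · have := hl.1 x hx; omega
      · exact hm.1 x hx
  termination_by l m => l.length + m.length

theorem mem_leaf_of_mem {two : Bool} {bn : List ℕ} {m : ℕ} {path : List ℕ}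
    {acc : List (List ℕ)} {Q : List ℕ} (h : Q ∈ acc) : Q ∈ leaf two bn m path acc := by
  unfold leaf
  cases two with
  | false => exact mem_addNew_of_mem _ h
  | true =>
    cases Nat.ble 4 m with
    | false => exact mem_addNew_of_mem _ h
    | true => exact mem_addNew_of_mem _ (mem_addNew_of_mem _ h)

/-- The absolute values of the coefficients on new coordinates, of total square `m`. -/
def IsFresh (two : Bool) (m : ℕ) (F : List ℕ) : Prop :=
  F = List.replicate m 1 ∨ (two = true ∧ 4 ≤ m ∧ F = List.replicate (m - 4) 1 ++ [2])

theorem mem_leaf {two : Bool} {bn : List ℕ} {m : ℕ} {path : List ℕ}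
    {acc : List (List ℕ)} {F : List ℕ} (h : IsFresh two m F) :
    F ++ merge path bn ∈ leaf two bn m path acc := by
  unfold leaf
  rcases h with rfl | ⟨rfl, hm, rfl⟩
  · rw [← ones_eq]
    cases two with
    | false => exact mem_addNew_self _ _
    | true =>
      cases Nat.ble 4 m with
      | false => exact mem_addNew_self _ _
      | true => exact mem_addNew_of_mem _ (mem_addNew_self _ _)
  · rw [Nat.ble_eq_true_of_le hm, List.append_assoc,
      show List.replicate (m - 4) 1 ++ ([2] ++ merge path bn) =
        ones (Nat.sub m 4) (2 :: merge path bn) from (ones_eq _ _).symm]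
    exact mem_addNew_self _ _

/-- The items with the given values and their residual bounds. -/
def toItems (e : ℕ) : List ℕ → Items
  | [] => .nil
  | a :: l => .cons a (e * l.sum + e * l.sum) (toItems e l)

theorem mem_step_of_mem {ih : ℕ → ℕ → ℕ → List ℕ → List (List ℕ) → List (List ℕ)}
    (hih : ∀ m r x p acc (Q : List ℕ), Q ∈ acc → Q ∈ ih m r x p acc)
    (e a T m r prev : ℕ) (path : List ℕ) (acc : List (List ℕ)) (ch : List (ℕ × ℕ)) (Q : List ℕ)
    (h : Q ∈ acc) : Q ∈ step ih e a T m r prev path acc ch := by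
  induction ch with
  | nil => exact h
  | cons c ch ihc =>
    obtain ⟨j, k⟩ := c
    change Q ∈ (Bool.rec (step ih e a T m r prev path acc ch)
      (Bool.rec (step ih e a T m r prev path acc ch)
        (branch ih T (Nat.sub (Nat.add (Nat.mul 8 a) j) e) prev (Nat.sub m k)
          (Nat.sub r (Nat.mul j a)) path (step ih e a T m r prev path acc ch))
        (Nat.ble (Nat.mul j a) r))
      (Nat.ble k m) : List (List ℕ))
    cases Nat.ble k m with
    | false => exact ihc
    | true =>
      cases Nat.ble (Nat.mul j a) r with
      | false => exact ihc
      | true =>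
        unfold branch
        cases Nat.ble (Nat.sub (Nat.add (Nat.mul 8 a) j) e) prev with
        | false => exact ihc
        | true =>
          cases Nat.ble (Nat.sub r (Nat.mul j a)) T with
          | false => exact ihc
          | true => exact hih _ _ _ _ _ _ ihc

theorem mem_step {ih : ℕ → ℕ → ℕ → List ℕ → List (List ℕ) → List (List ℕ)}
    (hih : ∀ m r x p acc (Q : List ℕ), Q ∈ acc → Q ∈ ih m r x p acc)
    {e a T m r prev : ℕ} {path : List ℕ} {acc : List (List ℕ)} {ch : List (ℕ × ℕ)} {Q : List ℕ}
    {j k : ℕ} (hjk : (j, k) ∈ ch) (hk : k ≤ m) (hr : j * a ≤ r) (hp : 8 * a + j - e ≤ prev)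
    (hT : r - j * a ≤ T)
    (h : ∀ acc, Q ∈ ih (m - k) (r - j * a) (8 * a + j - e) ((8 * a + j - e) :: path) acc) :
    Q ∈ step ih e a T m r prev path acc ch := by
  induction ch with
  | nil => cases hjk
  | cons c ch ihc =>
    obtain ⟨j', k'⟩ := c
    change Q ∈ (Bool.rec (step ih e a T m r prev path acc ch)
      (Bool.rec (step ih e a T m r prev path acc ch)
        (branch ih T (Nat.sub (Nat.add (Nat.mul 8 a) j') e) prev (Nat.sub m k')
          (Nat.sub r (Nat.mul j' a)) path (step ih e a T m r prev path acc ch))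
        (Nat.ble (Nat.mul j' a) r))
      (Nat.ble k' m) : List (List ℕ))
    rcases List.mem_cons.1 hjk with hjk | hjk
    · obtain ⟨rfl, rfl⟩ := Prod.mk.inj hjk
      rw [Nat.ble_eq_true_of_le hk,
        show Nat.ble (Nat.mul j a) r = true from Nat.ble_eq_true_of_le hr]
      unfold branch
      rw [show Nat.ble (Nat.sub (Nat.add (Nat.mul 8 a) j) e) prev = true from
          Nat.ble_eq_true_of_le hp,
        show Nat.ble (Nat.sub r (Nat.mul j a)) T = true from Nat.ble_eq_true_of_le hT]
      exact h _
    · have := ihc hjk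
      cases Nat.ble k' m with
      | false => exact this
      | true =>
        cases Nat.ble (Nat.mul j' a) r with
        | false => exact this
        | true =>
          unfold branch
          cases Nat.ble (Nat.sub (Nat.add (Nat.mul 8 a) j') e) prev with
          | false => exact this
          | true =>
            cases Nat.ble (Nat.sub r (Nat.mul j' a)) T with
            | false => exact this
            | true => exact hih _ _ _ _ _ _ this

theorem mem_enum_of_mem {two : Bool} {bn : List ℕ} (it : Items) :
    ∀ (m r x : ℕ) (p : List ℕ) (acc : List (List ℕ)) (Q : List ℕ), Q ∈ acc →
      Q ∈ enum two bn it m r x p acc := by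
  induction it with
  | nil => intro m r x p acc Q h; exact mem_leaf_of_mem h
  | cons a T l ih =>
    intro m r x p acc Q h
    exact mem_step_of_mem ih _ _ _ _ _ _ _ _ _ _ h

/-- The new code of a coordinate with code `a` and coefficient `c`. -/
def newCode (s : ℕ × ℤ) : ℕ := (8 * (s.1 : ℤ) + s.2).toNat

theorem mem_enum {two : Bool} {bn F : List ℕ} :
    ∀ (ps : List (ℕ × ℤ)) (m r prev : ℕ) (path : List ℕ) (acc : List (List ℕ)),
      (∀ s ∈ ps, 0 < s.1 ∧ |s.2| ≤ bound two) →
      ps.Pairwise (fun s t => newCode t ≤ newCode s) →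
      (∀ s ∈ ps, newCode s ≤ prev) →
      (ps.map fun s => s.2.natAbs ^ 2).sum ≤ m →
      IsFresh two (m - (ps.map fun s => s.2.natAbs ^ 2).sum) F →
      (r : ℤ) = (ps.map fun s => (s.2 + (bound two : ℤ)) * (s.1 : ℤ)).sum →
      F ++ merge ((ps.map newCode).reverse ++ path) bn ∈
        enum two bn (toItems (bound two) (ps.map Prod.fst)) m r prev path acc
  | [], m, r, prev, path, acc, _, _, _, _, hF, hr => by
    exact mem_leaf (by simpa using hF)
  | s :: ps, m, r, prev, path, acc, hps, hs, hprev, hm, hF, hr => by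
    obtain ⟨a, c⟩ := s
    have hac := hps (a, c) List.mem_cons_self
    rw [List.pairwise_cons] at hs
    simp only [List.map_cons, List.sum_cons] at hm hF hr
    obtain ⟨j, hj⟩ : ∃ j : ℕ, (j : ℤ) = c + bound two :=
      ⟨(c + bound two).toNat, by have := abs_le.1 hac.2; simp at this ⊢; omega⟩
    have h0 : ∀ qs : List (ℕ × ℤ), (∀ s ∈ qs, 0 < s.1 ∧ |s.2| ≤ bound two) →
        0 ≤ (qs.map fun s => (s.2 + bound two) * (s.1 : ℤ)).sum ∧
        (qs.map fun s => (s.2 + bound two) * (s.1 : ℤ)).sum ≤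
          2 * bound two * ((qs.map Prod.fst).sum : ℕ) := by
      intro qs
      induction qs with
      | nil => simp
      | cons q qs ih =>
        intro hq
        have h1 := ih fun s hs => hq s (List.mem_cons_of_mem _ hs)
        have h2 := abs_le.1 (hq q List.mem_cons_self).2
        simp only [List.map_cons, List.sum_cons]
        push_cast
        push_cast at h1
        constructor
        · have : 0 ≤ (q.2 + (bound two : ℤ)) * q.1 := mul_nonneg (by linarith) (by positivity)
          linarith
        · have : (q.2 + (bound two : ℤ)) * q.1 ≤ (2 * bound two) * q.1 :=
            mul_le_mul_of_nonneg_right (by linarith) (by positivity)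
          linarith
    have h1 := h0 ps fun s hs => hps s (List.mem_cons_of_mem _ hs)
    rw [← hj] at hr
    have hja : j * a ≤ r := by zify; linarith
    have hcode : newCode (a, c) = 8 * a + j - bound two := by
      unfold newCode
      have : 0 < a := hac.1
      have hb : bound two ≤ 2 := by cases two <;> simp [bound]
      simp only
      omega
    refine mem_step (mem_enum_of_mem _) (j := j) (k := c.natAbs ^ 2) ?_ (by omega) hja ?_ ?_ ?_
    · have h2 := abs_le.1 hac.2
      cases two with
      | false =>
        simp only [bound, Nat.cast_one] at hj h2
        have : c = -1 ∨ c = 0 ∨ c = 1 := by omega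
        rcases this with rfl | rfl | rfl
        · have : j = 0 := by omega
          subst this; simp [choices]
        · have : j = 1 := by omega
          subst this; simp [choices]
        · have : j = 2 := by omega
          subst this; simp [choices]
      | true =>
        simp only [bound, Nat.cast_ofNat] at hj h2
        have : c = -2 ∨ c = -1 ∨ c = 0 ∨ c = 1 ∨ c = 2 := by omega
        rcases this with rfl | rfl | rfl | rfl | rfl
        · have : j = 0 := by omega
          subst this; simp [choices]
        · have : j = 1 := by omega
          subst this; simp [choices]
        · have : j = 2 := by omega
          subst this; simp [choices]
        · have : j = 3 := by omega
          subst this; simp [choices]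
        · have : j = 4 := by omega
          subst this; simp [choices]
    · rw [← hcode]; exact hprev _ List.mem_cons_self
    · zify [hja]; push_cast at h1; linarith
    · intro acc
      rw [← hcode]
      have := mem_enum (two := two) (bn := bn) (F := F) ps (m - c.natAbs ^ 2) (r - j * a)
        (newCode (a, c)) (newCode (a, c) :: path) acc
        (fun s hs => hps s (List.mem_cons_of_mem _ hs)) hs.2 hs.1 (by omega)
        (by rwa [Nat.sub_sub]) (by push_cast [hja]; linarith)
      rw [List.map_cons, List.reverse_cons, List.append_assoc]
      exact this

theorem mem_start_of_mem {two : Bool} {it : Items} {S m p q : ℕ} {bn : List ℕ}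
    {acc : List (List ℕ)} {Q : List ℕ} (h : Q ∈ acc) : Q ∈ start two it S m p q bn acc := by
  unfold start
  cases Nat.ble q (Nat.add p S) with
  | false => exact h
  | true =>
    cases Nat.ble p (Nat.add q S) with
    | false => exact h
    | true => exact mem_enum_of_mem _ _ _ _ _ _ _ h

theorem newCode_add_one_le {two : Bool} {s : ℕ × ℤ} (h : |s.2| ≤ bound two) :
    newCode s ≤ 8 * s.1 + 2 := by
  have := abs_le.1 h
  have hb : bound two ≤ 2 := by cases two <;> simp [bound]
  unfold newCode
  omega

theorem mem_start {two : Bool} {bn F : List ℕ} {ps : List (ℕ × ℤ)} {m p q : ℕ}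
    {acc : List (List ℕ)}
    (hps : ∀ s ∈ ps, 0 < s.1 ∧ |s.2| ≤ bound two)
    (hs : ps.Pairwise (fun s t => newCode t ≤ newCode s))
    (hm : (ps.map fun s => s.2.natAbs ^ 2).sum ≤ m)
    (hF : IsFresh two (m - (ps.map fun s => s.2.natAbs ^ 2).sum) F)
    (hr : (ps.map fun s => s.2 * (s.1 : ℤ)).sum = (p : ℤ) - q) :
    F ++ merge ((ps.map newCode).reverse) bn ∈
      start two (toItems (bound two) (ps.map Prod.fst)) (bound two * (ps.map Prod.fst).sum)
        m p q bn acc := by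
  have key : ∀ qs : List (ℕ × ℤ), (∀ s ∈ qs, 0 < s.1 ∧ |s.2| ≤ bound two) →
      |(qs.map fun s => s.2 * (s.1 : ℤ)).sum| ≤ bound two * ((qs.map Prod.fst).sum : ℕ) ∧
      (qs.map fun s => (s.2 + (bound two : ℤ)) * (s.1 : ℤ)).sum =
        (qs.map fun s => s.2 * (s.1 : ℤ)).sum + bound two * ((qs.map Prod.fst).sum : ℕ) ∧
      ∀ s ∈ qs, s.1 ≤ (qs.map Prod.fst).sum := by
    intro qs
    induction qs with
    | nil => simp
    | cons s qs ih =>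
      intro h
      obtain ⟨h1, h2, h3⟩ := ih fun t ht => h t (List.mem_cons_of_mem _ ht)
      have h4 := (h s List.mem_cons_self).2
      simp only [List.map_cons, List.sum_cons]
      refine ⟨?_, ?_, ?_⟩
      · push_cast
        have h5 : |s.2 * (s.1 : ℤ)| ≤ bound two * s.1 := by
          rw [abs_mul, Nat.abs_cast]
          exact mul_le_mul_of_nonneg_right h4 (by positivity)
        have := abs_add_le (s.2 * (s.1 : ℤ)) (qs.map fun s => s.2 * (s.1 : ℤ)).sum
        push_cast at h1
        linarith
      · rw [h2]; push_cast; ring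
      · intro t ht
        rcases List.mem_cons.1 ht with rfl | ht
        · omega
        · have := h3 t ht; omega
  obtain ⟨h1, h2, h3⟩ := key ps hps
  set S := bound two * (ps.map Prod.fst).sum with hS
  have hS' : ((S : ℕ) : ℤ) = bound two * ((ps.map Prod.fst).sum : ℕ) := by rw [hS]; push_cast; ring
  rw [← hS', hr] at h1
  rw [← hS', hr] at h2
  have h4 := abs_le.1 h1
  have e1 : Nat.ble q (Nat.add p S) = true :=
    Nat.ble_eq_true_of_le (show q ≤ p + S by zify; linarith)
  have e2 : Nat.ble p (Nat.add q S) = true :=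
    Nat.ble_eq_true_of_le (show p ≤ q + S by zify; linarith)
  have hb : 1 ≤ bound two := by cases two <;> simp [bound]
  unfold start
  rw [e1, e2]
  have := mem_enum (two := two) (bn := bn) (F := F) ps m (S + p - q) (8 * S + 8) [] acc hps hs
    (fun s hs' => by
      have h5 := newCode_add_one_le (hps s hs').2
      have h6 := h3 s hs'
      have h7 : (ps.map Prod.fst).sum ≤ S := by rw [hS]; exact Nat.le_mul_of_pos_left _ hb
      omega) hm hF (by rw [h2]; zify [show q ≤ S + p by omega]; ring)
  rw [List.append_nil] at this
  exact this

theorem mem_pick_of_mem {two : Bool} {it : Items} {S k m : ℕ} (ns : Nbrs) :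
    ∀ {pr : List ℕ → List ℕ} {acc : List (List ℕ)} {Q : List ℕ}, Q ∈ acc →
      Q ∈ pick two it S k m ns pr acc := by
  induction ns with
  | nil => intro pr acc Q h; exact h
  | cons s l ih =>
    intro pr acc Q h
    obtain ⟨a, sg⟩ := s
    refine ih ?_
    cases sg with
    | false => exact mem_start_of_mem h
    | true => exact mem_start_of_mem h

theorem mem_pick {two : Bool} {it : Items} {S k m : ℕ} {Q : List ℕ} {a : ℕ} {sg : Bool}
    (l₂ : Nbrs) : ∀ (l₁ : Nbrs) {pr : List ℕ → List ℕ} {acc : List (List ℕ)},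
      (∀ acc, Q ∈ start two it S m (if sg then a else 0) (if sg then k else k + a)
        (pr (eights l₁ ++ (if sg then 8 * a - 1 else 8 * a + 1) :: eights l₂)) acc) →
      Q ∈ pick two it S k m (l₁ ++ (a, sg) :: l₂) pr acc
  | [], pr, acc, h => by
    refine mem_pick_of_mem l₂ ?_
    cases sg with
    | false => exact h acc
    | true => exact h acc
  | s :: l₁, pr, acc, h => by
    obtain ⟨b, sb⟩ := s
    exact mem_pick l₂ l₁ h

theorem prepWith_eq {e : ℕ} {f g h : ℕ → Bool} :
    ∀ (M l : List ℕ) (b : List ℕ → List ℕ),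
      prepWith e f g h M (e * l.sum) (toItems e l) b =
        ⟨toItems e ((M.filter fun a => f a && g a).reverse ++ l),
          e * ((M.filter fun a => f a && g a).reverse ++ l).sum,
          b ((M.filter fun a => !f a).map (8 * ·)),
          (M.filter fun a => f a && !g a).map fun a => (a, h a)⟩
  | [], l, b => rfl
  | a :: M, l, b => by
    change (Bool.rec (prepWith e f g h M (e * l.sum) (toItems e l)
          (fun t => b (List.cons (8 * a) t)))
        (Bool.rec
          (Prep.rec (fun it S b ns => Prep.mk it S b (List.cons (Prod.mk a (h a)) ns))
            (prepWith e f g h M (e * l.sum) (toItems e l) b))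
          (prepWith e f g h M (e * l.sum + e * a) (toItems e (a :: l)) b) (g a)) (f a) : Prep) = _
    cases h1 : f a with
    | false =>
      simp only [prepWith_eq M l, List.filter_cons, h1]
      simp
    | true =>
      cases h2 : g a with
      | false =>
        simp only [prepWith_eq M l, List.filter_cons, h1, h2]
        simp
      | true =>
        have e5 : e * l.sum + e * a = e * (a :: l).sum := by rw [List.sum_cons]; ring
        simp only [e5, prepWith_eq M (a :: l), List.filter_cons, h1, h2]
        simp

theorem mem_sols1_of_mem {two : Bool} {P : Prep} {k w : ℕ} {nb : Bool} {acc : List (List ℕ)}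
    {Q : List ℕ} (h : Q ∈ acc) : Q ∈ sols1 two P k w nb acc := by
  obtain ⟨it, S, b, ns⟩ := P
  cases nb with
  | false =>
    change Q ∈ start two it S w 0 k b acc
    exact mem_start_of_mem h
  | true =>
    cases w with
    | zero => exact h
    | succ m => exact mem_pick_of_mem _ h

theorem mem_sols {two : Bool} {e bm bh nk nh k w : ℕ} {nb : Bool} {M Q : List ℕ}
    {Ms : List (List ℕ)} (hM : M ∈ Ms)
    (h : ∀ acc, Q ∈ sols1 two (prep e bm bh nk nh M 0 Items.nil fun t => t) k w nb acc) :
    Q ∈ sols two k w nb (preps e bm bh nk nh Ms) := by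
  induction Ms with
  | nil => cases hM
  | cons M' Ms ih =>
    rcases List.mem_cons.1 hM with rfl | hM
    · exact h _
    · exact mem_sols1_of_mem (ih hM)

theorem eights_eq (l : List ℕ) (f : ℕ → Bool) :
    eights (l.map fun a => (a, f a)) = l.map (8 * ·) := by
  induction l with
  | nil => rfl
  | cons a l ih => exact congrArg _ ih

theorem newCode_zero (a : ℕ) : newCode (a, 0) = 8 * a := by
  unfold newCode; simp; omega

theorem fst_le_of_newCode_le {two : Bool} {s t : ℕ × ℤ} (hs : |s.2| ≤ bound two)
    (ht : |t.2| ≤ bound two) (h : newCode s ≤ newCode t) : s.1 ≤ t.1 := by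
  have h1 := abs_le.1 hs
  have h2 := abs_le.1 ht
  have hb : bound two ≤ 2 := by cases two <;> simp [bound]
  unfold newCode at h
  omega

theorem filter_three_perm {α : Type} (f g : α → Bool) (l : List α) :
    (l.filter (fun a => f a && g a) ++ (l.filter (fun a => !f a) ++
      l.filter (fun a => f a && !g a))).Perm l := by
  induction l with
  | nil => simp
  | cons a l ih =>
    cases h1 : f a with
    | false =>
      simp only [List.filter_cons, h1]
      simp only [Bool.false_and, Bool.false_eq_true, if_false, Bool.not_false, if_true]
      exact List.perm_middle.trans (ih.cons a)
    | true =>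
      cases h2 : g a with
      | false =>
        simp only [List.filter_cons, h1, h2]
        simp only [Bool.true_and, Bool.false_eq_true, if_false, Bool.not_false, if_true,
          Bool.not_true]
        rw [← List.append_assoc]
        refine List.perm_middle.trans (List.Perm.cons a ?_)
        rw [List.append_assoc]
        exact ih
      | true =>
        simp only [List.filter_cons, h1, h2]
        simp only [Bool.true_and, Bool.false_eq_true, if_false, if_true,
          Bool.not_true]
        exact ih.cons a

theorem IsFresh.le_two {two : Bool} {m : ℕ} {F : List ℕ} (h : IsFresh two m F) :
    ∀ x ∈ F, x ≤ 2 := by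
  rcases h with rfl | ⟨-, -, rfl⟩
  · intro x hx; rw [List.eq_of_mem_replicate hx]; omega
  · intro x hx
    rcases List.mem_append.1 hx with hx | hx
    · rw [List.eq_of_mem_replicate hx]; omega
    · rw [List.mem_singleton.1 hx]

theorem IsFresh.sorted {two : Bool} {m : ℕ} {F : List ℕ} (h : IsFresh two m F) :
    F.Pairwise (· ≤ ·) := by
  rcases h with rfl | ⟨-, -, rfl⟩
  · exact List.pairwise_replicate.2 (Or.inr le_rfl)
  · refine List.pairwise_append.2 ⟨List.pairwise_replicate.2 (Or.inr le_rfl), by simp, ?_⟩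
    intro x hx y hy
    rw [List.eq_of_mem_replicate hx, List.mem_singleton.1 hy]; omega

theorem mem_sols1 {two nb : Bool} {f g h : ℕ → Bool} {ps : List (ℕ × ℤ)} {k w : ℕ} {F : List ℕ}
    (hs : ps.Pairwise fun s t => newCode s ≤ newCode t)
    (hps : ∀ s ∈ ps, 0 < s.1 ∧ |s.2| ≤ bound two)
    (hf : ∀ s ∈ ps, f s.1 = false → s.2 = 0)
    (hm : (ps.map fun s => s.2.natAbs ^ 2).sum ≤ w)
    (hF : IsFresh two (w - (ps.map fun s => s.2.natAbs ^ 2).sum) F)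
    (hr : (ps.map fun s => s.2 * (s.1 : ℤ)).sum = -(k : ℤ))
    (h₀ : nb = false → ∀ s ∈ ps, (f s.1 && !g s.1) = false)
    (h₁ : nb = true → ∃ l₁ l₂ a, (ps.filter fun s => f s.1 && !g s.1) =
      l₁ ++ (a, if h a then (-1 : ℤ) else 1) :: l₂ ∧ (∀ s ∈ l₁, s.2 = 0) ∧ ∀ s ∈ l₂, s.2 = 0) :
    ∃ Q : List ℕ, Q.Perm (F ++ ps.map newCode) ∧ Q.Pairwise (· ≤ ·) ∧
      ∀ acc, Q ∈ sols1 two (prepWith (bound two) f g h (ps.map Prod.fst) 0 Items.nil fun t => t)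
        k w nb acc := by
  have hperm := filter_three_perm (fun s : ℕ × ℤ => f s.1) (fun s => g s.1) ps
  set fr := ps.filter fun s => f s.1 && g s.1 with hfr
  set bl := ps.filter fun s => !f s.1 with hbl
  set nl := ps.filter fun s => f s.1 && !g s.1 with hnl
  have hfr' : ∀ s ∈ fr, s ∈ ps := fun s hs => (List.mem_filter.1 hs).1
  have hbl0 : ∀ s ∈ bl, s.2 = 0 := fun s hs => by
    have := List.mem_filter.1 hs
    exact hf s this.1 (by simpa using this.2)
  have e0 := prepWith_eq (e := bound two) (f := f) (g := g) (h := h) (ps.map Prod.fst) []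
    (fun t => t)
  rw [List.append_nil, List.filter_map, List.filter_map, List.filter_map] at e0
  change prepWith (bound two) f g h (ps.map Prod.fst) 0 Items.nil _ =
    ⟨toItems _ (fr.map Prod.fst).reverse, _ * (fr.map Prod.fst).reverse.sum,
      (bl.map Prod.fst).map (8 * ·), (nl.map Prod.fst).map fun a => (a, h a)⟩ at e0
  rw [← List.map_reverse] at e0
  have hbe : (bl.map Prod.fst).map (8 * ·) = bl.map newCode := by
    rw [List.map_map]
    refine List.map_congr_left fun s hs => ?_
    obtain ⟨a, c⟩ := s
    have : c = 0 := hbl0 _ hs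
    subst this
    exact (newCode_zero a).symm
  rw [hbe] at e0
  have hsq := (hperm.map fun s : ℕ × ℤ => s.2.natAbs ^ 2).sum_eq
  have hsm := (hperm.map fun s : ℕ × ℤ => s.2 * (s.1 : ℤ)).sum_eq
  simp only [List.map_append, List.sum_append] at hsq hsm
  have hz : ∀ l : List (ℕ × ℤ), (∀ s ∈ l, s.2 = 0) →
      (l.map fun s => s.2.natAbs ^ 2).sum = 0 ∧ (l.map fun s => s.2 * (s.1 : ℤ)).sum = 0 := by
    intro l hl
    constructor
    · rw [List.sum_eq_zero]
      intro x hx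
      obtain ⟨s, hs, rfl⟩ := List.mem_map.1 hx
      simp [hl s hs]
    · rw [List.sum_eq_zero]
      intro x hx
      obtain ⟨s, hs, rfl⟩ := List.mem_map.1 hx
      simp [hl s hs]
  obtain ⟨hz1, hz2⟩ := hz bl hbl0
  rw [hz1] at hsq
  rw [hz2] at hsm
  have hF2 : ∀ x ∈ F, x ≤ 2 := hF.le_two
  have hFs : F.Pairwise (· ≤ ·) := hF.sorted
  have hb : bound two ≤ 2 := by cases two <;> simp [bound]
  have fin : ∀ bn : List ℕ, bn.Perm (bl.map newCode ++ nl.map newCode) →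
      bn.Pairwise (· ≤ ·) →
      (F ++ merge ((fr.reverse.map newCode).reverse) bn).Perm (F ++ ps.map newCode) ∧
      (F ++ merge ((fr.reverse.map newCode).reverse) bn).Pairwise (· ≤ ·) := by
    intro bn h1 h2
    have h3 : (fr.reverse.map newCode).reverse = fr.map newCode := by
      rw [List.map_reverse, List.reverse_reverse]
    rw [h3]
    have h4 : (merge (fr.map newCode) bn).Perm (ps.map newCode) := by
      refine (merge_perm _ _).trans ((h1.append_left _).trans ?_)
      rw [← List.map_append, ← List.map_append]
      exact hperm.map _
    refine ⟨h4.append_left _, ?_⟩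
    rw [List.pairwise_append]
    refine ⟨hFs, merge_sorted _ _ ?_ h2, ?_⟩
    · rw [List.pairwise_map]
      exact hs.filter _
    · intro x hx y hy
      obtain ⟨s, hs', rfl⟩ := List.mem_map.1 (h4.subset hy)
      have h5 := hF2 x hx
      obtain ⟨h6, h7⟩ := hps s hs'
      have := abs_le.1 h7
      unfold newCode
      omega
  have hbs : (bl.map newCode).Pairwise (· ≤ ·) := by
    rw [List.pairwise_map]; exact hs.filter _
  have hns : (nl.map newCode).Pairwise (· ≤ ·) := by
    rw [List.pairwise_map]; exact hs.filter _
  have hrs : fr.reverse.Pairwise fun s t => newCode t ≤ newCode s := by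
    rw [List.pairwise_reverse]; exact hs.filter _
  have hrp : ∀ s ∈ fr.reverse, 0 < s.1 ∧ |s.2| ≤ bound two := fun s hs =>
    hps s (hfr' s (List.mem_reverse.1 hs))
  have hrev1 : (fr.reverse.map fun s => s.2.natAbs ^ 2).sum =
    (fr.map fun s => s.2.natAbs ^ 2).sum := ((List.reverse_perm fr).map _).sum_eq
  have hrev2 : (fr.reverse.map fun s => s.2 * (s.1 : ℤ)).sum =
    (fr.map fun s => s.2 * (s.1 : ℤ)).sum := ((List.reverse_perm fr).map _).sum_eq
  cases nb with
  | false =>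
    have hn : nl = [] := by
      rw [hnl, List.filter_eq_nil_iff]
      intro s hs'
      rw [h₀ rfl s hs']; simp
    rw [hn] at hsq hsm
    obtain ⟨f1, f2⟩ := fin (bl.map newCode) (by rw [hn]; simp) hbs
    refine ⟨_, f1, f2, fun acc => ?_⟩
    rw [e0]
    change _ ∈ start two (toItems _ _) _ w 0 k (bl.map newCode) acc
    refine mem_start hrp hrs ?_ ?_ ?_
    · rw [hrev1]; simp at hsq; omega
    · rw [hrev1]
      simp at hsq
      rw [hsq]; exact hF
    · rw [hrev2]; simp at hsm; rw [hsm, hr]; simp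
  | true =>
    obtain ⟨l₁, l₂, a, hl, hl1, hl2⟩ := h₁ rfl
    change nl = _ at hl
    obtain ⟨z1, z2⟩ := hz l₁ hl1
    obtain ⟨z3, z4⟩ := hz l₂ hl2
    rw [hl] at hsq hsm
    simp only [List.map_append, List.sum_append, List.map_cons, List.sum_cons, z1, z2, z3, z4]
      at hsq hsm
    have hone : (if h a then (-1 : ℤ) else 1).natAbs ^ 2 = 1 := by split <;> rfl
    rw [hone] at hsq
    obtain ⟨m, rfl⟩ : ∃ m, w = m + 1 := ⟨w - 1, by omega⟩
    have ha : 0 < a := by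
      have : (a, if h a then (-1 : ℤ) else 1) ∈ nl := by rw [hl]; simp
      exact (hps _ (List.mem_filter.1 this).1).1
    have he : ∀ l : List (ℕ × ℤ), (∀ s ∈ l, s.2 = 0) →
        eights ((l.map Prod.fst).map fun a => (a, h a)) = l.map newCode := by
      intro l hl
      rw [eights_eq, List.map_map]
      refine List.map_congr_left fun s hs => ?_
      obtain ⟨a, c⟩ := s
      have : c = 0 := hl _ hs
      subst this
      exact (newCode_zero a).symm
    have hx : (if h a then 8 * a - 1 else 8 * a + 1) =
        newCode (a, if h a then (-1 : ℤ) else 1) := by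
      unfold newCode
      split <;> simp only [] <;> omega
    have hmid : eights ((l₁.map Prod.fst).map fun a => (a, h a)) ++
        (if h a then 8 * a - 1 else 8 * a + 1) ::
        eights ((l₂.map Prod.fst).map fun a => (a, h a)) = nl.map newCode := by
      rw [he _ hl1, he _ hl2, hx, hl]
      simp
    obtain ⟨f1, f2⟩ := fin (merge (nl.map newCode) (bl.map newCode))
      ((merge_perm _ _).trans List.perm_append_comm) (merge_sorted _ _ hns hbs)
    refine ⟨_, f1, f2, fun acc => ?_⟩
    rw [e0]
    change _ ∈ pick _ _ _ _ _ _ _ _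
    have hnm : (nl.map Prod.fst).map (fun a => (a, h a)) =
        (l₁.map Prod.fst).map (fun a => (a, h a)) ++ (a, h a) ::
          (l₂.map Prod.fst).map (fun a => (a, h a)) := by
      rw [hl]; simp
    rw [hnm]
    refine mem_pick _ _ fun acc => ?_
    rw [hmid]
    refine mem_start hrp hrs ?_ ?_ ?_
    · rw [hrev1]; omega
    · rw [hrev1]
      have : m - (fr.map fun s => s.2.natAbs ^ 2).sum =
        m + 1 - (ps.map fun s => s.2.natAbs ^ 2).sum := by omega
      rw [this]; exact hF
    · rw [hrev2]
      rw [hr] at hsm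
      by_cases hh : h a = true
      · simp only [hh, if_true] at hsm ⊢; linarith
      · simp only [hh, if_false, Bool.false_eq_true] at hsm ⊢; push_cast; linarith

section

open Finset

variable {N : ℕ}

theorem add_eight_mul_and {x y u v : ℕ} (hx : x < 8) (hy : y < 8) :
    (x + 8 * u) &&& (y + 8 * v) = (x &&& y) + 8 * (u &&& v) := by
  have h1 := Nat.and_mod_two_pow (a := x + 8 * u) (b := y + 8 * v) (n := 3)
  have h2 := Nat.and_div_two_pow (a := x + 8 * u) (b := y + 8 * v) (n := 3)
  have e1 : (x + 8 * u) % 2 ^ 3 = x := by omega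
  have e2 : (y + 8 * v) % 2 ^ 3 = y := by omega
  have e3 : (x + 8 * u) / 2 ^ 3 = u := by omega
  have e4 : (y + 8 * v) / 2 ^ 3 = v := by omega
  rw [e1, e2] at h1
  rw [e3, e4] at h2
  omega

theorem sum_and_sum (K : ℕ) : ∀ (f : ℕ → ℕ) (c : ℕ → Prop) [DecidablePred c], (∀ j, f j < 8) →
    (∑ j ∈ range K, f j * 8 ^ j) &&& (7 * ∑ j ∈ range K, if c j then 8 ^ j else 0) =
      ∑ j ∈ range K, if c j then f j * 8 ^ j else 0 := by
  induction K with
  | zero => intro f c _ _; simp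
  | succ K ih =>
    intro f c _ hf
    have e1 : ∑ j ∈ range (K + 1), f j * 8 ^ j =
        f 0 + 8 * ∑ j ∈ range K, f (j + 1) * 8 ^ j := by
      rw [sum_range_succ', mul_sum]
      simp only [pow_succ, pow_zero, mul_one]
      rw [add_comm]; congr 1
      exact sum_congr rfl fun j _ => by ring
    have e2 : 7 * (∑ j ∈ range (K + 1), if c j then 8 ^ j else 0) =
        (if c 0 then 7 else 0) + 8 * (7 * ∑ j ∈ range K, if c (j + 1) then 8 ^ j else 0) := by
      rw [sum_range_succ', mul_add, add_comm]
      congr 1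
      · split <;> simp
      · rw [mul_left_comm, mul_sum (a := 8)]
        congr 1
        exact sum_congr rfl fun j _ => by split <;> ring
    have e3 : (∑ j ∈ range (K + 1), if c j then f j * 8 ^ j else 0) =
        (if c 0 then f 0 else 0) +
          8 * ∑ j ∈ range K, if c (j + 1) then f (j + 1) * 8 ^ j else 0 := by
      rw [sum_range_succ', add_comm, mul_sum]
      congr 1
      · simp
      · exact sum_congr rfl fun j _ => by split <;> ring
    have h7 : f 0 &&& 7 = f 0 := by
      have := Nat.and_two_pow_sub_one_eq_mod (f 0) 3
      have h := hf 0
      norm_num at this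
      omega
    rw [e1, e2, e3, add_eight_mul_and (hf 0) (by split <;> omega),
      ih (fun j => f (j + 1)) (fun j => c (j + 1)) fun j => hf _]
    congr 1
    split
    · exact h7
    · simp

/-- The integer with the given signed digits in base 8, least significant first. -/
def value : List ℤ → ℤ
  | [] => 0
  | d :: l => d + 8 * value l

theorem sum_getD_eq_value : ∀ (l : List ℤ) (K : ℕ), l.length ≤ K →
    ∑ j ∈ range K, l.getD j 0 * 8 ^ j = value l
  | [], K, _ => by simp [value]
  | d :: l, 0, h => by simp at h
  | d :: l, K + 1, h => by
    rw [sum_range_succ', value, ← sum_getD_eq_value l K (by simpa using h), mul_sum, add_comm]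
    congr 1
    · simp
    · exact sum_congr rfl fun j _ => by rw [List.getD_cons_succ]; ring

theorem abs_getD_le {l : List ℤ} {b : ℤ} (hb : 0 ≤ b) (h : ∀ d ∈ l, |d| ≤ b) (j : ℕ) :
    |l.getD j 0| ≤ b := by
  rw [List.getD_eq_getElem?_getD]
  cases h' : l[j]? with
  | none => simpa using hb
  | some d => exact h d (List.mem_of_getElem? h')

theorem value_eq_zero : ∀ {l : List ℤ}, (∀ d ∈ l, |d| ≤ 3) → value l = 0 → ∀ d ∈ l, d = 0
  | [], _, _, d, hd => by cases hd
  | x :: l, h, h0, d, hd => by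
    have hx := abs_le.1 (h x List.mem_cons_self)
    rw [value] at h0
    have h1 : value l = 0 := by omega
    rcases List.mem_cons.1 hd with rfl | hd
    · omega
    · exact value_eq_zero (fun d hd => h d (List.mem_cons_of_mem _ hd)) h1 d hd

theorem shift_eq (a : ℕ) : shift a = a + ∑ j ∈ range 20, 4 * 8 ^ j := by
  have : ∑ j ∈ range 20, 4 * 8 ^ j = 658812288346769700 := by decide +kernel
  rw [this, shift]

theorem land_shift {l : List ℤ} {a : ℕ} {J : Finset ℕ} (hl : l.length ≤ 20)
    (hd : ∀ d ∈ l, |d| ≤ 3) (ha : value l = a) (hJ : ∀ j ∈ J, j < 20) :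
    Nat.land (shift a) (Nat.mul 7 (∑ j ∈ J, 8 ^ j)) =
      ∑ j ∈ J, (l.getD j 0 + 4).toNat * 8 ^ j := by
  have hb := fun j => abs_le.1 (abs_getD_le (by norm_num) hd j)
  have e1 : shift a = ∑ j ∈ range 20, (l.getD j 0 + 4).toNat * 8 ^ j := by
    rw [shift_eq]
    zify
    rw [← ha, ← sum_getD_eq_value l 20 hl, ← sum_add_distrib]
    refine sum_congr rfl fun j _ => ?_
    rw [Int.toNat_of_nonneg (by have := hb j; omega)]
    ring
  have e2 : ∀ f : ℕ → ℕ, ∑ j ∈ J, f j = ∑ j ∈ range 20, if j ∈ J then f j else 0 := by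
    intro f
    rw [← sum_filter]
    refine sum_congr ?_ fun _ _ => rfl
    ext j
    simp only [mem_filter, mem_range]
    exact ⟨fun h => ⟨hJ j h, h⟩, fun h => h.2⟩
  rw [e1, e2, e2]
  exact sum_and_sum 20 _ _ fun j => by have := hb j; omega

theorem land_shift_of_eq_zero {l : List ℤ} {a : ℕ} {J : Finset ℕ} (hl : l.length ≤ 20)
    (hd : ∀ d ∈ l, |d| ≤ 3) (ha : value l = a) (hJ : ∀ j ∈ J, j < 20)
    (h : ∀ j ∈ J, l.getD j 0 = 0) :
    Nat.land (shift a) (Nat.mul 7 (∑ j ∈ J, 8 ^ j)) = Nat.mul 4 (∑ j ∈ J, 8 ^ j) := by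
  rw [land_shift hl hd ha hJ]
  change _ = 4 * _
  rw [mul_sum]
  exact sum_congr rfl fun j hj => by rw [h j hj]; rfl

theorem land_shift_singleton {l : List ℤ} {a j : ℕ} (hl : l.length ≤ 20)
    (hd : ∀ d ∈ l, |d| ≤ 3) (ha : value l = a) (hj : j < 20) :
    Nat.land (shift a) (Nat.mul 7 (8 ^ j)) = (l.getD j 0 + 4).toNat * 8 ^ j := by
  have := land_shift (J := {j}) hl hd ha (by simpa using hj)
  simpa using this

theorem land_beq_singleton {l : List ℤ} {a j : ℕ} (hl : l.length ≤ 20)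
    (hd : ∀ d ∈ l, |d| ≤ 3) (ha : value l = a) (hj : j < 20) :
    Nat.beq (Nat.land (shift a) (Nat.mul 7 (8 ^ j))) (Nat.mul 4 (8 ^ j)) = true ↔
      l.getD j 0 = 0 := by
  rw [Nat.beq_eq, land_shift_singleton hl hd ha hj]
  have := abs_le.1 (abs_getD_le (by norm_num) hd j)
  change _ = 4 * 8 ^ j ↔ _
  rw [Nat.mul_left_inj (by positivity)]
  omega

theorem land_ble_singleton {l : List ℤ} {a j : ℕ} (hl : l.length ≤ 20)
    (hd : ∀ d ∈ l, |d| ≤ 3) (ha : value l = a) (hj : j < 20) :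
    Nat.ble (Nat.land (shift a) (Nat.mul 7 (8 ^ j))) (Nat.mul 4 (8 ^ j)) = true ↔
      l.getD j 0 ≤ 0 := by
  rw [Nat.ble_eq, land_shift_singleton hl hd ha hj]
  have := abs_le.1 (abs_getD_le (by norm_num) hd j)
  change _ ≤ 4 * 8 ^ j ↔ _
  rw [Nat.mul_le_mul_right_iff (by positivity)]
  omega

theorem notB_eq (b : Bool) : notB b = !b := by cases b <;> rfl

theorem digitNZ_eq (m a : ℕ) :
    digitNZ m a = !(Nat.beq (Nat.land (shift a) (Nat.mul 7 m)) (Nat.mul 4 m)) :=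
  notB_eq _

theorem digitNZ_iff {l : List ℤ} {a j : ℕ} (hl : l.length ≤ 20)
    (hd : ∀ d ∈ l, |d| ≤ 3) (ha : value l = a) (hj : j < 20) :
    digitNZ (8 ^ j) a = true ↔ l.getD j 0 ≠ 0 := by
  rw [digitNZ_eq, Bool.not_eq_true', ← Bool.not_eq_true, land_beq_singleton hl hd ha hj]

/-- The values at a coordinate of a list of vectors, as an integer in base 8. -/
def code (Y : List (Fin N → ℤ)) (e : Fin N) : ℤ := value (Y.map fun y => y e)

theorem code_cons (y : Fin N → ℤ) (Y : List (Fin N → ℤ)) (e : Fin N) :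
    code (y :: Y) e = y e + 8 * code Y e := rfl

/-- The list `M` represents the vectors `Y` up to signed permutations of the coordinates. -/
def Rep (Y : List (Fin N → ℤ)) (M : List ℕ) : Prop :=
  ∃ cs : List (Fin N), cs.Nodup ∧ (∀ e, e ∈ cs ↔ code Y e ≠ 0) ∧
    M = cs.map (fun e => (code Y e).natAbs) ∧ M.Pairwise (· ≤ ·)

theorem exists_map_of_perm {α β : Type} {f : α → β} {Q : List β} {l : List α}
    (h : Q.Perm (l.map f)) : ∃ l' : List α, l'.Perm l ∧ Q = l'.map f := by
  have : (fun u v => List.Perm u (List.map f v)) Q l := h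
  rw [← List.eq_map_comp_perm] at this
  obtain ⟨l', h1, h2⟩ := this
  exact ⟨l', h2, h1⟩

theorem exists_perm_sorted {α : Type} (r : α → ℕ) (l : List α) :
    ∃ l' : List α, l'.Perm l ∧ l'.Pairwise (fun a b => r a ≤ r b) := by
  have : Std.Total (fun a b : α => r a ≤ r b) := ⟨fun s t => le_total _ _⟩
  have : IsTrans α (fun a b : α => r a ≤ r b) := ⟨fun a b c h1 h2 => h1.trans h2⟩
  exact ⟨l.insertionSort fun a b => r a ≤ r b, List.perm_insertionSort _ _,
    List.pairwise_insertionSort _ _⟩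

theorem exists_isFresh {two : Bool} : ∀ {l : List ℕ},
    (∀ a ∈ l, 1 ≤ a ∧ a ≤ bound two) → (l.map (· ^ 2)).sum ≤ 7 →
    ∃ F, IsFresh two (l.map (· ^ 2)).sum F ∧ F.Perm l := by
  intro l hl hs
  have hone : ∀ l : List ℕ, (∀ a ∈ l, a = 1) → l = List.replicate (l.map (· ^ 2)).sum 1 := by
    intro l
    induction l with
    | nil => simp
    | cons a l ih =>
      intro h
      have h1 := h a List.mem_cons_self
      subst h1
      conv_lhs => rw [ih fun b hb => h b (List.mem_cons_of_mem _ hb)]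
      rw [List.map_cons, List.sum_cons, one_pow, add_comm, List.replicate_succ]
  by_cases h2 : 2 ∈ l
  · obtain ⟨s, t, rfl⟩ := List.append_of_mem h2
    have hb := (hl 2 (by simp)).2
    have ht : two = true := by
      cases two with
      | false => exact absurd hb (by simp [bound])
      | true => rfl
    have hsum : ((s ++ 2 :: t).map (· ^ 2)).sum = 4 + ((s ++ t).map (· ^ 2)).sum := by
      simp; omega
    have h1 : ∀ a ∈ s ++ t, a = 1 := by
      intro a ha
      have h3 := hl a (by simp at ha ⊢; tauto)
      have h4 := List.single_le_sum (l := (s ++ t).map (· ^ 2)) (fun _ _ => Nat.zero_le _) (a ^ 2)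
        (List.mem_map_of_mem ha)
      by_contra hne
      have : 2 ≤ a := by omega
      have : 2 ^ 2 ≤ a ^ 2 := Nat.pow_le_pow_left this 2
      omega
    have h5 := hone _ h1
    refine ⟨_, Or.inr ⟨ht, by omega, rfl⟩, ?_⟩
    rw [hsum, Nat.add_sub_cancel_left, ← h5]
    exact List.perm_append_comm.trans
      (List.Perm.symm (List.perm_middle (a := 2) (l₁ := s) (l₂ := t)))
  · have h1 : ∀ a ∈ l, a = 1 := by
      intro a ha
      have h3 := hl a ha
      have : bound two ≤ 2 := by cases two <;> simp [bound]
      have : a ≠ 2 := fun h => h2 (h ▸ ha)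
      omega
    exact ⟨_, Or.inl rfl, by rw [← hone l h1]⟩

theorem sum_map_eq_sum {α : Type} [AddCommMonoid α] {cs : List (Fin N)} {F : Fin N → α}
    (hn : cs.Nodup) (h : ∀ e, e ∉ cs → F e = 0) : (cs.map F).sum = ∑ e, F e := by
  rw [← List.sum_toFinset F hn]
  exact sum_subset (subset_univ _) fun e _ he => h e (by simpa using he)

/-- The coefficient of a vector relative to the sign of a code. -/
def coef (Y : List (Fin N → ℤ)) (x : Fin N → ℤ) (e : Fin N) : ℤ := (code Y e).sign * x e

theorem natAbs_code_cons {Y : List (Fin N → ℤ)} {x : Fin N → ℤ} {e : Fin N}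
    (hx : |x e| ≤ 2) (h : code Y e ≠ 0) :
    (code (x :: Y) e).natAbs = newCode ((code Y e).natAbs, coef Y x e) := by
  have := abs_le.1 hx
  rw [code_cons]
  unfold newCode coef
  rcases lt_trichotomy (code Y e) 0 with h1 | h1 | h1
  · rw [Int.sign_eq_neg_one_of_neg h1]; simp only []; omega
  · exact absurd h1 h
  · rw [Int.sign_eq_one_of_pos h1]; simp only []; omega

theorem rep_step {two nb : Bool} {f g h : ℕ → Bool} {Y : List (Fin N → ℤ)} {x : Fin N → ℤ}
    {M : List ℕ} {k w : ℕ} (hM : Rep Y M)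
    (hx : ∀ e, |x e| ≤ bound two) (hw : dot x x = w) (hw7 : w ≤ 7)
    (hk : ∑ e, x e * code Y e = -k)
    (hf : ∀ e, code Y e ≠ 0 → f (code Y e).natAbs = false → x e = 0)
    (h₀ : nb = false → ∀ e, code Y e ≠ 0 →
      (f (code Y e).natAbs && !g (code Y e).natAbs) = false)
    (h₁ : nb = true → ∃ e₀, code Y e₀ ≠ 0 ∧
      (f (code Y e₀).natAbs && !g (code Y e₀).natAbs) = true ∧
      coef Y x e₀ = (if h (code Y e₀).natAbs then (-1 : ℤ) else 1) ∧
      ∀ e, e ≠ e₀ → code Y e ≠ 0 → (f (code Y e).natAbs && !g (code Y e).natAbs) = true →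
        x e = 0) :
    ∃ Q, Rep (x :: Y) Q ∧ ∀ acc, Q ∈ sols1 two
      (prepWith (bound two) f g h M 0 Items.nil fun t => t) k w nb acc := by
  obtain ⟨cs₀, hn₀, hc₀, rfl, hs₀⟩ := hM
  set pr : Fin N → ℕ × ℤ := fun e => ((code Y e).natAbs, coef Y x e) with hpr
  obtain ⟨cs, hcp, hcs⟩ := exists_perm_sorted (fun e => newCode (pr e)) cs₀
  have hn : cs.Nodup := hcp.nodup_iff.2 hn₀
  have hc : ∀ e, e ∈ cs ↔ code Y e ≠ 0 := fun e => by rw [hcp.mem_iff]; exact hc₀ e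
  have hb : bound two ≤ 2 := by cases two <;> simp [bound]
  have hx2 : ∀ e, |x e| ≤ 2 := fun e => (hx e).trans (by exact_mod_cast hb)
  have hsign : ∀ e, code Y e ≠ 0 → |coef Y x e| = |x e| := by
    intro e he
    unfold coef
    rw [abs_mul, Int.abs_sign_of_ne_zero he, one_mul]
  have hps : ∀ s ∈ cs.map pr, 0 < s.1 ∧ |s.2| ≤ bound two := by
    intro s hs
    obtain ⟨e, he, rfl⟩ := List.mem_map.1 hs
    have he := (hc e).1 he
    exact ⟨Int.natAbs_pos.2 he, by simp only [hpr]; rw [hsign e he]; exact hx e⟩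
  have hM : cs₀.map (fun e => (code Y e).natAbs) = (cs.map pr).map Prod.fst := by
    refine List.Perm.eq_of_pairwise (le := fun a b : ℕ => a ≤ b)
      (fun a b _ _ h1 h2 => le_antisymm h1 h2) hs₀ ?_ ?_
    · rw [List.pairwise_map, List.pairwise_map]
      refine hcs.imp_of_mem fun {a b} ha hb' h => ?_
      exact fst_le_of_newCode_le (hps _ (List.mem_map_of_mem ha)).2
        (hps _ (List.mem_map_of_mem hb')).2 h
    · rw [List.map_map]
      exact (hcp.map _).symm
  set fr : List (Fin N) := (univ.filter fun e => code Y e = 0 ∧ x e ≠ 0).toList with hfr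
  have hfrm : ∀ e, e ∈ fr ↔ code Y e = 0 ∧ x e ≠ 0 := fun e => by
    rw [hfr, Finset.mem_toList]; simp
  have hfn : fr.Nodup := Finset.nodup_toList _
  have hdis : (cs ++ fr).Nodup := by
    rw [List.nodup_append]
    refine ⟨hn, hfn, ?_⟩
    rintro a ha _ hb' rfl
    exact (hc a).1 ha ((hfrm a).1 hb').1
  have hsq : ((cs.map pr).map fun s => s.2.natAbs ^ 2).sum +
      ((fr.map fun e => (x e).natAbs).map (· ^ 2)).sum = w := by
    have e1 : ((cs.map pr).map fun s => s.2.natAbs ^ 2) = cs.map fun e => (x e).natAbs ^ 2 := by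
      rw [List.map_map]
      refine List.map_congr_left fun e he => ?_
      have : (coef Y x e).natAbs = (x e).natAbs := by
        have := abs_eq_abs.1 (hsign e ((hc e).1 he))
        omega
      simp only [Function.comp, hpr, this]
    rw [e1, List.map_map]
    change (cs.map fun e => (x e).natAbs ^ 2).sum + (fr.map fun e => (x e).natAbs ^ 2).sum = w
    rw [← List.sum_append, ← List.map_append, sum_map_eq_sum hdis]
    · zify
      rw [← hw, dot]
      refine sum_congr rfl fun e _ => ?_
      rw [sq_abs, sq]
    · intro e he
      rw [List.mem_append, hc, hfrm] at he
      have : x e = 0 := by tauto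
      rw [this]; rfl
  have hfb : ∀ a ∈ fr.map (fun e => (x e).natAbs), 1 ≤ a ∧ a ≤ bound two := by
    intro a ha
    obtain ⟨e, he, rfl⟩ := List.mem_map.1 ha
    have h1 := ((hfrm e).1 he).2
    have h2 := abs_le.1 (hx e)
    omega
  obtain ⟨F, hF, hFp⟩ := exists_isFresh (two := two) hfb (by omega)
  have hr : ((cs.map pr).map fun s => s.2 * (s.1 : ℤ)).sum = -(k : ℤ) := by
    rw [← hk, List.map_map, ← sum_map_eq_sum hn]
    · congr 1
      refine List.map_congr_left fun e he => ?_
      simp only [Function.comp, hpr, coef]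
      rw [mul_right_comm, Int.natCast_natAbs, Int.sign_mul_abs, mul_comm]
    · intro e he
      rw [hc, not_not] at he
      rw [he, mul_zero]
  obtain ⟨Q, hQ1, hQ2, hQ3⟩ := mem_sols1 (two := two) (nb := nb) (f := f) (g := g) (h := h)
    (ps := cs.map pr) (k := k) (w := w) (F := F) (by rw [List.pairwise_map]; exact hcs) hps
    (by
      intro s hs hfs
      obtain ⟨e, he, rfl⟩ := List.mem_map.1 hs
      simp only [hpr, coef]
      rw [hf e ((hc e).1 he) hfs, mul_zero])
    (by omega)
    (by
      have : w - ((cs.map pr).map fun s => s.2.natAbs ^ 2).sum =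
        ((fr.map fun e => (x e).natAbs).map (· ^ 2)).sum := by omega
      rw [this]; exact hF)
    hr
    (by
      intro hnb s hs
      obtain ⟨e, he, rfl⟩ := List.mem_map.1 hs
      exact h₀ hnb e ((hc e).1 he))
    (by
      intro hnb
      obtain ⟨e₀, he₀, h2, h3, h4⟩ := h₁ hnb
      have hmem := (hc e₀).2 he₀
      obtain ⟨s, t, rfl⟩ := List.append_of_mem hmem
      have hne : ∀ e ∈ s ++ t, e ≠ e₀ := by
        rintro e he rfl
        exact (List.nodup_cons.1 (List.nodup_middle.1 hn)).1 he
      refine ⟨(s.map pr).filter fun s => f s.1 && !g s.1,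
        (t.map pr).filter fun s => f s.1 && !g s.1, (code Y e₀).natAbs, ?_, ?_, ?_⟩
      · rw [List.map_append, List.map_cons, List.filter_append, List.filter_cons]
        simp only [hpr]
        rw [if_pos h2, h3]
      · intro p hp
        obtain ⟨hp, hp'⟩ := List.mem_filter.1 hp
        obtain ⟨e, he, rfl⟩ := List.mem_map.1 hp
        simp only [hpr, coef]
        rw [h4 e (hne e (by simp [he])) ((hc e).1 (by simp [he])) hp', mul_zero]
      · intro p hp
        obtain ⟨hp, hp'⟩ := List.mem_filter.1 hp
        obtain ⟨e, he, rfl⟩ := List.mem_map.1 hp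
        simp only [hpr, coef]
        rw [h4 e (hne e (by simp [he])) ((hc e).1 (by simp [he])) hp', mul_zero])
  rw [hM]
  refine ⟨Q, ?_, hQ3⟩
  have hmap : (cs ++ fr).map (fun e => (code (x :: Y) e).natAbs) =
      (cs.map pr).map newCode ++ fr.map fun e => (x e).natAbs := by
    rw [List.map_append, List.map_map]
    congr 1
    · exact List.map_congr_left fun e he => natAbs_code_cons (hx2 e) ((hc e).1 he)
    · refine List.map_congr_left fun e he => ?_
      rw [code_cons, ((hfrm e).1 he).1, mul_zero, add_zero]
  have hQ4 : Q.Perm ((cs ++ fr).map fun e => (code (x :: Y) e).natAbs) := by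
    rw [hmap]
    exact hQ1.trans ((hFp.append_right _).trans List.perm_append_comm)
  obtain ⟨cs', hcs', rfl⟩ := exists_map_of_perm hQ4
  refine ⟨cs', hcs'.nodup_iff.2 hdis, fun e => ?_, rfl, hQ2⟩
  rw [hcs'.mem_iff, List.mem_append, hc, hfrm, code_cons]
  have := abs_le.1 (hx2 e)
  by_cases h0 : code Y e = 0
  · simp [h0]
  · simp only [h0, ne_eq, not_false_iff, false_and, or_false, true_iff]
    omega

theorem value_map_mul (s : ℤ) : ∀ l : List ℤ, value (l.map (s * ·)) = s * value l
  | [] => by simp [value]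
  | d :: l => by rw [List.map_cons, value, value, value_map_mul s l]; ring

theorem sum_mul_code {N : ℕ} (x : Fin N → ℤ) : ∀ Y : List (Fin N → ℤ),
    ∑ e, x e * code Y e = value (Y.map (dot x))
  | [] => by simp [code, value]
  | y :: Y => by
    rw [List.map_cons, value, ← sum_mul_code x Y, dot, mul_sum, ← sum_add_distrib]
    exact sum_congr rfl fun e _ => by rw [code_cons]; ring

/-- The window of `l` consecutive integers starting at `p` in the direction `s`. -/
def win (p s : ℤ) (l : ℕ) : List ℤ := (List.range l).map fun i : ℕ => p + s * i

theorem win_succ (p s : ℤ) (l : ℕ) : win p s (l + 1) = p :: win (p + s) s l := by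
  unfold win
  rw [List.range_succ_eq_map, List.map_cons, List.map_map]
  congr 1
  · simp
  · refine List.map_congr_left fun i _ => ?_
    simp only [Function.comp]
    push_cast
    ring

theorem mem_win {p s : ℤ} {l : ℕ} {u : ℤ} : u ∈ win p s l ↔ ∃ i : ℕ, i < l ∧ p + s * i = u := by
  simp [win]

/-- A disjoint union of weighted paths, placed on the integer line so that adjacent vertices are
consecutive integers, together with an embedding. -/
structure Line (N : ℕ) where
  ok : ℤ → Bool
  X : ℤ → Fin N → ℤ
  wp : ℤ → ℕ
  self : ∀ k, ok k = true →
    dot (X k) (X k) = (wp k + boolNat (ok (k - 1)) + boolNat (ok (k + 1)) : ℕ)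
  two_le : ∀ k, ok k = true → 2 ≤ wp k + boolNat (ok (k - 1)) + boolNat (ok (k + 1))
  adj : ∀ k, ok k = true → ok (k + 1) = true → dot (X k) (X (k + 1)) = -1
  far : ∀ k l, ok k = true → ok l = true → k + 2 ≤ l → dot (X k) (X l) = 0
  conv : ∀ k m l, ok k = true → ok l = true → k ≤ m → m ≤ l → l < k + 8 → ok m = true
  nohit : ∀ p s l p' s' l', (s = 1 ∨ s = -1) → (s' = 1 ∨ s' = -1) →
    (∀ u ∈ win p s l, ok u = true) → (∀ u ∈ win p' s' l', ok u = true) →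
    (∀ u ∈ win p s l, u ∉ win p' s' l') →
    ∀ R, R <:+ rows ((win p s l).map wp) ++ 0 :: rows ((win p' s' l').map wp) → hit R = false

theorem dot_comm (x y : Fin N → ℤ) : dot x y = dot y x :=
  sum_congr rfl fun _ _ => mul_comm _ _

namespace Line

variable (L : Line N)

theorem boolNat_le_one (b : Bool) : boolNat b ≤ 1 := by cases b <;> simp [boolNat]

theorem wp_le_three {k : ℤ} (hk : L.ok k = true) : L.wp k ≤ 3 := by
  by_contra h
  obtain ⟨m, hm⟩ : ∃ m, L.wp k = m + 4 := ⟨L.wp k - 4, by omega⟩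
  have h1 := L.nohit k 1 1 0 1 0 (Or.inl rfl) (Or.inl rfl) (by simpa [win] using hk)
    (by simp [win]) (by simp [win]) [2, 2, 2, 0] (by
      have : (win k 1 1).map L.wp = [m + 4] := by simp [win, hm]
      rw [this]
      have e : ∀ m, [2, 2, 2, 0] <:+ rows [m + 4] ++ [0] := by
        intro m
        induction m with
        | zero => exact List.suffix_rfl
        | succ m ih => exact ih.trans (List.suffix_cons _ _)
      exact e m)
  exact absurd h1 (by decide)

theorem dot_self_le {k : ℤ} (hk : L.ok k = true) : dot (L.X k) (L.X k) ≤ 5 := by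
  rw [L.self k hk]
  have := L.wp_le_three hk
  have := boolNat_le_one (L.ok (k - 1))
  have := boolNat_le_one (L.ok (k + 1))
  exact_mod_cast (by omega : L.wp k + boolNat (L.ok (k - 1)) + boolNat (L.ok (k + 1)) ≤ 5)

theorem abs_le_two {k : ℤ} (hk : L.ok k = true) (e : Fin N) : |L.X k e| ≤ 2 := by
  have h1 := L.dot_self_le hk
  have h2 : L.X k e * L.X k e ≤ dot (L.X k) (L.X k) :=
    single_le_sum (f := fun e => L.X k e * L.X k e) (fun _ _ => mul_self_nonneg _) (mem_univ e)
  by_contra h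
  have h3 : 3 ≤ |L.X k e| := by omega
  have h4 := abs_mul_abs_self (L.X k e)
  nlinarith

/-- The pairs of vertices at distance less than `D` have standard overlaps. -/
structure Hyp (D : ℕ) : Prop where
  one : 1 ≤ D → ∀ k e, L.ok k = true → |L.X k e| ≤ 1
  two : 2 ≤ D → ∀ k, L.ok k = true → L.ok (k + 1) = true →
    (supp (L.X k) ∩ supp (L.X (k + 1))).card = 1
  far : ∀ t : ℕ, 3 ≤ t → t < D → ∀ k, L.ok k = true → L.ok (k + t) = true →
    ∀ e, L.X k e = 0 ∨ L.X (k + t) e = 0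

variable {L}

theorem Hyp.abs_le {D : ℕ} (H : L.Hyp D) {k : ℤ} (hk : L.ok k = true) (e : Fin N) :
    |L.X k e| ≤ bound (Search.two D) := by
  cases D with
  | zero => exact L.abs_le_two hk e
  | succ D => exact H.one (by omega) k e hk

theorem Hyp.two' {D : ℕ} (H : L.Hyp D) (hD : 2 ≤ D) {p s : ℤ} (hs : s = 1 ∨ s = -1)
    (hp : L.ok p = true) (hv : L.ok (p - s) = true) :
    (supp (L.X (p - s)) ∩ supp (L.X p)).card = 1 := by
  rcases hs with rfl | rfl
  · have := H.two hD (p - 1) hv (by simpa using hp)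
    simpa using this
  · rw [inter_comm]
    have := H.two hD p hp (by simpa using hv)
    simpa using this

theorem adj' (L : Line N) {p s : ℤ} (hs : s = 1 ∨ s = -1)
    (hp : L.ok p = true) (hv : L.ok (p - s) = true) : dot (L.X (p - s)) (L.X p) = -1 := by
  rcases hs with rfl | rfl
  · have := L.adj (p - 1) hv (by simpa using hp)
    simpa using this
  · rw [dot_comm]
    have := L.adj p hp (by simpa using hv)
    simpa using this

theorem self' (L : Line N) {p s : ℤ} (hs : s = 1 ∨ s = -1) (hp : L.ok p = true) :
    dot (L.X p) (L.X p) = (L.wp p + boolNat (L.ok (p - s)) + boolNat (L.ok (p + s)) : ℕ) := by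
  rcases hs with rfl | rfl
  · exact L.self p hp
  · rw [L.self p hp]; congr 1; simp only [sub_neg_eq_add, ← sub_eq_add_neg]; omega

theorem far' (L : Line N) {k l : ℤ} (hk : L.ok k = true) (hl : L.ok l = true)
    (h : k + 2 ≤ l ∨ l + 2 ≤ k) : dot (L.X k) (L.X l) = 0 := by
  rcases h with h | h
  · exact L.far k l hk hl h
  · rw [dot_comm]; exact L.far l k hl hk h

theorem Hyp.far' {D : ℕ} (H : L.Hyp D) {p s : ℤ} (hs : s = 1 ∨ s = -1) {i : ℕ} (hi : i + 3 < D)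
    (hv : L.ok (p - s) = true) (hu : L.ok (p + s * (i + 2 : ℕ)) = true) (e : Fin N)
    (he : L.X (p + s * (i + 2 : ℕ)) e ≠ 0) : L.X (p - s) e = 0 := by
  rcases hs with rfl | rfl
  · have e1 : p + 1 * ((i + 2 : ℕ) : ℤ) = (p - 1) + ((i + 3 : ℕ) : ℤ) := by push_cast; ring
    rw [e1] at he hu
    exact (H.far (i + 3) (by omega) hi (p - 1) hv hu e).resolve_right he
  · have e1 : p - -1 = (p + -1 * ((i + 2 : ℕ) : ℤ)) + ((i + 3 : ℕ) : ℤ) := by push_cast; ring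
    rw [e1] at hv ⊢
    exact (H.far (i + 3) (by omega) hi _ hu hv e).resolve_left he

end Line

theorem mask_eq (n : ℕ) : ∀ (ts : List ℕ) (k : ℕ),
    mask n ts k = (((ts.take k).map (n - ·)).map (8 ^ ·)).sum
  | [], k => by simp [mask]
  | t :: ts, 0 => rfl
  | t :: ts, k + 1 => by
    change 8 ^ (n - t) + mask n ts k = _
    rw [mask_eq n ts k]
    simp

theorem code_ne_zero {Y : List (Fin N → ℤ)} {e : Fin N} (hY : ∀ y ∈ Y, |y e| ≤ 2)
    {y : Fin N → ℤ} (hy : y ∈ Y) (h : y e ≠ 0) : code Y e ≠ 0 := fun h0 =>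
  h (value_eq_zero (l := Y.map fun y : Fin N → ℤ => y e) (fun d hd => by
    obtain ⟨y, hy, rfl⟩ := List.mem_map.1 hd
    have := hY y hy
    omega) h0 _ (List.mem_map_of_mem hy))

/-- The digits of the absolute value of a code. -/
def digits (Y : List (Fin N → ℤ)) (e : Fin N) : List ℤ :=
  (Y.map fun y => y e).map ((code Y e).sign * ·)

theorem value_digits (Y : List (Fin N → ℤ)) (e : Fin N) :
    value (digits Y e) = (code Y e).natAbs := by
  unfold digits
  rw [value_map_mul, Int.natCast_natAbs]
  exact Int.sign_mul_self_eq_abs _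

theorem abs_digits_le {Y : List (Fin N → ℤ)} {e : Fin N} (hY : ∀ y ∈ Y, |y e| ≤ 2) :
    ∀ d ∈ digits Y e, |d| ≤ 3 := by
  intro d hd
  unfold digits at hd
  rw [List.map_map] at hd
  obtain ⟨y, hy, rfl⟩ := List.mem_map.1 hd
  have := hY y hy
  simp only [Function.comp, abs_mul]
  have h1 : |(code Y e).sign| ≤ 1 := by
    rcases Int.sign_trichotomy (code Y e) with h | h | h <;> rw [h] <;> simp
  nlinarith [abs_nonneg (y e), abs_nonneg (code Y e).sign]

theorem digits_getD {Y : List (Fin N → ℤ)} {e : Fin N} {j : ℕ} {y : Fin N → ℤ}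
    (h : Y[j]? = some y) : (digits Y e).getD j 0 = (code Y e).sign * y e := by
  unfold digits
  rw [List.getD_eq_getElem?_getD, List.getElem?_map, List.getElem?_map, h]
  rfl

theorem length_digits (Y : List (Fin N → ℤ)) (e : Fin N) : (digits Y e).length = Y.length := by
  simp [digits]

/-- The data of a window agree with the vertices at the positions of a window, which have been
added at the recorded times. -/
structure SegAt (L : Line N) (n : ℕ) (hs : List ℤ) (A : Seg) (p s : ℤ) (l : ℕ) : Prop where
  dir : s = 1 ∨ s = -1
  ok : ∀ i : ℕ, i < l → L.ok (p + s * i) = true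
  ws : A.ws = (win p s l).map L.wp
  len : A.ts.length = l
  times : ∀ i t : ℕ, A.ts[i]? = some t → t ≤ n ∧ hs[n - t]? = some (p + s * i)
  lo : A.lo = (decide (0 < l) && L.ok (p - s))
  ro : A.ro = (decide (0 < l) && L.ok (p + s * l))

theorem SegAt.nodup {L : Line N} {n l : ℕ} {hs : List ℤ} {A : Seg} {p s : ℤ}
    (h : SegAt L n hs A p s l) : (A.ts.map (n - ·)).Nodup := by
  rw [List.nodup_iff_injective_getElem]
  intro ⟨i, hi⟩ ⟨j, hj⟩ hij
  simp only [List.getElem_map] at hij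
  rw [List.length_map] at hi hj
  have h1 := (h.times i _ (List.getElem?_eq_getElem hi)).2
  have h2 := (h.times j _ (List.getElem?_eq_getElem hj)).2
  rw [hij, h2] at h1
  have h3 := Option.some.inj h1
  rcases h.dir with rfl | rfl <;> · simp only [Fin.mk.injEq]; omega

theorem prep_eq_prepWith (e bm bh nk nh : ℕ) : prep e bm bh nk nh =
    prepWith e (fun a => Nat.beq (Nat.land (shift a) bm) bh)
    (fun a => Nat.beq (Nat.land (shift a) nk) nh)
    (fun a => notB (Nat.ble (Nat.land (shift a) nk) nh)) := rfl

theorem beq_land_zero (a : ℕ) :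
    Nat.beq (Nat.land (shift a) (Nat.mul 7 0)) (Nat.mul 4 0) = true := by
  rw [Nat.beq_eq]
  exact Nat.and_zero _

theorem exists_rep_of_extension {L : Line N} {D n l k w bm : ℕ} {nb : Bool} {hs : List ℤ}
    {A : Seg} {p s : ℤ} {M : List ℕ} {Ms : List (List ℕ)} (H : L.Hyp D)
    (hA : SegAt L n hs A p s (l + 1)) (hlen : hs.length ≤ 20) (hn : hs.Nodup)
    (hok : ∀ u ∈ hs, L.ok u = true) (hv : L.ok (p - s) = true)
    (hfar : ∀ u ∈ hs, u ≠ p → u + 2 ≤ p - s ∨ p - s + 2 ≤ u)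
    (hM : M ∈ Ms) (hrep : Rep (hs.map L.X) M)
    (hk : k = mask n A.ts 1) (hbm : bm = mask n A.ts.tail.tail (D - 3)) (hnb : nb = Nat.ble 2 D)
    (hw : w = L.wp (p - s) + boolNat (L.ok (p - s - s)) + 1) :
    ∃ Q, Rep (((p - s) :: hs).map L.X) Q ∧ Q ∈ sols (two D) k w nb
      (preps (bound (two D)) (Nat.mul 7 bm) (Nat.mul 4 bm) (Nat.mul 7 (if nb then k else 0))
        (Nat.mul 4 (if nb then k else 0)) Ms) := by
  set Y := hs.map L.X with hY
  set x := L.X (p - s) with hx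
  have hp : L.ok p = true := by simpa using hA.ok 0 (by omega)
  have hY2 : ∀ e, ∀ y ∈ Y, |y e| ≤ 2 := by
    intro e y hy
    obtain ⟨u, hu, rfl⟩ := List.mem_map.1 hy
    exact L.abs_le_two (hok u hu) e
  have hYl : Y.length ≤ 20 := by rw [hY, List.length_map]; exact hlen
  have hdl : ∀ e, (digits Y e).length ≤ 20 := fun e => by rw [length_digits]; exact hYl
  have hd3 := fun e => abs_digits_le (hY2 e)
  have hval := fun e => value_digits Y e
  obtain ⟨t₀, ts', hts⟩ : ∃ t₀ ts', A.ts = t₀ :: ts' := by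
    have := hA.len
    cases h : A.ts with
    | nil => simp [h] at this
    | cons t ts => exact ⟨t, ts, rfl⟩
  obtain ⟨ht0, hj0⟩ := hA.times 0 t₀ (by rw [hts]; rfl)
  simp only [Nat.cast_zero, mul_zero, add_zero] at hj0
  set j₀ := n - t₀ with hj₀
  have hk' : k = 8 ^ j₀ := by
    rw [hk, mask_eq, hts]
    simp [hj₀]
  have hjlt : j₀ < 20 := lt_of_lt_of_le (List.getElem?_eq_some_iff.1 hj0).1 hlen
  have hYj : Y[j₀]? = some (L.X p) := by rw [hY, List.getElem?_map, hj0]; rfl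
  have hYp : L.X p ∈ Y := List.mem_of_getElem? hYj
  -- the block mask
  set js := ((A.ts.tail.tail.take (D - 3)).map (n - ·)) with hjs
  have hjsn : js.Nodup := by
    refine hA.nodup.sublist ?_
    rw [hjs]
    exact ((List.take_sublist _ _).trans ((List.tail_sublist _).trans
      (List.tail_sublist _))).map _
  have hjsm : ∀ j ∈ js, ∃ i : ℕ, i + 3 < D ∧ L.ok (p + s * (i + 2 : ℕ)) = true ∧
      hs[j]? = some (p + s * (i + 2 : ℕ)) := by
    intro j hj
    obtain ⟨t, ht, rfl⟩ := List.mem_map.1 hj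
    obtain ⟨i, hi⟩ := List.mem_iff_getElem?.1 ht
    rw [List.getElem?_take] at hi
    split at hi
    · rename_i hiD
      rw [List.getElem?_tail, List.getElem?_tail] at hi
      have h1 := hA.times _ _ hi
      refine ⟨i, by omega, hA.ok _ ?_, h1.2⟩
      have := (List.getElem?_eq_some_iff.1 hi).1
      rw [hA.len] at this
      omega
    · cases hi
  have hbm' : bm = ∑ j ∈ js.toFinset, 8 ^ j := by
    rw [hbm, mask_eq, List.sum_toFinset _ hjsn]
  have hJ : ∀ j ∈ js.toFinset, j < 20 := by
    intro j hj
    obtain ⟨i, -, -, h⟩ := hjsm j (List.mem_toFinset.1 hj)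
    exact lt_of_lt_of_le (List.getElem?_eq_some_iff.1 h).1 hlen
  have hblock : ∀ e, Nat.beq (Nat.land (shift (code Y e).natAbs) (Nat.mul 7 bm)) (Nat.mul 4 bm) =
      false → x e = 0 := by
    intro e he
    by_contra hxe
    rw [← Bool.not_eq_true, Nat.beq_eq] at he
    apply he
    rw [hbm']
    refine land_shift_of_eq_zero (hdl e) (hd3 e) (hval e) hJ fun j hj => ?_
    obtain ⟨i, hi, hok', h⟩ := hjsm j (List.mem_toFinset.1 hj)
    rw [digits_getD (y := L.X (p + s * (i + 2 : ℕ))) (by rw [hY, List.getElem?_map, h]; rfl)]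
    by_contra h0
    exact hxe (H.far' hA.dir hi hv hok' e fun h1 => h0 (by rw [h1, mul_zero]))
  have hwx : dot x x = w := by
    rw [hx, L.self' (s := s) hA.dir hv, hw]
    simp [hp, boolNat]
  have hw7 : w ≤ 7 := by
    have := L.dot_self_le hv
    rw [← hx, hwx] at this
    omega
  have hkx : ∑ e, x e * code Y e = -k := by
    rw [sum_mul_code, ← sum_getD_eq_value _ 20 (by rw [List.length_map]; exact hYl),
      sum_eq_single j₀]
    · rw [List.getD_eq_getElem?_getD, List.getElem?_map, hYj, hk']
      simp only [Option.map_some, Option.getD_some]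
      rw [hx, L.adj' hA.dir hp hv]
      push_cast; ring
    · intro j _ hj
      rw [List.getD_eq_getElem?_getD, List.getElem?_map, hY, List.getElem?_map]
      cases hu : hs[j]? with
      | none => simp
      | some u =>
        have hmem := List.mem_of_getElem? hu
        have hup : u ≠ p := by
          rintro rfl
          have h1 := List.getElem?_eq_some_iff.1 hu
          have h2 := List.getElem?_eq_some_iff.1 hj0
          exact hj ((hn.getElem_inj_iff).1 (h1.2.trans h2.2.symm))
        simp only [Option.map_some, Option.getD_some]
        rw [hx, L.far' hv (hok u hmem) ((hfar u hmem hup).symm), zero_mul]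
    · intro h
      exact absurd (mem_range.2 hjlt) h
  have hg : ∀ e, nb = true → (Nat.beq (Nat.land (shift (code Y e).natAbs)
      (Nat.mul 7 (if nb then k else 0))) (Nat.mul 4 (if nb then k else 0)) = true ↔
        (code Y e).sign * L.X p e = 0) := by
    intro e hnb'
    rw [if_pos hnb', hk', land_beq_singleton (hdl e) (hd3 e) (hval e) hjlt, digits_getD hYj]
  have hsg : ∀ e, code Y e ≠ 0 → (code Y e).sign = 1 ∨ (code Y e).sign = -1 := by
    intro e he
    rcases Int.sign_trichotomy (code Y e) with h | h | h
    · exact Or.inl h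
    · exact absurd (Int.sign_eq_zero_iff_zero.1 h) he
    · exact Or.inr h
  obtain ⟨Q, hQ1, hQ2⟩ := rep_step (two := two D) (nb := nb)
    (f := fun a => Nat.beq (Nat.land (shift a) (Nat.mul 7 bm)) (Nat.mul 4 bm))
    (g := fun a => Nat.beq (Nat.land (shift a) (Nat.mul 7 (if nb then k else 0)))
      (Nat.mul 4 (if nb then k else 0)))
    (h := fun a => notB (Nat.ble (Nat.land (shift a) (Nat.mul 7 (if nb then k else 0)))
      (Nat.mul 4 (if nb then k else 0))))
    hrep (fun e => H.abs_le hv e) hwx hw7 hkx (fun e _ he => hblock e he)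
    (by
      intro h e _
      rw [if_neg (by rw [h]; decide), beq_land_zero, Bool.not_true, Bool.and_false])
    (by
      intro hnb'
      have hD : 2 ≤ D := by
        rw [hnb] at hnb'
        exact Nat.le_of_ble_eq_true hnb'
      obtain ⟨e₀, he₀⟩ := card_eq_one.1 (H.two' hD hA.dir hp hv)
      have huniq : ∀ e, x e ≠ 0 → L.X p e ≠ 0 → e = e₀ := by
        intro e h1 h2
        have : e ∈ supp (L.X (p - s)) ∩ supp (L.X p) := by simp [supp, h1, h2, ← hx]
        rw [he₀] at this
        exact mem_singleton.1 this
      have hmem : e₀ ∈ supp (L.X (p - s)) ∩ supp (L.X p) := by rw [he₀]; simp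
      obtain ⟨hx0, hp0⟩ : x e₀ ≠ 0 ∧ L.X p e₀ ≠ 0 := by simpa [supp, ← hx] using hmem
      have hprod : x e₀ * L.X p e₀ = -1 := by
        have h1 := L.adj' hA.dir hp hv
        rw [dot, sum_eq_single e₀] at h1
        · exact h1
        · intro e _ hne
          by_contra h2
          exact hne (huniq e (left_ne_zero_of_mul h2) (right_ne_zero_of_mul h2))
        · intro h; exact absurd (mem_univ _) h
      have hc0 : code Y e₀ ≠ 0 := code_ne_zero (hY2 e₀) hYp hp0
      refine ⟨e₀, hc0, ?_, ?_, ?_⟩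
      · rw [Bool.and_eq_true]
        constructor
        · by_contra h
          exact hx0 (hblock e₀ (Bool.eq_false_iff.2 h))
        · rw [Bool.not_eq_true', ← Bool.not_eq_true, hg e₀ hnb']
          exact mul_ne_zero (by rcases hsg e₀ hc0 with h | h <;> rw [h] <;> decide) hp0
      · rw [if_pos hnb', notB_eq]
        have h1 := land_ble_singleton (hdl e₀) (hd3 e₀) (hval e₀) hjlt
        rw [digits_getD hYj, ← hk'] at h1
        simp only [Bool.not_eq_true', ← Bool.not_eq_true, h1]
        change (code Y e₀).sign * x e₀ = _
        rw [Int.mul_eq_neg_one_iff_eq_one_or_neg_one] at hprod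
        rcases hsg e₀ hc0 with h | h <;> rcases hprod with ⟨h2, h3⟩ | ⟨h2, h3⟩ <;>
          rw [h, h2, h3] <;> decide
      · intro e hne _ hfg
        by_contra hxe
        rw [Bool.and_eq_true, Bool.not_eq_true', ← Bool.not_eq_true, hg e hnb'] at hfg
        exact hne (huniq e hxe (right_ne_zero_of_mul hfg.2)))
  refine ⟨Q, hQ1, mem_sols hM ?_⟩
  rw [prep_eq_prepWith]
  exact hQ2

theorem app_eq (l m : List ℕ) : app l m = l ++ m := by
  induction l with
  | nil => rfl
  | cons a l ih => exact congrArg (a :: ·) ih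

theorem revOnto_eq {α : Type} (l m : List α) : revOnto l m = l.reverse ++ m := by
  induction l generalizing m with
  | nil => rfl
  | cons a l ih =>
    change revOnto l (a :: m) = _
    rw [ih]
    simp

theorem rows_one (ws : List ℕ) : rows (1 :: ws) = consLead (lead ws) (rows ws) := rfl

theorem rows_succ_succ (w : ℕ) (ws : List ℕ) : rows ((w + 2) :: ws) = 2 :: rows ((w + 1) :: ws) :=
  rfl

theorem consLead_append (g : ℕ) (l m : List ℕ) : consLead g (l ++ m) = consLead g l ++ m := by
  cases g <;> rfl

theorem orB_eq (a b : Bool) : orB a b = (a || b) := by cases a <;> rfl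

theorem andB_eq (a b : Bool) : andB a b = (a && b) := by cases a <;> rfl

theorem unlessNil_of_mem {M : List (List ℕ)} {k : List (List ℕ) → Bool} {Q : List ℕ}
    (h : unlessNil M k = true) (hQ : Q ∈ M) : k M = true := by
  cases M with
  | nil => simp at hQ
  | cons a l => exact h

theorem mem_filterB {p : List ℕ → Bool} {Q : List ℕ} (hp : p Q = true) :
    ∀ {Ms : List (List ℕ)}, Q ∈ Ms → Q ∈ filterB p Ms
  | a :: l, hQ => by
    change Q ∈ (Bool.rec (filterB p l) (a :: filterB p l) (p a) : List (List ℕ))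
    rcases List.mem_cons.1 hQ with rfl | hQ
    · rw [hp]; exact List.mem_cons_self
    · have := mem_filterB hp hQ
      cases p a
      · exact this
      · exact List.mem_cons_of_mem _ this

theorem options_sound {S : ℕ → List (List ℕ)} {k : ℕ → Bool → List (List ℕ) → Bool}
    {base : List ℕ} (h : options S k base = true) {wp : ℕ} {c : Bool} {Q : List ℕ}
    (hQ : Q ∈ S (wp + boolNat c + 1)) (h2 : 2 ≤ wp + boolNat c + 1) (h3 : wp ≤ 3)
    (hit1 : 1 ≤ wp → hit base = false) (hit2 : 2 ≤ wp → hit (2 :: base) = false)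
    (hit3 : 3 ≤ wp → hit (2 :: 2 :: base) = false) : k wp c (S (wp + boolNat c + 1)) = true := by
  unfold options at h
  simp only [andB_eq, orB_eq, Bool.and_eq_true, Bool.or_eq_true] at h
  have key : ∀ {w k}, w = wp + boolNat c + 1 → unlessNil (S w) k = true → k (S w) = true := by
    rintro w k rfl h
    exact unlessNil_of_mem h hQ
  obtain ⟨ha, h⟩ := h
  rcases Nat.eq_zero_or_pos wp with rfl | hw1
  · cases c
    · simp [boolNat] at h2
    · have := key rfl ha
      simp only [Bool.and_eq_true] at this
      exact this.1
  have e1 := hit1 hw1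
  obtain ⟨hb, h⟩ := h.resolve_left (by rw [e1]; simp)
  rcases eq_or_lt_of_le (Nat.succ_le_of_lt hw1) with rfl | hw2
  · cases c
    · have := key rfl ha
      simp only [Bool.and_eq_true, Bool.or_eq_true] at this
      exact this.2.resolve_left (by rw [e1]; simp)
    · have := key rfl hb
      simp only [Bool.and_eq_true] at this
      exact this.1
  have e2 := hit2 hw2
  obtain ⟨hc, h⟩ := h.resolve_left (by rw [e2]; simp)
  rcases eq_or_lt_of_le (Nat.succ_le_of_lt hw2) with rfl | hw3
  · cases c
    · have := key rfl hb
      simp only [Bool.and_eq_true, Bool.or_eq_true] at this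
      exact this.2.resolve_left (by rw [e2]; simp)
    · have := key rfl hc
      simp only [Bool.and_eq_true] at this
      exact this.1
  have e3 := hit3 hw3
  have h := h.resolve_left (by rw [e3]; simp)
  obtain rfl : wp = 3 := by omega
  cases c
  · have := key rfl hc
    simp only [Bool.and_eq_true, Bool.or_eq_true] at this
    exact this.2.resolve_left (by rw [e3]; simp)
  · exact key rfl h

theorem SegAt.push {L : Line N} {n l : ℕ} {hs : List ℤ} {A : Seg} {p s : ℤ}
    (h : SegAt L n hs A p s l) (u : ℤ) : SegAt L (n + 1) (u :: hs) A p s l :=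
  { h with
    times := fun i t ht => by
      obtain ⟨h1, h2⟩ := h.times i t ht
      refine ⟨by omega, ?_⟩
      rw [show n + 1 - t = (n - t) + 1 by omega, List.getElem?_cons_succ, h2] }

theorem SegAt.extend {L : Line N} {n l : ℕ} {hs : List ℤ} {ws ts : List ℕ} {lo ro : Bool}
    {p s : ℤ} (h : SegAt L n hs ⟨ws, ts, lo, ro⟩ p s (l + 1)) (hv : L.ok (p - s) = true) :
    SegAt L (n + 1) ((p - s) :: hs) ⟨L.wp (p - s) :: ws, (n + 1) :: ts, L.ok (p - s - s), ro⟩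
      (p - s) s (l + 2) where
  dir := h.dir
  ok i hi := by
    cases i with
    | zero => simpa using hv
    | succ i =>
      have := h.ok i (by omega)
      rw [← this]
      congr 1
      push_cast
      ring
  ws := by
    rw [win_succ, List.map_cons, sub_add_cancel]
    exact congrArg _ h.ws
  len := congrArg Nat.succ h.len
  times i t ht := by
    cases i with
    | zero =>
      obtain rfl : n + 1 = t := by simpa using ht
      simp
    | succ i =>
      obtain ⟨h1, h2⟩ := (h.push (p - s)).times i t (by simpa using ht)
      refine ⟨h1, h2.trans (congrArg some ?_)⟩
      push_cast
      ring
  lo := by simp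
  ro := by
    have := h.ro
    simp only [Nat.zero_lt_succ, decide_true, Bool.true_and] at this ⊢
    rw [this]
    congr 1
    push_cast
    ring

theorem win_reverse (p s : ℤ) (l : ℕ) : (win p s l).reverse = win (p + s * (l - 1)) (-s) l := by
  refine List.ext_getElem (by simp [win]) fun i h1 h2 => ?_
  have hi : i < l := by simpa [win] using h2
  rw [List.getElem_reverse]
  simp only [win, List.getElem_map, List.getElem_range, List.length_map, List.length_range]
  rw [show l - 1 - i = l - (1 + i) by omega, Nat.cast_sub (by omega)]
  push_cast
  ring

theorem SegAt.rev {L : Line N} {n l : ℕ} {hs : List ℤ} {A : Seg} {p s : ℤ}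
    (h : SegAt L n hs A p s l) : SegAt L n hs A.rev (p + s * (l - 1)) (-s) l := by
  obtain ⟨ws, ts, lo, ro⟩ := A
  have hrev : Seg.rev ⟨ws, ts, lo, ro⟩ = ⟨ws.reverse, ts.reverse, ro, lo⟩ := by
    change Seg.mk (revOnto ws []) (revOnto ts []) ro lo = _
    rw [revOnto_eq, revOnto_eq, List.append_nil, List.append_nil]
  rw [hrev]
  constructor
  · rcases h.dir with rfl | rfl <;> simp
  · intro i hi
    rw [← h.ok (l - 1 - i) (by omega)]
    congr 1
    rw [show l - 1 - i = l - (1 + i) by omega, Nat.cast_sub (by omega)]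
    push_cast
    ring
  · rw [← win_reverse, List.map_reverse]
    exact congrArg List.reverse h.ws
  · rw [List.length_reverse]
    exact h.len
  · intro i t ht
    have hl : ts.length = l := h.len
    have hi : i < ts.length := by
      have := (List.getElem?_eq_some_iff.1 ht).1
      rwa [List.length_reverse] at this
    rw [List.getElem?_reverse hi] at ht
    obtain ⟨h1, h2⟩ := h.times _ t ht
    refine ⟨h1, h2.trans (congrArg some ?_)⟩
    rw [hl, show l - 1 - i = l - (1 + i) by omega, Nat.cast_sub (by omega)]
    push_cast
    ring
  · refine h.ro.trans ?_
    congr 2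
    ring
  · refine h.lo.trans ?_
    congr 2
    ring

theorem mem_win_rev {p s : ℤ} {l : ℕ} {u : ℤ} :
    u ∈ win (p + s * (l - 1)) (-s) l ↔ u ∈ win p s l := by
  rw [← win_reverse, List.mem_reverse]

theorem extend_sound {L : Line N} {D n l l' : ℕ} {hs : List ℤ} {A B : Seg} {p s p' s' : ℤ}
    {Ms : List (List ℕ)} {M : List ℕ} {k : Seg → List (List ℕ) → Bool} (H : L.Hyp D)
    (hA : SegAt L n hs A p s (l + 1)) (hB : SegAt L n hs B p' s' l') (hlen : hs.length ≤ 20)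
    (hn : hs.Nodup) (hok : ∀ u ∈ hs, L.ok u = true) (hv : L.ok (p - s) = true)
    (hfar : ∀ u ∈ hs, u ≠ p → u + 2 ≤ p - s ∨ p - s + 2 ≤ u)
    (hdis : ∀ u ∈ win (p - s) s (l + 2), u ∉ win p' s' l') (hM : M ∈ Ms)
    (hrep : Rep (hs.map L.X) M) (h : extend D n A B Ms k = true) :
    ∃ A' Ms' M', SegAt L (n + 1) ((p - s) :: hs) A' (p - s) s (l + 2) ∧ M' ∈ Ms' ∧
      Rep (((p - s) :: hs).map L.X) M' ∧ k A' Ms' = true := by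
  obtain ⟨ws, ts, lo, ro⟩ := A
  obtain ⟨t₀, ts', rfl⟩ : ∃ t₀ ts', ts = t₀ :: ts' := by
    cases ts with
    | nil => exact absurd hA.len (by simp)
    | cons t ts => exact ⟨t, ts, rfl⟩
  have hA' := hA.extend hv
  obtain ⟨Q, hQ1, hQ2⟩ := exists_rep_of_extension H hA hlen hn hok hv hfar hM hrep rfl rfl
    (nb := Nat.ble 2 D) rfl rfl
  refine ⟨_, _, Q, hA', hQ2, hQ1, ?_⟩
  have hws : L.wp (p - s) :: ws = (win (p - s) s (l + 2)).map L.wp := hA'.ws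
  have hhit : ∀ R, R <:+ rows (L.wp (p - s) :: ws) ++ 0 :: rows B.ws → hit R = false := by
    rw [hws, hB.ws]
    refine L.nohit _ _ _ _ _ _ hA.dir hB.dir (fun u hu => ?_) (fun u hu => ?_) hdis
    · obtain ⟨i, hi, rfl⟩ := mem_win.1 hu
      exact hA'.ok i hi
    · obtain ⟨i, hi, rfl⟩ := mem_win.1 hu
      exact hB.ok i hi
  set base := consLead (lead ws) (app (rows ws) (List.cons 0 (rows B.ws))) with hbase
  have hb1 : rows (1 :: ws) ++ 0 :: rows B.ws = base := by
    rw [rows_one, hbase, app_eq, consLead_append]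
  have hw2 := L.two_le (p - s) hv
  have hw3 := L.wp_le_three hv
  have hsum : L.wp (p - s) + boolNat (L.ok (p - s - 1)) + boolNat (L.ok (p - s + 1)) =
      L.wp (p - s) + boolNat (L.ok (p - s - s)) + 1 := by
    have hp : L.ok p = true := by simpa using hA.ok 0 (by omega)
    rcases hA.dir with rfl | rfl
    · rw [sub_add_cancel, hp]; rfl
    · rw [show p - -1 - 1 = p by ring, hp, sub_neg_eq_add (p - -1)]
      simp only [boolNat]
      omega
  rw [hsum] at hw2
  have hs1 : 1 ≤ L.wp (p - s) → base <:+ rows (L.wp (p - s) :: ws) ++ 0 :: rows B.ws := by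
    intro h1
    obtain ⟨m, hm⟩ : ∃ m, L.wp (p - s) = m + 1 := ⟨L.wp (p - s) - 1, by omega⟩
    rw [hm, ← hb1]
    clear hm
    induction m with
    | zero => exact List.suffix_rfl
    | succ m ih => exact ih.trans (List.suffix_cons _ _)
  have hopt := options_sound (wp := L.wp (p - s)) (c := L.ok (p - s - s)) (Q := Q)
    (S := fun w => sols (two D) (mask n (t₀ :: ts') 1) w (Nat.ble 2 D)
        (preps (bound (two D)) (Nat.mul 7 (mask n ts'.tail (D - 3)))
          (Nat.mul 4 (mask n ts'.tail (D - 3)))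
          (Nat.mul 7 (if Nat.ble 2 D then mask n (t₀ :: ts') 1 else 0))
          (Nat.mul 4 (if Nat.ble 2 D then mask n (t₀ :: ts') 1 else 0)) Ms))
    (k := fun wp c M => k ⟨wp :: ws, (n + 1) :: t₀ :: ts', c, ro⟩ M) (base := base) ?_ hQ2 hw2 hw3
    (fun h1 => hhit _ (hs1 h1)) ?_ ?_
  · exact hopt
  · refine Eq.trans ?_ h
    unfold Search.extend
    simp only
    congr 1
    funext w
    cases Nat.ble 2 D <;> rfl
  · intro h1
    refine hhit _ ?_
    rcases eq_or_lt_of_le h1 with h1 | h1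
    · rw [← h1, rows_succ_succ 0, ← hb1]; exact List.suffix_rfl
    · rw [show L.wp (p - s) = 3 by omega, rows_succ_succ 1, rows_succ_succ 0, ← hb1]
      exact List.suffix_cons _ _
  · intro h1
    refine hhit _ ?_
    rw [show L.wp (p - s) = 3 by omega, rows_succ_succ 1, rows_succ_succ 0, ← hb1]
    exact List.suffix_rfl

/-- The number of extensions towards the other window within the given number of steps. -/
def inner : ℕ → Bool → Bool → ℕ
  | 0, _, _ => 0
  | f + 1, h₁, h₂ => boolNat h₁ + inner f h₂ (!h₁)

theorem refute_zero (D n : ℕ) (A B : Seg) (Ms : List (List ℕ)) :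
    refute D 0 n A B Ms = unlessNil Ms fun _ => false := rfl

theorem refute_succ (D fuel n : ℕ) (A B : Seg) (Ms : List (List ℕ)) :
    refute D (fuel + 1) n A B Ms = unlessNil Ms fun Ms => Bool.rec (refute D fuel n B A.rev Ms)
      (extend D n A B Ms fun A' Ms' => refute D fuel (n + 1) B A'.rev Ms') A.lo := rfl

theorem refute_sound {L : Line N} {D : ℕ} (H : L.Hyp D) : ∀ (fuel n : ℕ) {l l' : ℕ} {hs : List ℤ}
    {A B : Seg} {p s p' s' τ : ℤ} {Ms : List (List ℕ)} {M : List ℕ}, n + fuel ≤ 19 →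
    SegAt L n hs A p s l → SegAt L n hs B p' s' l' → hs.length = n + 1 → hs.Nodup →
    (∀ u ∈ hs, u ∈ win p s l ∨ u ∈ win p' s' l') → (τ = 1 ∨ τ = -1) →
    (∀ a ∈ win p s l, ∀ b ∈ win p' s' l',
      2 + (inner fuel (decide (s = -τ)) (decide (s' = τ)) : ℤ) ≤ τ * (b - a)) →
    M ∈ Ms → Rep (hs.map L.X) M → refute D fuel n A B Ms = true → False := by
  intro fuel
  induction fuel with
  | zero =>
    intro n l l' hs A B p s p' s' τ Ms M _ _ _ _ _ _ _ _ hM _ h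
    rw [refute_zero] at h
    exact absurd (unlessNil_of_mem h hM) (by simp)
  | succ fuel ih =>
    intro n l l' hs A B p s p' s' τ Ms M hnf hA hB hlen hn hcov hτ hgap hM hrep h
    rw [refute_succ] at h
    have h1 := unlessNil_of_mem h hM
    have hflag : (!decide (s = -τ)) = decide (-s = -τ) := by
      rcases hA.dir with rfl | rfl <;> rcases hτ with rfl | rfl <;> decide
    have hτ' : -τ = 1 ∨ -τ = -1 := by omega
    have hh : inner (fuel + 1) (decide (s = -τ)) (decide (s' = τ)) = boolNat (decide (s = -τ)) +
        inner fuel (decide (s' = - -τ)) (decide (-s = -τ)) := by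
      rw [inner, hflag, neg_neg]
    rw [hh] at hgap
    cases hlo : A.lo with
    | false =>
      rw [hlo] at h1
      refine ih n (by omega) hB hA.rev hlen hn (fun u hu => ?_) hτ' (fun b hb a ha => ?_) hM hrep h1
      · rw [mem_win_rev]; exact (hcov u hu).symm
      · rw [mem_win_rev] at ha
        have := hgap a ha b hb
        push_cast at this
        linarith
    | true =>
      rw [hlo] at h1
      have h2 := hA.lo
      rw [hlo, eq_comm, Bool.and_eq_true, decide_eq_true_iff] at h2
      obtain ⟨hl, hv⟩ := h2
      obtain ⟨l, rfl⟩ : ∃ m, l = m + 1 := ⟨l - 1, by omega⟩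
      have hpm : p ∈ win p s (l + 1) := by rw [win_succ]; exact List.mem_cons_self
      have hstep : 2 * (boolNat (decide (s = -τ)) : ℤ) = 1 - τ * s := by
        rcases hA.dir with rfl | rfl <;> rcases hτ with rfl | rfl <;> decide
      have hb8 : ∀ b ∈ win p' s' l', 2 + (inner fuel (decide (s' = - -τ)) (decide (-s = -τ)) : ℤ) ≤
          τ * (b - (p - s)) := by
        intro b hb
        have := hgap p hpm b hb
        push_cast at this
        have e : τ * (b - (p - s)) = τ * (b - p) + τ * s := by ring
        rw [e]
        have : τ * s = 1 ∨ τ * s = -1 := by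
          rcases hA.dir with rfl | rfl <;> rcases hτ with rfl | rfl <;> simp
        omega
      have hfar : ∀ u ∈ hs, u ≠ p → u + 2 ≤ p - s ∨ p - s + 2 ≤ u := by
        intro u hu hup
        rcases hcov u hu with h | h
        · obtain ⟨i, -, rfl⟩ := mem_win.1 h
          rcases Nat.eq_zero_or_pos i with rfl | hi
          · simp at hup
          · rcases hA.dir with rfl | rfl <;> omega
        · have := hb8 u h
          rcases hτ with rfl | rfl <;> omega
      have hok : ∀ u ∈ hs, L.ok u = true := by
        intro u hu
        rcases hcov u hu with h | h
        · obtain ⟨i, hi, rfl⟩ := mem_win.1 h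
          exact hA.ok i hi
        · obtain ⟨i, hi, rfl⟩ := mem_win.1 h
          exact hB.ok i hi
      have hgap' : ∀ a ∈ win (p - s) s (l + 2), ∀ b ∈ win p' s' l',
          2 + (inner fuel (decide (s' = - -τ)) (decide (-s = -τ)) : ℤ) ≤ τ * (b - a) := by
        intro a ha b hb
        rw [win_succ, sub_add_cancel] at ha
        rcases List.mem_cons.1 ha with rfl | ha
        · exact hb8 b hb
        · have := hgap a ha b hb
          push_cast at this
          linarith [Int.natCast_nonneg (boolNat (decide (s = -τ)))]
      have hdis : ∀ u ∈ win (p - s) s (l + 2), u ∉ win p' s' l' := by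
        intro u hu hu'
        have := hgap' u hu u hu'
        rw [sub_self, mul_zero] at this
        omega
      obtain ⟨A', Ms', M', hA', hM', hrep', hk⟩ := extend_sound H hA hB (by omega) hn hok hv hfar
        hdis hM hrep h1
      refine ih (n + 1) (by omega) (hB.push _) hA'.rev (by simp [hlen]) ?_ (fun u hu => ?_) hτ'
        (fun b hb a ha => ?_) hM' hrep' hk
      · refine List.nodup_cons.2 ⟨fun hmem => ?_, hn⟩
        by_cases hps : p - s = p
        · rcases hA.dir with rfl | rfl <;> omega
        · have := hfar _ hmem hps
          omega
      · rw [mem_win_rev, win_succ, sub_add_cancel]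
        rcases List.mem_cons.1 hu with rfl | hu
        · exact Or.inr List.mem_cons_self
        · rcases hcov u hu with h | h
          · exact Or.inr (List.mem_cons_of_mem _ h)
          · exact Or.inl h
      · rw [mem_win_rev] at ha
        have := hgap' a ha b hb
        linarith

theorem exists_rep_singleton {two : Bool} {x : Fin N → ℤ} {w : ℕ} (hx : ∀ e, |x e| ≤ bound two)
    (hw : dot x x = w) (hw7 : w ≤ 7) : ∃ M, IsFresh two w M ∧ Rep [x] M := by
  have hcode : ∀ e, code [x] e = x e := fun e => by simp [code, value]
  set cs₀ := (univ.filter fun e => x e ≠ 0).toList with hcs₀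
  have hmem : ∀ e, e ∈ cs₀ ↔ x e ≠ 0 := fun e => by simp [cs₀]
  have hsum : ((cs₀.map fun e => (x e).natAbs).map (· ^ 2)).sum = w := by
    rw [List.map_map, hcs₀, sum_map_toList]
    zify
    rw [← hw, dot, sum_filter_of_ne]
    · exact sum_congr rfl fun e _ => by simp [sq]
    · intro e _ h h0
      simp [h0] at h
  obtain ⟨F, hF, hp⟩ := exists_isFresh (two := two) (l := cs₀.map fun e => (x e).natAbs)
    (fun a ha => by
      obtain ⟨e, he, rfl⟩ := List.mem_map.1 ha
      have h1 := (hmem e).1 he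
      have h2 := abs_le.1 (hx e)
      exact ⟨Int.natAbs_pos.2 h1, by omega⟩) (by rw [hsum]; exact hw7)
  rw [hsum] at hF
  obtain ⟨cs, hcs, rfl⟩ := exists_map_of_perm hp
  refine ⟨_, hF, cs, hcs.nodup_iff.2 (nodup_toList _), fun e => ?_, ?_, hF.sorted⟩
  · rw [hcs.mem_iff, hmem, hcode]
  · exact List.map_congr_left fun e _ => by rw [hcode]

theorem countB_map {α : Type} {q : ℕ → Bool} {r : α → ℕ} {p : α → Bool} : ∀ {l : List α},
    (∀ a ∈ l, q (r a) = p a) → countB q (l.map r) = (l.filter p).length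
  | [], _ => rfl
  | a :: l, h => by
    have ih := countB_map fun b hb => h b (List.mem_cons_of_mem _ hb)
    change (Bool.rec (countB q (l.map r)) (countB q (l.map r)).succ (q (r a)) : ℕ) = _
    rw [ih, h a List.mem_cons_self, List.filter_cons]
    cases p a <;> rfl

theorem overlap_eq {Y : List (Fin N → ℤ)} {M : List ℕ} (hrep : Rep Y M) (hl : Y.length ≤ 20)
    (hY : ∀ y ∈ Y, ∀ e, |y e| ≤ 2) {a b c : ℕ} {x y z : Fin N → ℤ} (ha : Y[a]? = some x)
    (hb : Y[b]? = some y) (hc : Y[c]? = some z) :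
    overlap (8 ^ a) (8 ^ b) (8 ^ c) M = (supp x ∩ supp y ∩ supp z).card := by
  obtain ⟨cs, hn, hcs, rfl, -⟩ := hrep
  have key : ∀ {j : ℕ} {u : Fin N → ℤ}, Y[j]? = some u → ∀ e ∈ cs,
      (digitNZ (8 ^ j) (code Y e).natAbs = true ↔ u e ≠ 0) := by
    intro j u hu e he
    have hj : j < 20 := lt_of_lt_of_le (List.getElem?_eq_some_iff.1 hu).1 hl
    rw [digitNZ_iff (by rw [length_digits]; exact hl) (abs_digits_le fun y hy => hY y hy e)
      (value_digits Y e) hj, digits_getD hu, mul_ne_zero_iff, Ne, Int.sign_eq_zero_iff_zero]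
    exact and_iff_right ((hcs e).1 he)
  unfold overlap
  rw [countB_map (p := fun e => decide (x e ≠ 0 ∧ y e ≠ 0 ∧ z e ≠ 0))]
  · rw [← List.toFinset_card_of_nodup (hn.filter _)]
    congr 1
    ext e
    simp only [List.mem_toFinset, List.mem_filter, decide_eq_true_eq, supp, mem_inter, mem_filter,
      mem_univ, true_and]
    refine ⟨fun h => ⟨⟨h.2.1, h.2.2.1⟩, h.2.2.2⟩, fun h => ⟨?_, h.1.1, h.1.2, h.2⟩⟩
    exact (hcs e).2 (code_ne_zero (fun y hy => hY y hy e) (List.mem_of_getElem? ha) h.1.1)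
  · intro e he
    rw [andB_eq, andB_eq, Bool.eq_iff_iff, Bool.and_eq_true, Bool.and_eq_true,
      key ha e he, key hb e he, key hc e he,
      decide_eq_true_iff]

theorem build_zero (D : ℕ) (viol : List ℕ → List ℕ → Bool) (n : ℕ) (A : Seg)
    (Ms : List (List ℕ)) : build D viol 0 n A Ms =
      refute D (Nat.sub 19 n) n A emptySeg (filterB (viol A.ws) Ms) := rfl

theorem build_succ (D : ℕ) (viol : List ℕ → List ℕ → Bool) (d n : ℕ) (A : Seg)
    (Ms : List (List ℕ)) : build D viol (d + 1) n A Ms = Bool.rec true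
      (extend D n A emptySeg Ms fun A' Ms' => build D viol d (n + 1) A' Ms') A.lo := rfl

theorem segAt_empty (L : Line N) (n : ℕ) (hs : List ℤ) : SegAt L n hs emptySeg 0 1 0 where
  dir := Or.inl rfl
  ok i hi := absurd hi (Nat.not_lt_zero _)
  ws := rfl
  len := rfl
  times i t h := by simp [emptySeg] at h
  lo := rfl
  ro := rfl

theorem nodup_win {p s : ℤ} (hs : s = 1 ∨ s = -1) (l : ℕ) : (win p s l).Nodup := by
  refine List.Nodup.map (fun i j h => ?_) List.nodup_range
  rcases hs with rfl | rfl <;> simpa using h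

theorem length_win (p s : ℤ) (l : ℕ) : (win p s l).length = l := by simp [win]

theorem build_sound {L : Line N} {D : ℕ} (H : L.Hyp D) {viol : List ℕ → List ℕ → Bool} {s : ℤ} :
    ∀ (d n : ℕ) {A : Seg} {Ms : List (List ℕ)} {p : ℤ} {M : List ℕ}, n + d ≤ 19 →
    SegAt L n (win p s (n + 1)) A p s (n + 1) → (∀ i : ℕ, i ≤ d → L.ok (p - s * i) = true) →
    M ∈ Ms → Rep ((win p s (n + 1)).map L.X) M → build D viol d n A Ms = true →
    ∃ M', Rep ((win (p - s * d) s (n + d + 1)).map L.X) M' ∧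
      viol ((win (p - s * d) s (n + d + 1)).map L.wp) M' = false := by
  intro d
  induction d with
  | zero =>
    intro n A Ms p M hn hA _ hM hrep h
    rw [Nat.cast_zero, mul_zero, sub_zero]
    refine ⟨M, hrep, ?_⟩
    by_contra hv
    rw [Bool.not_eq_false] at hv
    rw [build_zero] at h
    refine refute_sound H (Nat.sub 19 n) n (τ := 1) (Nat.add_sub_cancel' hn).le hA
      (segAt_empty L n _) (length_win _ _ _) (nodup_win hA.dir _) (fun u hu => Or.inl hu)
      (Or.inl rfl) (fun a _ b hb => ?_) (mem_filterB (by rw [hA.ws]; exact hv) hM) hrep h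
    simp [win] at hb
  | succ d ih =>
    intro n A Ms p M hn hA hok hM hrep h
    have hv : L.ok (p - s) = true := by simpa using hok 1 (by omega)
    rw [build_succ, hA.lo, hv] at h
    simp only [Nat.zero_lt_succ, decide_true, Bool.and_true] at h
    have hw : ∀ m, (p - s) :: win p s m = win (p - s) s (m + 1) := fun m => by
      rw [win_succ, sub_add_cancel]
    obtain ⟨A', Ms', M', hA', hM', hrep', hk⟩ := extend_sound H hA
      (segAt_empty L n _) (by rw [length_win]; omega) (nodup_win hA.dir _)
      (fun u hu => by obtain ⟨i, hi, rfl⟩ := mem_win.1 hu; exact hA.ok i hi) hv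
      (fun u hu hup => by
        obtain ⟨i, -, rfl⟩ := mem_win.1 hu
        rcases Nat.eq_zero_or_pos i with rfl | hi
        · simp at hup
        · rcases hA.dir with rfl | rfl <;> omega)
      (fun u _ hu => by simp [win] at hu) hM hrep h
    rw [hw] at hA' hrep'
    have := ih (n + 1) (by omega) hA' (fun i hi => by
      rw [← hok (i + 1) (by omega)]
      congr 1
      push_cast
      ring) hM' hrep' hk
    rw [show p - s - s * (d : ℤ) = p - s * ((d + 1 : ℕ) : ℤ) by push_cast; ring,
      show n + 1 + d + 1 = n + (d + 1) + 1 by omega] at this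
    exact this

theorem mem_starts {w : ℕ} {a b : Bool} (h2 : 2 ≤ w + boolNat a + boolNat b) (h3 : w ≤ 3) :
    (w, a, b) ∈ starts := by
  cases a <;> cases b <;> interval_cases w <;> simp [boolNat] at h2 <;> decide

theorem segAt_singleton {L : Line N} {n t : ℕ} {hs : List ℤ} {p s : ℤ} (hs1 : s = 1 ∨ s = -1)
    (hp : L.ok p = true) (ht : t ≤ n) (hh : hs[n - t]? = some p) :
    SegAt L n hs ⟨[L.wp p], [t], L.ok (p - s), L.ok (p + s)⟩ p s 1 where
  dir := hs1
  ok i hi := by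
    obtain rfl : i = 0 := by omega
    simpa using hp
  ws := by simp [win]
  len := rfl
  times i t' h := by
    cases i with
    | zero =>
      obtain rfl : t = t' := by simpa using h
      simpa using ⟨ht, hh⟩
    | succ i => simp at h
  lo := by simp
  ro := by simp

theorem single_sound {L : Line N} {D d : ℕ} (H : L.Hyp D) (hd : d ≤ 19)
    {viol : List ℕ → List ℕ → Bool} {i : ℕ → List (List ℕ)} (h : single D d viol i = true) {k : ℤ}
    (hok : ∀ j : ℕ, j ≤ d → L.ok (k + j) = true) {M : List ℕ}
    (hM : M ∈ i (L.wp (k + d) + boolNat (L.ok (k + d - 1)) + boolNat (L.ok (k + d + 1))))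
    (hrep : Rep [L.X (k + d)] M) :
    ∃ M', Rep ((win k 1 (d + 1)).map L.X) M' ∧ viol ((win k 1 (d + 1)).map L.wp) M' = false := by
  have hp := hok d le_rfl
  have h1 := List.all_eq_true.1 h _ (mem_starts (L.two_le _ hp) (L.wp_le_three hp))
  have h2 := build_sound H (s := 1) d 0 (p := k + d) (by omega)
    (segAt_singleton (Or.inl rfl) hp le_rfl (by simp [win])) (fun j hj => by
      rw [← hok (d - j) (by omega), Nat.cast_sub hj]
      congr 1
      ring) hM (by simpa [win] using hrep) h1
  rw [one_mul, add_sub_cancel_right, zero_add] at h2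
  exact h2

theorem exists_mem_unitStart {L : Line N} (h1 : ∀ k e, L.ok k = true → |L.X k e| ≤ 1) {k : ℤ}
    (hk : L.ok k = true) :
    ∃ M ∈ unitStart (L.wp k + boolNat (L.ok (k - 1)) + boolNat (L.ok (k + 1))),
      Rep [L.X k] M := by
  have hw := L.self k hk
  have h5 := L.dot_self_le hk
  rw [hw] at h5
  obtain ⟨M, hM, hr⟩ := exists_rep_singleton (two := false) (fun e => h1 k e hk) hw (by omega)
  refine ⟨M, ?_, hr⟩
  rcases hM with rfl | ⟨h, -⟩
  · unfold unitStart
    rw [ones_eq, List.append_nil]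
    exact List.mem_singleton_self _
  · cases h

namespace Line
variable (L : Line N)

theorem hyp_zero : L.Hyp 0 where
  one h := by omega
  two h := by omega
  far t _ h := by omega

theorem hyp_one : L.Hyp 1 where
  one _ k e hk := by
    by_contra h
    have hw := L.self k hk
    have h5 := L.dot_self_le hk
    rw [hw] at h5
    obtain ⟨M, hM, hr⟩ := exists_rep_singleton (two := true) (fun e => L.abs_le_two hk e) hw
      (by omega)
    have hbig : M ∈ bigStart (L.wp k + boolNat (L.ok (k - 1)) + boolNat (L.ok (k + 1))) := by
      rcases hM with rfl | ⟨-, h4, rfl⟩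
      · exfalso
        obtain ⟨cs, -, hcs, hcm, -⟩ := hr
        have hc : code [L.X k] e = L.X k e := by simp [code, value]
        have he : e ∈ cs := (hcs e).2 (by rw [hc]; intro h0; rw [h0] at h; simp at h)
        have h1 : (L.X k e).natAbs ∈ List.replicate
            (L.wp k + boolNat (L.ok (k - 1)) + boolNat (L.ok (k + 1))) 1 := by
          rw [hcm, ← hc]
          exact List.mem_map_of_mem (f := fun e => (code [L.X k] e).natAbs) he
        have := List.eq_of_mem_replicate h1
        exact h (by rw [Int.abs_eq_natAbs, this]; rfl)
      · obtain h | h : L.wp k + boolNat (L.ok (k - 1)) + boolNat (L.ok (k + 1)) = 4 ∨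
          L.wp k + boolNat (L.ok (k - 1)) + boolNat (L.ok (k + 1)) = 5 := by omega
        all_goals rw [h]; simp [bigStart]
    obtain ⟨M', -, hv⟩ := single_sound L.hyp_zero (by omega) single_zero (k := k) (fun j hj => by
      obtain rfl : j = 0 := by omega
      simpa using hk) (M := M) (by simpa using hbig) (by simpa using hr)
    simp [viol] at hv
  two h := by omega
  far t _ h := by omega

variable {L}

/-- Consecutive vertices have a representation that passes a given test. -/
theorem Hyp.exists_rep {D d : ℕ} (H : L.Hyp D) (hD : 1 ≤ D) (hd : d ≤ 7)
    {viol : List ℕ → List ℕ → Bool} (h : single D d viol unitStart = true) {k : ℤ}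
    (hk : L.ok k = true) (hl : L.ok (k + d) = true) :
    ∃ M, Rep ((win k 1 (d + 1)).map L.X) M ∧ viol ((win k 1 (d + 1)).map L.wp) M = false ∧
      ∀ a b c : ℕ, a ≤ d → b ≤ d → c ≤ d → overlap (8 ^ a) (8 ^ b) (8 ^ c) M =
        (supp (L.X (k + a)) ∩ supp (L.X (k + b)) ∩ supp (L.X (k + c))).card := by
  have hok : ∀ j : ℕ, j ≤ d → L.ok (k + j) = true := fun j hj =>
    L.conv k _ _ hk hl (by omega) (by omega) (by omega)
  obtain ⟨M, hM, hr⟩ := exists_mem_unitStart (H.one hD) hl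
  obtain ⟨M', h1, h2⟩ := single_sound H (by omega) h hok hM hr
  refine ⟨M', h1, h2, fun a b c ha hb hc => ?_⟩
  have hget : ∀ j ≤ d, ((win k 1 (d + 1)).map L.X)[j]? = some (L.X (k + j)) := by
    intro j hj
    simp only [win, List.map_map, List.getElem?_map, List.getElem?_range (show j < d + 1 by omega)]
    simp
  refine overlap_eq h1 (by rw [List.length_map, length_win]; omega) ?_ (hget a ha) (hget b hb)
    (hget c hc)
  intro y hy e
  obtain ⟨u, hu, rfl⟩ := List.mem_map.1 hy
  obtain ⟨i, hi, rfl⟩ := mem_win.1 hu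
  refine L.abs_le_two ?_ e
  rw [one_mul]
  exact hok i (by omega)

variable (L)

theorem hyp_two : L.Hyp 2 where
  one _ := L.hyp_one.one le_rfl
  two _ k hk hl := by
    obtain ⟨M, -, hv, ho⟩ := L.hyp_one.exists_rep le_rfl (by omega) single_one hk
      (by simpa using hl)
    have h1 := ho 0 1 0 (by omega) le_rfl (by omega)
    simp only [pow_zero, pow_one, Nat.cast_zero, add_zero, Nat.cast_one] at h1
    simp only [viol, Bool.not_eq_false', Nat.beq_eq, h1] at hv
    rwa [inter_right_comm, inter_self] at hv
  far t h3 h := by omega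

theorem win_three (k : ℤ) : win k 1 3 = [k, k + 1, k + 2] := by
  simp [win, List.range_succ]

theorem overlap_near {k : ℤ} (hk : L.ok k = true) (hl : L.ok (k + 2) = true) :
    (supp (L.X k) ∩ supp (L.X (k + 2))).card = 0 ∨
    (0 < L.wp k ∧ 0 < L.wp (k + 2) ∧ (supp (L.X k) ∩ supp (L.X (k + 2))).card = 2 ∧
      (supp (L.X k) ∩ supp (L.X (k + 1)) ∩ supp (L.X (k + 2))).card = 1) := by
  obtain ⟨M, -, hv, ho⟩ := L.hyp_two.exists_rep (by omega) (by omega) single_two hk hl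
  have h1 := ho 0 2 0 (by omega) le_rfl (by omega)
  have h2 := ho 0 2 1 (by omega) le_rfl (by omega)
  norm_num at h1 h2
  rw [← inter_assoc, inter_right_comm, inter_self] at h1
  rw [← inter_assoc, inter_right_comm] at h2
  rw [win_three, List.map_cons, List.map_cons, List.map_cons, List.map_nil] at hv
  rcases Nat.eq_zero_or_pos (L.wp k) with h | hpos
  · rw [h] at hv
    simp only [viol, h1, Nat.ble_eq, ← Bool.not_eq_true] at hv
    omega
  rcases Nat.eq_zero_or_pos (L.wp (k + 2)) with h | hpos'
  · obtain ⟨m, hm⟩ : ∃ m, L.wp k = m + 1 := ⟨L.wp k - 1, by omega⟩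
    rw [h, hm] at hv
    simp only [viol, h1, Nat.ble_eq, ← Bool.not_eq_true] at hv
    omega
  · obtain ⟨m, hm⟩ : ∃ m, L.wp k = m + 1 := ⟨L.wp k - 1, by omega⟩
    obtain ⟨m', hm'⟩ : ∃ m, L.wp (k + 2) = m + 1 := ⟨L.wp (k + 2) - 1, by omega⟩
    rw [hm', hm] at hv
    simp only [viol, h1, h2, Bool.not_eq_false', Bool.or_eq_true, Bool.and_eq_true, Nat.beq_eq]
      at hv
    rcases hv with hv | hv
    · exact Or.inl hv
    · exact Or.inr ⟨hpos, hpos', hv⟩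

variable {L}

theorem Hyp.succ {D : ℕ} (H : L.Hyp D) (hD : 3 ≤ D) (hD' : D ≤ 7)
    (h : single D D (viol D) unitStart = true) : L.Hyp (D + 1) where
  one _ := H.one (by omega)
  two _ := H.two (by omega)
  far t h3 ht k hk hl e := by
    rcases Nat.lt_succ_iff_lt_or_eq.1 ht with ht | rfl
    · exact H.far t h3 ht k hk hl e
    · obtain ⟨M, -, hv, ho⟩ := H.exists_rep (by omega) (by omega) h hk hl
      have h1 := ho 0 t 0 (by omega) le_rfl (by omega)
      simp only [pow_zero, Nat.cast_zero, add_zero] at h1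
      rw [inter_right_comm, inter_self] at h1
      have hv' : Nat.ble 1 (overlap 1 (8 ^ t) 1 M) = false := by
        rw [← hv]
        match t, h3 with
        | t + 3, _ => rfl
      rw [h1, ← Bool.not_eq_true, Nat.ble_eq, Nat.not_le, Nat.lt_one_iff, card_eq_zero] at hv'
      by_contra hc
      rw [not_or] at hc
      have : e ∈ supp (L.X k) ∩ supp (L.X (k + t)) := by simpa [supp] using hc
      rw [hv'] at this
      simp at this

variable (L)

theorem hyp_three : L.Hyp 3 where
  one _ := L.hyp_two.one (by omega)
  two _ := L.hyp_two.two le_rfl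
  far t h3 h := by omega

theorem hyp_eight : L.Hyp 8 :=
  (((((L.hyp_three.succ (by omega) (by omega) single_three).succ (by omega) (by omega)
    single_four).succ (by omega) (by omega) single_five).succ (by omega) (by omega)
    single_six).succ (by omega) (by omega) single_seven)

theorem abs_le_one {k : ℤ} (hk : L.ok k = true) (e : Fin N) : |L.X k e| ≤ 1 :=
  L.hyp_one.one le_rfl k e hk

theorem nohit_pair {k l : ℤ} (hk : L.ok k = true) (hl : L.ok l = true) (hkl : k ≠ l) (R : List ℕ)
    (hR : R <:+ rows [L.wp k] ++ 0 :: rows [L.wp l]) : hit R = false :=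
  L.nohit k 1 1 l 1 1 (Or.inl rfl) (Or.inl rfl) (by simpa [win] using hk) (by simpa [win] using hl)
    (by simpa [win] using hkl) R (by simpa [win] using hR)

theorem far_eight {k l : ℤ} (hk : L.ok k = true) (hl : L.ok l = true) (hkl : k + 8 ≤ l) :
    (supp (L.X l) ∩ supp (L.X k)).card = 0 := by
  by_contra hne
  have h1 := List.all_eq_true.1 (List.all_eq_true.1 double_eq_true _
    (mem_starts (L.two_le k hk) (L.wp_le_three hk))) _
    (mem_starts (L.two_le l hl) (L.wp_le_three hl))
  simp only [orB_eq, Bool.or_eq_true] at h1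
  obtain ⟨M, hM, hrep⟩ := exists_mem_unitStart (fun k e hk => L.abs_le_one hk e) hk
  have hw := L.self l hl
  have h5 := L.dot_self_le hl
  rw [hw] at h5
  obtain ⟨Q, hQ1, hQ2⟩ := rep_step (two := false) (nb := false) (k := 0)
    (f := fun a => Nat.beq (Nat.land (shift a) 0) 0)
    (g := fun a => Nat.beq (Nat.land (shift a) 0) 0)
    (h := fun a => notB (Nat.ble (Nat.land (shift a) 0) 0))
    hrep (fun e => L.abs_le_one hl e) hw (by omega)
    (by
      rw [sum_mul_code]
      simp [value, L.far' hl hk (Or.inr (by omega))])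
    (fun e _ he => by
      rw [← Bool.not_eq_true, Nat.beq_eq] at he
      exact absurd (Nat.and_zero _) he)
    (fun _ e _ => by
      have : Nat.beq (Nat.land (shift (code [L.X k] e).natAbs) 0) 0 = true := by
        rw [Nat.beq_eq]; exact Nat.and_zero _
      rw [this]; rfl)
    (fun h => by cases h)
  have hmem : Q ∈ sols false 0 (L.wp l + boolNat (L.ok (l - 1)) + boolNat (L.ok (l + 1))) false
      (preps 1 0 0 0 0
        (unitStart (L.wp k + boolNat (L.ok (k - 1)) + boolNat (L.ok (k + 1))))) := by
    refine mem_sols hM ?_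
    rw [prep_eq_prepWith]
    exact hQ2
  have ho := overlap_eq (a := 0) (b := 1) (c := 1) (x := L.X l) (y := L.X k) (z := L.X k) hQ1
    (by simp) (fun y hy e => by
      simp only [List.mem_cons, List.not_mem_nil, or_false] at hy
      rcases hy with rfl | rfl
      · exact L.abs_le_two hl e
      · exact L.abs_le_two hk e) rfl rfl rfl
  rw [inter_assoc, inter_self, pow_zero, pow_one] at ho
  rcases h1 with (h1 | h1) | h1
  · cases hb : Nat.ble 1 (L.wp k) with
    | false => rw [hb] at h1; cases h1
    | true =>
      rw [hb] at h1
      have := L.nohit_pair hk hl (by omega) _ List.suffix_rfl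
      simp only at h1
      rw [this] at h1
      cases h1
  · cases hb : Nat.ble 2 (L.wp k) with
    | false => rw [hb] at h1; cases h1
    | true =>
      rw [hb] at h1
      have := L.nohit_pair hk hl (by omega) ((rows [L.wp k]).tail ++ 0 :: rows [L.wp l]) (by
        rw [Nat.ble_eq] at hb
        obtain ⟨m, hm⟩ : ∃ m, L.wp k = m + 2 := ⟨L.wp k - 2, by omega⟩
        rw [hm]
        exact List.suffix_cons _ _)
      simp only at h1
      rw [this] at h1
      cases h1
  · refine refute_sound L.hyp_eight 12 1 (τ := -1) (hs := [l, k]) (by omega)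
      (segAt_singleton (Or.inl rfl) hl le_rfl rfl)
      (segAt_singleton (Or.inl rfl) hk (by omega) rfl) rfl ?_ ?_ (Or.inr rfl) ?_
      (mem_filterB ?_ hmem) hQ1 h1
    · simp; omega
    · intro u hu
      simpa [win] using hu
    · intro a ha b hb
      simp only [win, List.range_one, List.map_cons, List.map_nil, List.mem_singleton,
        Nat.cast_zero, mul_zero, add_zero] at ha hb
      rw [ha, hb]
      have : inner 12 (decide ((1 : ℤ) = - -1)) (decide ((1 : ℤ) = -1)) = 6 := by decide
      rw [this]
      push_cast
      linarith
    · rw [Nat.ble_eq, ho]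
      omega

theorem disjoint_of_far {k l : ℤ} (hk : L.ok k = true) (hl : L.ok l = true) (h : k + 3 ≤ l) :
    (supp (L.X k) ∩ supp (L.X l)).card = 0 := by
  by_cases h8 : k + 8 ≤ l
  · rw [inter_comm]
    exact L.far_eight hk hl h8
  · obtain ⟨t, rfl⟩ : ∃ t : ℕ, l = k + t := ⟨(l - k).toNat, by omega⟩
    rw [card_eq_zero, eq_empty_iff_forall_notMem]
    intro e he
    have := L.hyp_eight.far t (by omega) (by omega) k hk hl e
    simp only [supp, mem_inter, mem_filter, mem_univ, true_and] at he
    tauto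

theorem card_supp {k : ℤ} (hk : L.ok k = true) :
    ((supp (L.X k)).card : ℤ) = dot (L.X k) (L.X k) := by
  rw [supp, card_eq_sum_ones, sum_filter, dot]
  push_cast
  refine sum_congr rfl fun e _ => ?_
  have := abs_le.1 (L.abs_le_one hk e)
  have h3 : L.X k e = 0 ∨ L.X k e = 1 ∨ L.X k e = -1 := by omega
  rcases h3 with h | h | h <;> simp [h]

/-- A vertex whose two neighbours are not disjoint. -/
def Crossed (x : ℤ) : Prop :=
  L.ok (x - 1) = true ∧ L.ok (x + 1) = true ∧ (supp (L.X (x - 1)) ∩ supp (L.X (x + 1))).card ≠ 0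

variable {L}

theorem Crossed.two {x : ℤ} (h : L.Crossed x) : 0 < L.wp (x - 1) ∧ 0 < L.wp (x + 1) ∧
    (supp (L.X (x - 1)) ∩ supp (L.X (x + 1))).card = 2 ∧
      (supp (L.X (x - 1)) ∩ supp (L.X x) ∩ supp (L.X (x + 1))).card = 1 := by
  have e1 : x - 1 + 2 = x + 1 := by ring
  have := L.overlap_near h.1 (by rw [e1]; exact h.2.1)
  rw [e1, sub_add_cancel] at this
  exact this.resolve_left h.2.2

theorem Crossed.ok {x : ℤ} (h : L.Crossed x) : L.ok x = true :=
  L.conv _ _ _ h.1 h.2.1 (by omega) (by omega) (by omega)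

theorem crossed_window {x : ℤ} (h : L.Crossed x) : ∃ a b c, a < 3 ∧ b < 4 ∧ c < 3 ∧
    (win (x - 1) 1 3).map L.wp = [1 + a, b, c + 1] := by
  have h1 := h.two
  have h2 := L.wp_le_three h.1
  have h3 := L.wp_le_three h.ok
  have h4 := L.wp_le_three h.2.1
  refine ⟨L.wp (x - 1) - 1, L.wp x, L.wp (x + 1) - 1, by omega, by omega, by omega, ?_⟩
  rw [win_three, sub_add_cancel, show x - 1 + 2 = x + 1 by ring, List.map_cons, List.map_cons,
    List.map_cons, List.map_nil, Nat.add_sub_cancel' h1.1, Nat.sub_add_cancel h1.2.1]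

theorem Crossed.not_adjacent {x : ℤ} (h : L.Crossed x) (h' : L.Crossed (x + 1)) : False := by
  have h1 := h.2.2
  have h2 := h'.2.2
  have e1 : x + 1 - 1 = x := by ring
  have e2 : x + 1 + 1 = x - 1 + 3 := by ring
  rw [e1, e2] at h2
  obtain ⟨M, -, hv, ho⟩ := L.hyp_three.exists_rep (by omega) (by omega) single_adjacent h.1
    (by simpa [e2] using h'.2.1)
  have o1 := ho 0 2 2 (by omega) (by omega) (by omega)
  have o2 := ho 1 3 3 (by omega) (by omega) (by omega)
  norm_num at o1 o2
  rw [show x - 1 + 2 = x + 1 by ring] at o1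
  rw [← Nat.pos_iff_ne_zero] at h1 h2
  rw [violAdjacent, o1, o2, Nat.ble_eq_true_of_le h1, Nat.ble_eq_true_of_le h2] at hv
  cases hv

theorem Crossed.not_near {x : ℤ} (h : L.Crossed x) (h' : L.Crossed (x + 2)) : False := by
  have h1 := h.2.2
  have h2 := h'.2.2
  have e1 : x + 2 - 1 = x + 1 := by ring
  have e2 : x + 2 + 1 = x - 1 + 4 := by ring
  rw [e1, e2] at h2
  obtain ⟨M, -, hv, ho⟩ := (L.hyp_three.succ le_rfl (by omega) single_three).exists_rep (by omega)
    (by omega) single_near h.1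
    (by simpa [e2] using h'.2.1)
  have o1 := ho 0 2 2 (by omega) (by omega) (by omega)
  have o2 := ho 2 4 4 (by omega) (by omega) (by omega)
  norm_num at o1 o2
  rw [show x - 1 + 2 = x + 1 by ring] at o1 o2
  rw [← Nat.pos_iff_ne_zero] at h1 h2
  rw [violNear, o1, o2, Nat.ble_eq_true_of_le h1, Nat.ble_eq_true_of_le h2] at hv
  cases hv

theorem rows_add_suffix (a : ℕ) (l : List ℕ) : rows (1 :: l) <:+ rows ((1 + a) :: l) := by
  rw [add_comm]
  induction a with
  | zero => exact List.suffix_rfl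
  | succ a ih => exact ih.trans (List.suffix_cons _ _)

theorem Crossed.unique_of_le {x y : ℤ} (h : L.Crossed x) (h' : L.Crossed y) (hxy : x ≤ y) :
    x = y := by
  by_contra hne
  obtain rfl | hy : y = x + 1 ∨ x + 2 ≤ y := by omega
  · exact h.not_adjacent h'
  obtain rfl | hy : y = x + 2 ∨ x + 3 ≤ y := by omega
  · exact h.not_near h'
  obtain ⟨a, b, c, ha, hb, hc, hw⟩ := crossed_window h
  obtain ⟨a', b', c', ha', hb', hc', hw'⟩ := crossed_window h'
  have hokx : ∀ u ∈ win (x - 1) 1 3, L.ok u = true := by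
    intro u hu
    rw [win_three] at hu
    simp only [List.mem_cons, List.not_mem_nil, or_false] at hu
    exact L.conv _ _ _ h.1 h.2.1 (by omega) (by omega) (by omega)
  have hoky : ∀ u ∈ win (y - 1) 1 3, L.ok u = true := by
    intro u hu
    rw [win_three] at hu
    simp only [List.mem_cons, List.not_mem_nil, or_false] at hu
    exact L.conv _ _ _ h'.1 h'.2.1 (by omega) (by omega) (by omega)
  have key := List.all_eq_true.1 (List.all_eq_true.1 two_windows_hit (b * 3 + c)
    (List.mem_range.2 (by omega))) (a' * 12 + b' * 3 + c') (List.mem_range.2 (by omega))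
  obtain ⟨R, hR, hhit⟩ := List.any_eq_true.1 key
  rw [List.mem_tails, show (b * 3 + c) / 3 = b by omega, show (b * 3 + c) % 3 = c by omega,
    show (a' * 12 + b' * 3 + c') / 12 = a' by omega,
    show (a' * 12 + b' * 3 + c') / 3 % 4 = b' by omega,
    show (a' * 12 + b' * 3 + c') % 3 = c' by omega, ← hw'] at hR
  have := L.nohit (x - 1) 1 3 (y - 1) 1 3 (Or.inl rfl) (Or.inl rfl) hokx hoky (by
    intro u hu hu'
    rw [win_three] at hu hu'
    simp only [List.mem_cons, List.not_mem_nil, or_false] at hu hu'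
    omega) R (by
      rw [hw]
      obtain ⟨t, ht⟩ := rows_add_suffix a [b, c + 1]
      rw [← ht, List.append_assoc]
      exact hR.trans (List.suffix_append _ _))
  rw [this] at hhit
  cases hhit

theorem Crossed.unique {x y : ℤ} (h : L.Crossed x) (h' : L.Crossed y) : x = y := by
  rcases le_total x y with hxy | hxy
  · exact h.unique_of_le h' hxy
  · exact (h'.unique_of_le h hxy).symm

end Line

end

def incHead : List ℕ → List ℕ
  | [] => []
  | a :: l => (a + 1) :: l

/-- The adjusted weights of a path, in which the first vertex has a further neighbour. -/
def tailAdjusted : List ℤ → List ℕ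
  | [] => []
  | [x] => [(x - 1).toNat]
  | x :: y :: l => (x - 2).toNat :: tailAdjusted (y :: l)

theorem rows_zero_cons (t : List ℕ) : rows (0 :: t) = rows t := rfl

theorem lead_succ_cons (w : ℕ) (t : List ℕ) : lead ((w + 1) :: t) = 3 := rfl

theorem lead_zero_cons (t : List ℕ) : lead (0 :: t) = if lead t = 0 then 0 else lead t + 1 := by
  change (Nat.rec 0 (fun _ _ => (lead t).succ) (lead t) : ℕ) = _
  cases h : lead t <;> simp

theorem consLead_of_ne_zero {g : ℕ} (h : g ≠ 0) (l : List ℕ) : consLead g l = g :: l := by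
  cases g with
  | zero => exact absurd rfl h
  | succ g => rfl

theorem incHead_rows_incHead {t : List ℕ} (h : lead t ≠ 0) :
    incHead (rows (incHead t)) = consLead (lead t) (rows t) := by
  cases t with
  | nil => exact absurd rfl h
  | cons w t =>
    cases w with
    | succ w => rfl
    | zero =>
      rw [lead_zero_cons] at h ⊢
      have h0 : lead t ≠ 0 := fun h0 => h (by rw [if_pos h0])
      rw [if_neg h0, incHead, zero_add, rows_one, rows_zero_cons, consLead_of_ne_zero h0,
        consLead_of_ne_zero (Nat.succ_ne_zero _), incHead]

theorem lead_tailAdjusted : ∀ {b : List ℤ}, b ≠ [] → (∀ x ∈ b, 2 ≤ x) → lead (tailAdjusted b) ≠ 0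
  | [], h, _ => absurd rfl h
  | [x], _, h => by
    obtain ⟨m, hm⟩ : ∃ m : ℕ, (x - 1).toNat = m + 1 := by
      have := h x (by simp)
      exact ⟨(x - 2).toNat, by omega⟩
    rw [tailAdjusted, hm, lead_succ_cons]
    decide
  | x :: y :: l, _, h => by
    have ih := lead_tailAdjusted (b := y :: l) (by simp) fun z hz => h z (List.mem_cons_of_mem _ hz)
    rw [tailAdjusted]
    cases (x - 2).toNat with
    | zero => rw [lead_zero_cons, if_neg ih]; exact Nat.succ_ne_zero _
    | succ m => rw [lead_succ_cons]; decide

/-- The value of the continued fraction of a list of natural numbers. -/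
def natCF (R : List ℕ) : ℚ := negCF (R.map Nat.cast)

theorem natCF_cons (a : ℕ) (R : List ℕ) : natCF (a :: R) = a - 1 / natCF R := by
  simp [natCF, negCF]

theorem one_lt_negCF : ∀ {b : List ℤ}, b ≠ [] → (∀ x ∈ b, 2 ≤ x) → 1 < negCF b
  | [], h, _ => absurd rfl h
  | [x], _, h => by
    have : (2 : ℚ) ≤ x := by exact_mod_cast h x (by simp)
    simp only [negCF, div_zero, sub_zero]
    linarith
  | x :: y :: l, _, h => by
    have ih := one_lt_negCF (b := y :: l) (by simp) fun z hz => h z (List.mem_cons_of_mem _ hz)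
    have hx : (2 : ℚ) ≤ x := by exact_mod_cast h x (by simp)
    rw [negCF]
    have : 1 / negCF (y :: l) < 1 := (div_lt_one (by linarith)).2 ih
    linarith

theorem negCF_injective : ∀ {a b : List ℤ}, (∀ x ∈ a, 2 ≤ x) → (∀ x ∈ b, 2 ≤ x) →
    negCF a = negCF b → a = b
  | [], [], _, _, _ => rfl
  | [], y :: l, _, hb, h => by
    have := one_lt_negCF (by simp) hb
    rw [← h, negCF] at this
    norm_num at this
  | x :: k, [], ha, _, h => by
    have := one_lt_negCF (by simp) ha
    rw [h, negCF] at this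
    norm_num at this
  | x :: k, y :: l, ha, hb, h => by
    have key : ∀ {m : List ℤ}, (∀ x ∈ m, 2 ≤ x) → 0 ≤ 1 / negCF m ∧ 1 / negCF m < 1 := by
      intro m hm
      cases m with
      | nil => simp [negCF]
      | cons z m =>
        have h1 := one_lt_negCF (by simp) hm
        exact ⟨by positivity, (div_lt_one (by linarith)).2 h1⟩
    have hk : ∀ z ∈ k, 2 ≤ z := fun z hz => ha z (List.mem_cons_of_mem _ hz)
    have hl : ∀ z ∈ l, 2 ≤ z := fun z hz => hb z (List.mem_cons_of_mem _ hz)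
    have h1 := key hk
    have h2 := key hl
    rw [negCF, negCF] at h
    have hxy : x = y := by
      have h3 : (x : ℚ) < y + 1 := by linarith
      have h4 : (y : ℚ) < x + 1 := by linarith
      have h3 : x < y + 1 := by exact_mod_cast h3
      have h4 : y < x + 1 := by exact_mod_cast h4
      omega
    subst hxy
    rw [sub_right_inj, one_div, one_div, inv_inj] at h
    rw [negCF_injective hk hl h]

theorem rows_dual : ∀ {b : List ℤ}, b ≠ [] → (∀ x ∈ b, 2 ≤ x) →
    natCF (rows (incHead (tailAdjusted b))) = negCF b / (negCF b - 1) ∧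
      (∀ x ∈ rows (incHead (tailAdjusted b)), 2 ≤ x) := by
  have step : ∀ (w : ℕ) (t : List ℕ) (r : ℚ), 1 < r →
      natCF (rows (1 :: t)) = r / (r - 1) → (∀ x ∈ rows (1 :: t), 2 ≤ x) →
      natCF (rows ((w + 1) :: t)) = (r + w) / (r + w - 1) ∧ ∀ x ∈ rows ((w + 1) :: t), 2 ≤ x := by
    intro w t r hr h1 h2
    induction w with
    | zero => simpa using ⟨h1, h2⟩
    | succ w ih =>
      have hw : (0 : ℚ) ≤ w := Nat.cast_nonneg w
      rw [rows_succ_succ, natCF_cons, ih.1]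
      refine ⟨?_, fun x hx => ?_⟩
      · have e1 : r + w - 1 ≠ 0 := by linarith
        have e2 : r + w ≠ 0 := by linarith
        have e3 : r + ((w + 1 : ℕ) : ℚ) - 1 ≠ 0 := by push_cast; linarith
        field_simp
        push_cast
        ring
      · rcases List.mem_cons.1 hx with rfl | hx
        · exact le_rfl
        · exact ih.2 x hx
  intro b
  induction b with
  | nil => intro h; exact absurd rfl h
  | cons x b ih =>
    intro hne h
    have hx := h x List.mem_cons_self
    cases b with
    | nil =>
      obtain ⟨m, rfl⟩ : ∃ m : ℕ, x = m + 2 := ⟨(x - 2).toNat, by omega⟩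
      have e : incHead (tailAdjusted [(m : ℤ) + 2]) = (m + 1 + 1) :: [] := by
        have : ((m : ℤ) + 2 - 1).toNat = m + 1 := by omega
        simp [tailAdjusted, incHead, this]
      have h2 : rows [m + 1 + 1] = List.replicate (m + 1) 2 := by
        clear e h hx ih hne
        induction m with
        | zero => rfl
        | succ m ih => rw [rows_succ_succ, ih, ← List.replicate_succ]
      rw [e]
      refine ⟨?_, fun y hy => by rw [h2] at hy; rw [List.eq_of_mem_replicate hy]⟩
      clear e h hx ih h2 hne
      induction m with
      | zero =>
        rw [show rows [0 + 1 + 1] = [2] from rfl, natCF_cons]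
        norm_num [natCF, negCF]
      | succ m ih =>
        rw [rows_succ_succ, natCF_cons, ih]
        have hm : (0 : ℚ) ≤ m := Nat.cast_nonneg m
        simp only [negCF]
        push_cast
        simp only [div_zero, sub_zero]
        have e1 : (m : ℚ) + 2 - 1 ≠ 0 := by linarith
        have e2 : (m : ℚ) + 2 ≠ 0 := by linarith
        have e3 : (m : ℚ) + 1 + 2 - 1 ≠ 0 := by linarith
        field_simp
        ring
    | cons y l =>
      have hl : ∀ z ∈ y :: l, 2 ≤ z := fun z hz => h z (List.mem_cons_of_mem _ hz)
      obtain ⟨ih1, ih2⟩ := ih (by simp) hl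
      have hr := one_lt_negCF (by simp) hl
      set r := negCF (y :: l) with hrdef
      set t := tailAdjusted (y :: l) with ht
      have hlead := lead_tailAdjusted (b := y :: l) (by simp) hl
      have e0 : rows (1 :: t) = incHead (rows (incHead t)) := by
        rw [rows_one, incHead_rows_incHead hlead]
      obtain ⟨m, rfl⟩ : ∃ m : ℕ, x = m + 2 := ⟨(x - 2).toNat, by omega⟩
      have e : incHead (tailAdjusted (((m : ℤ) + 2) :: y :: l)) = (m + 1) :: t := by
        have : ((m : ℤ) + 2 - 2).toNat = m := by omega
        rw [tailAdjusted, incHead, this]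
      have h1 : natCF (rows (1 :: t)) = (2 - 1 / r) / (2 - 1 / r - 1) ∧
          ∀ x ∈ rows (1 :: t), 2 ≤ x := by
        rw [e0]
        cases hR : rows (incHead t) with
        | nil =>
          rw [hR] at ih1
          have : 0 < r / (r - 1) := div_pos (by linarith) (by linarith)
          rw [← ih1] at this
          simp [natCF, negCF] at this
        | cons c R =>
          rw [hR] at ih1 ih2
          rw [incHead, natCF_cons]
          rw [natCF_cons] at ih1
          refine ⟨?_, fun z hz => ?_⟩
          · have e1 : r - 1 ≠ 0 := by linarith
            have e2 : r ≠ 0 := by linarith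
            have e3 : 2 - 1 / r - 1 = (r - 1) / r := by field_simp; ring
            have : ((c + 1 : ℕ) : ℚ) - 1 / natCF R = r / (r - 1) + 1 := by
              rw [← ih1]; push_cast; ring
            rw [this, e3]
            field_simp
            ring
          · rcases List.mem_cons.1 hz with rfl | hz
            · have := ih2 c List.mem_cons_self
              omega
            · exact ih2 z (List.mem_cons_of_mem _ hz)
      have hr1 : 1 / r < 1 := (div_lt_one (by linarith)).2 hr
      have := step m t (2 - 1 / r) (by linarith) h1.1 h1.2
      rw [e, negCF, ← hrdef]
      push_cast
      rw [show (m : ℚ) + 2 - 1 / r = 2 - 1 / r + m by ring]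
      exact this

theorem eq_rows_of_dualSeqs {a b : List ℤ} (h : DualSeqs a b) :
    a = (rows (incHead (tailAdjusted b))).map Nat.cast := by
  obtain ⟨-, hb0, ha, hb, p, q, hq, hqp, -, h1, h2⟩ := h
  obtain ⟨h3, h4⟩ := rows_dual hb0 hb
  refine negCF_injective ha (fun x hx => ?_) ?_
  · obtain ⟨n, hn, rfl⟩ := List.mem_map.1 hx
    exact_mod_cast h4 n hn
  · change _ = natCF _
    have e1 : (p : ℚ) - q ≠ 0 := by
      have : (q : ℚ) < p := by exact_mod_cast hqp
      linarith
    have e2 : (q : ℚ) ≠ 0 := by exact_mod_cast hq.ne'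
    rw [h3, h1, h2]
    have e3 : (p : ℚ) / (p - q) - 1 = q / (p - q) := by field_simp; ring
    rw [e3]
    field_simp

theorem length_tailAdjusted : ∀ b : List ℤ, (tailAdjusted b).length = b.length
  | [] => rfl
  | [_] => rfl
  | _ :: y :: l => by rw [tailAdjusted, List.length_cons, length_tailAdjusted (y :: l)]; rfl

theorem getElem_tailAdjusted : ∀ {b : List ℤ} {j : ℕ} (hj : j < b.length)
    (hj' : j < (tailAdjusted b).length),
    (tailAdjusted b)[j] = (b[j] - 1 - if j + 1 < b.length then 1 else 0).toNat
  | [x], 0, _, _ => by simp [tailAdjusted]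
  | x :: y :: l, 0, _, _ => by
    simp only [tailAdjusted, List.getElem_cons_zero, List.length_cons]
    rw [if_pos (by omega)]
    congr 1
    ring
  | x :: y :: l, j + 1, hj, hj' => by
    simp only [tailAdjusted, List.getElem_cons_succ]
    rw [getElem_tailAdjusted (b := y :: l) (by simpa using hj)]
    simp

theorem length_incHead (l : List ℕ) : (incHead l).length = l.length := by
  cases l <;> rfl

theorem getElem_incHead (l : List ℕ) {j : ℕ} (hj : j < (incHead l).length) :
    (incHead l)[j] = (l[j]'(by rwa [length_incHead] at hj)) + if j = 0 then 1 else 0 := by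
  cases l with
  | nil => simp [incHead] at hj
  | cons w t => cases j <;> simp [incHead]

theorem getElem_adjusted {b : List ℤ} (hb : ∀ x ∈ b, 2 ≤ x) {j : ℕ} (hj : j < b.length)
    (hj' : j < (incHead (tailAdjusted b)).length) : (incHead (tailAdjusted b))[j] =
      (b[j] - (if 0 < j then 1 else 0) - if j + 1 < b.length then 1 else 0).toNat := by
  have h1 := getElem_tailAdjusted hj (by rwa [length_tailAdjusted])
  have h2 := hb _ (List.getElem_mem hj)
  rw [getElem_incHead, h1]
  split_ifs <;> omega

section

open Finset

variable {N : ℕ}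

/-- The list of weights `R`, in which `0` separates components, is realized (up to sign) by an
induced subgraph of the configuration encoded by `P`. -/
def Realized (P : List (List ℤ)) (R : List ℕ) : Prop :=
  ∃ c κ : ℕ → ℕ, ∀ i, R.getD i 0 ≠ 0 → (P.getD (c i) []).getD (κ i) 0 = -(R.getD i 0 : ℤ) ∧
    ∀ j, R.getD j 0 ≠ 0 → (c i = c j → κ i = κ j → i = j) ∧
      ((c i = c j ∧ (κ i + 1 = κ j ∨ κ j + 1 = κ i)) ↔ (i + 1 = j ∨ j + 1 = i))

theorem Realized.suffix {P : List (List ℤ)} {R Q : List ℕ} (h : Realized P Q) (hR : R <:+ Q) :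
    Realized P R := by
  obtain ⟨T, rfl⟩ := hR
  obtain ⟨c, κ, h⟩ := h
  have e : ∀ i, (T ++ R).getD (T.length + i) 0 = R.getD i 0 := fun i => by
    rw [List.getD_append_right _ _ _ _ (Nat.le_add_right _ _), Nat.add_sub_cancel_left]
  refine ⟨fun i => c (T.length + i), fun i => κ (T.length + i), fun i hi => ?_⟩
  obtain ⟨h1, h2⟩ := h (T.length + i) (by rwa [e])
  rw [e] at h1
  refine ⟨h1, fun j hj => ?_⟩
  obtain ⟨h3, h4⟩ := h2 (T.length + j) (by rwa [e])
  refine ⟨fun a b => ?_, h4.trans ?_⟩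
  · have := h3 a b
    omega
  · omega

theorem ofList_ext {P : List (List ℤ)} {v u : (ofList P).V} (h1 : (v.1 : ℕ) = u.1)
    (h2 : (v.2 : ℕ) = u.2) : v = u := by
  obtain ⟨⟨i, hi⟩, ⟨j, hj⟩⟩ := v
  obtain ⟨⟨i', hi'⟩, ⟨j', hj'⟩⟩ := u
  simp only at h1 h2
  subst h1 h2
  rfl

theorem Realized.induced {P F : List (List ℤ)} {R : List ℕ} (h : Realized P R)
    (g : ℕ → ℕ → ℕ)
    (hw' : ∀ i (hi : i < F.length) j (hj : j < F[i].length), R.getD (g i j) 0 ≠ 0 ∧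
      F[i][j] = -(R.getD (g i j) 0 : ℤ))
    (hg' : ∀ i (hi : i < F.length) j (_ : j < F[i].length) i' (hi' : i' < F.length) j'
      (_ : j' < F[i'].length), (g i j = g i' j' → i = i' ∧ j = j') ∧
      ((i = i' ∧ (j + 1 = j' ∨ j' + 1 = j)) ↔ (g i j + 1 = g i' j' ∨ g i' j' + 1 = g i j))) :
    IsInducedSubgraph (ofList F) (ofList P) := by
  have hw := fun v : (ofList F).V => hw' v.1 v.1.2 v.2 v.2.2
  have hg := fun v u : (ofList F).V => hg' v.1 v.1.2 v.2 v.2.2 u.1 u.1.2 u.2 u.2.2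
  obtain ⟨c, κ, h⟩ := h
  have key : ∀ v : (ofList F).V, ∃ u : (ofList P).V, (u.1 : ℕ) = c (g v.1 v.2) ∧
      (u.2 : ℕ) = κ (g v.1 v.2) ∧ (ofList P).w u = (ofList F).w v := by
    intro v
    obtain ⟨h0, h1⟩ := hw v
    have h2 := (h _ h0).1
    have hc : c (g v.1 v.2) < P.length := by
      by_contra hc
      rw [List.getD_eq_default P [] (not_lt.1 hc)] at h2
      rw [List.getD_nil] at h2
      omega
    rw [List.getD_eq_getElem _ _ hc] at h2
    have hκ : κ (g v.1 v.2) < P[c (g v.1 v.2)].length := by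
      by_contra hκ
      rw [List.getD_eq_default _ _ (not_lt.1 hκ)] at h2
      omega
    rw [List.getD_eq_getElem _ _ hκ] at h2
    exact ⟨⟨⟨_, hc⟩, ⟨_, hκ⟩⟩, rfl, rfl, h2.trans h1.symm⟩
  choose f hf1 hf2 hf3 using key
  refine ⟨f, fun v u hvu => ?_, hf3, fun v u => ?_⟩
  · have := ((h _ (hw v).1).2 _ (hw u).1).1 (by rw [← hf1, ← hf1, hvu]) (by rw [← hf2, ← hf2, hvu])
    have := (hg v u).1 this
    exact ofList_ext this.1 this.2
  · have h1 := ((h _ (hw v).1).2 _ (hw u).1).2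
    rw [← hf1, ← hf1, ← hf2, ← hf2, ← (hg v u).2] at h1
    change (v.1 = u.1 ∧ _) ↔ ((f v).1 = (f u).1 ∧ _)
    rw [Fin.ext_iff, Fin.ext_iff]
    exact h1.symm

theorem startsWithB_iff : ∀ a R : List ℕ, startsWithB a R = true ↔ a <+: R
  | [], _ => by simp [startsWithB]
  | _ :: _, [] => by simp [startsWithB]
  | a :: l, b :: R => by
    change (Bool.rec false (startsWithB l R) (Nat.beq a b) : Bool) = true ↔ _
    rw [List.cons_prefix_cons, ← startsWithB_iff l R, ← Nat.beq_eq]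
    cases Nat.beq a b <;> simp

theorem containedB_imp (a : List ℕ) : ∀ R : List ℕ, containedB a R = true → a <:+: R
  | [], h => ((startsWithB_iff a []).1 h).isInfix
  | b :: R, h => by
    change (Bool.rec (containedB a R) true (startsWithB a (b :: R)) : Bool) = true at h
    cases hp : startsWithB a (b :: R) with
    | true => exact ((startsWithB_iff _ _).1 hp).isInfix
    | false =>
      rw [hp] at h
      exact (containedB_imp a R h).trans (List.suffix_cons _ _).isInfix

theorem dropLen_eq : ∀ a R : List ℕ, dropLen a R = R.drop a.length
  | [], _ => rfl
  | _ :: _, [] => rfl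
  | _ :: l, _ :: R => dropLen_eq l R

theorem hitIn_imp (R : List ℕ) : ∀ l : List (List ℕ × List ℕ), hitIn R l = true →
    ∃ p ∈ l, p.1 <+: R ∧ p.2 <:+: R.drop (p.1.length + 1)
  | [], h => by cases h
  | (a, b) :: l, h => by
    change (Bool.rec (hitIn R l) (Bool.rec (hitIn R l) true
      (containedB b (List.tail (dropLen a R)))) (startsWithB a R) : Bool) = true at h
    have ih : hitIn R l = true →
        ∃ p ∈ (a, b) :: l, p.1 <+: R ∧ p.2 <:+: R.drop (p.1.length + 1) := fun h' => by
      obtain ⟨p, hp, h1⟩ := hitIn_imp R l h'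
      exact ⟨p, List.mem_cons_of_mem _ hp, h1⟩
    cases h1 : startsWithB a R with
    | false => rw [h1] at h; exact ih h
    | true =>
      rw [h1] at h
      cases h2 : containedB b (List.tail (dropLen a R)) with
      | false => rw [h2] at h; exact ih h
      | true =>
        refine ⟨_, List.mem_cons_self, (startsWithB_iff _ _).1 h1, ?_⟩
        have := containedB_imp _ _ h2
        rwa [dropLen_eq, List.tail_drop] at this

/-- The weights of the plumbing graph corresponding to a table entry. -/
def negate (l : List ℕ) : List ℤ := l.map fun x : ℕ => -(x : ℤ)

theorem table_forbidden : ∀ a ∈ List.range 7, ∀ p ∈ nth table a,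
    (∀ x ∈ a :: p.1 ++ p.2, x ≠ 0) ∧
    ([negate (a :: p.1), negate p.2] ∈ forbidden17 ∨ [negate p.2, negate (a :: p.1)] ∈ forbidden17 ∨
      [negate (a :: p.1)] ∈ forbidden17 ∨ [(negate (a :: p.1)).reverse] ∈ forbidden17) := by
  decide +kernel

theorem nth_eq : ∀ (l : List (List (List ℕ × List ℕ))) (n : ℕ), nth l n = l.getD n []
  | [], _ => by simp [nth]
  | a :: l, 0 => rfl
  | a :: l, n + 1 => by rw [List.getD_cons_succ, ← nth_eq l n]; rfl

theorem Realized.not_hit {P : List (List ℤ)} {R : List ℕ} (h : Realized P R)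
    (h17 : ∀ F ∈ forbidden17, ¬ IsInducedSubgraph (ofList F) (ofList P)) : hit R = false := by
  rw [← Bool.not_eq_true]
  intro hh
  cases R with
  | nil => cases hh
  | cons a R =>
    obtain ⟨⟨A, B⟩, hp, ⟨S, rfl⟩, ⟨T, U, hTU⟩⟩ := hitIn_imp R _ hh
    have ha : a ∈ List.range 7 := by
      rw [List.mem_range]
      by_contra ha
      rw [nth_eq, List.getD_eq_default _ _ (not_lt.1 ha)] at hp
      cases hp
    obtain ⟨h0, hF⟩ := table_forbidden a ha _ hp
    simp only at h0 hF hTU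
    have eA : ∀ j (hj : j < (a :: A).length), (a :: (A ++ S)).getD j 0 = (a :: A)[j] := by
      intro j hj
      rw [← List.cons_append, List.getD_append _ _ _ _ hj, List.getD_eq_getElem _ _ hj]
    have eB : ∀ j (hj : j < B.length),
        (a :: (A ++ S)).getD (A.length + 2 + T.length + j) 0 = B[j] := by
      intro j hj
      have e : (a :: (A ++ S)).drop (A.length + 2) = T ++ B ++ U := hTU.symm
      rw [List.getD_eq_getElem?_getD,
        show A.length + 2 + T.length + j = A.length + 2 + (T.length + j) by omega,
        ← List.getElem?_drop, e, List.append_assoc,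
        List.getElem?_append_right (Nat.le_add_right _ _), Nat.add_sub_cancel_left,
        List.getElem?_append_left hj, List.getElem?_eq_getElem hj, Option.getD_some]
    have nA : ∀ j (hj : j < (a :: A).length), (a :: A)[j] ≠ 0 := fun j hj =>
      h0 _ (List.mem_append_left _ (List.getElem_mem hj))
    have nB : ∀ j (hj : j < B.length), B[j] ≠ 0 := fun j hj =>
      h0 _ (List.mem_append_right _ (List.getElem_mem hj))
    have lA : (negate (a :: A)).length = A.length + 1 := by simp [negate]
    have lB : (negate B).length = B.length := by simp [negate]
    have wA : ∀ j, j < (negate (a :: A)).length → (a :: (A ++ S)).getD j 0 ≠ 0 ∧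
        (negate (a :: A)).getD j 0 = -((a :: (A ++ S)).getD j 0 : ℤ) := by
      intro j hj
      rw [eA j (by simpa [negate] using hj)]
      refine ⟨nA j _, ?_⟩
      rw [List.getD_eq_getElem _ _ hj]
      simp only [negate, List.getElem_map]
    have wB : ∀ j, j < (negate B).length →
        (a :: (A ++ S)).getD (A.length + 2 + T.length + j) 0 ≠ 0 ∧
        (negate B).getD j 0 = -((a :: (A ++ S)).getD (A.length + 2 + T.length + j) 0 : ℤ) := by
      intro j hj
      rw [eB j (by simpa [negate] using hj)]
      refine ⟨nB j _, ?_⟩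
      rw [List.getD_eq_getElem _ _ hj]
      simp only [negate, List.getElem_map]
    generalize negate (a :: A) = A' at *
    generalize negate B = B' at *
    rcases hF with hF | hF | hF | hF <;> refine h17 _ hF ?_
    · refine h.induced (fun i j => if i = 0 then j else A.length + 2 + T.length + j) ?_ ?_
      · rintro (_ | _ | i) hi j hj
        · have := wA j hj
          rwa [List.getD_eq_getElem A' _ hj] at this
        · have := wB j hj
          rwa [List.getD_eq_getElem B' _ hj] at this
        · simp at hi
      · rintro (_ | _ | i) hi j hj (_ | _ | i') hi' j' hj' <;> simp at hi hi' hj hj' ⊢ <;> omega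
    · refine h.induced (fun i j => if i = 0 then A.length + 2 + T.length + j else j) ?_ ?_
      · rintro (_ | _ | i) hi j hj
        · have := wB j hj
          rwa [List.getD_eq_getElem B' _ hj] at this
        · have := wA j hj
          rwa [List.getD_eq_getElem A' _ hj] at this
        · simp at hi
      · rintro (_ | _ | i) hi j hj (_ | _ | i') hi' j' hj' <;> simp at hi hi' hj hj' ⊢ <;> omega
    · refine h.induced (fun _ j => j) ?_ ?_
      · rintro (_ | i) hi j hj
        · have := wA j hj
          rwa [List.getD_eq_getElem A' _ hj] at this
        · simp at hi
      · rintro (_ | i) hi j hj (_ | i') hi' j' hj' <;> simp at hi hi' hj hj' ⊢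
    · refine h.induced (fun _ j => A'.length - 1 - j) ?_ ?_
      · rintro (_ | i) hi j hj
        · have hj1 : j < A'.length := by simpa using hj
          have hj2 : A'.length - 1 - j < A'.length := by omega
          have := wA (A'.length - 1 - j) hj2
          rw [List.getD_eq_getElem A' _ hj2] at this
          simpa [List.getElem_reverse] using this
        · simp at hi
      · rintro (_ | i) hi j hj (_ | i') hi' j' hj' <;> simp at hi hi' hj hj' ⊢
        omega

/-- The distance of the last nonzero entry from the end, shifted like `lead`. -/
def trail : List ℕ → ℕ
  | [] => 0
  | w :: l => if trail l = 0 then (if w = 0 then 0 else l.length + 3) else trail l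

/-- The weight produced by two consecutive marks in adjacent windows. -/
def link (a b : ℕ) : List ℕ := if a = 0 ∨ b = 0 then [] else [a + b - 3]

theorem lead_cons (w : ℕ) (t : List ℕ) :
    lead (w :: t) = if w = 0 then (if lead t = 0 then 0 else lead t + 1) else 3 := by
  cases w with
  | zero => rw [lead_zero_cons, if_pos rfl]
  | succ w => rw [lead_succ_cons, if_neg (Nat.succ_ne_zero w)]

theorem lead_append (X Y : List ℕ) : lead (X ++ Y) =
    if lead X = 0 then (if lead Y = 0 then 0 else X.length + lead Y) else lead X := by
  induction X with
  | nil => simp [lead]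
  | cons w X ih =>
    rw [List.cons_append, lead_cons, lead_cons, ih, List.length_cons]
    split_ifs <;> simp_all; omega

theorem trail_eq_zero_iff (X : List ℕ) : trail X = 0 ↔ lead X = 0 := by
  induction X with
  | nil => simp [trail, lead]
  | cons w X ih =>
    rw [trail, lead_cons]
    split_ifs <;> simp_all

theorem three_le_lead {X : List ℕ} (h : lead X ≠ 0) : 3 ≤ lead X := by
  induction X with
  | nil => exact absurd rfl h
  | cons w X ih =>
    rw [lead_cons] at h ⊢
    split_ifs at h ⊢ <;> simp_all; omega

theorem rows_cons (w : ℕ) (Y : List ℕ) :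
    rows (w :: Y) = List.replicate (w - 1) 2 ++ link (lead [w]) (lead Y) ++ rows Y := by
  cases w with
  | zero => simp [rows_zero_cons, link, lead_cons, show lead [] = 0 from rfl]
  | succ w =>
    induction w with
    | zero =>
      rw [rows_one, show lead [0 + 1] = 3 from rfl, link]
      by_cases h : lead Y = 0
      · rw [h]; simp [consLead]
      · rw [consLead_of_ne_zero h]; simp [h]
    | succ w ih =>
      rw [rows_succ_succ, ih]
      simp [lead_succ_cons, List.replicate_succ]

theorem rows_eq_nil {X : List ℕ} (h : lead X = 0) : rows X = [] := by
  induction X with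
  | nil => rfl
  | cons w X ih =>
    rw [lead_cons] at h
    split_ifs at h with hw hX
    rw [hw, rows_zero_cons, ih hX]

theorem rows_append (X Y : List ℕ) :
    rows (X ++ Y) = rows X ++ link (trail X) (lead Y) ++ rows Y := by
  induction X with
  | nil => simp [trail, link, rows]
  | cons w X ih =>
    rw [List.cons_append, rows_cons, rows_cons, ih, lead_append, trail]
    by_cases hX : lead X = 0
    · have hX' := (trail_eq_zero_iff X).2 hX
      have h3 := @three_le_lead Y
      rw [rows_eq_nil hX]
      simp only [hX, hX', if_true, lead_cons, link]
      by_cases hw : w = 0 <;> by_cases hY : lead Y = 0 <;>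
        simp [hw, hY, show lead [] = 0 from rfl]
      omega
    · have hX' : trail X ≠ 0 := fun h => hX ((trail_eq_zero_iff X).1 h)
      simp [hX, hX']

theorem trail_concat (X : List ℕ) (w : ℕ) : trail (X ++ [w]) =
    if w = 0 then (if trail X = 0 then 0 else trail X + 1) else 3 := by
  induction X with
  | nil => simp [trail]
  | cons x X ih =>
    rw [List.cons_append, trail, trail, ih]
    split_ifs <;> simp_all

theorem trail_reverse (X : List ℕ) : trail X.reverse = lead X := by
  induction X with
  | nil => rfl
  | cons w X ih => rw [List.reverse_cons, trail_concat, lead_cons, ih]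

theorem rows_reverse (X : List ℕ) : rows X.reverse = (rows X).reverse := by
  induction X with
  | nil => rfl
  | cons w X ih =>
    have e : rows [w] = List.replicate (w - 1) 2 := by
      rw [rows_cons]
      simp [link, show lead [] = 0 from rfl, show rows [] = [] from rfl]
    have hl : ∀ a b, (link a b).reverse = link b a := fun a b => by
      unfold link
      by_cases h : a = 0 ∨ b = 0
      · rw [if_pos h, if_pos h.symm]; rfl
      · rw [if_neg h, if_neg fun h' => h h'.symm, add_comm]; rfl
    rw [List.reverse_cons, rows_append, ih, e, trail_reverse, rows_cons]
    simp [hl]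

theorem lead_ne_zero_of_rows {X : List ℕ} (h : rows X ≠ []) : lead X ≠ 0 :=
  fun h' => h (rows_eq_nil h')

theorem rows_inside (X W Z : List ℕ) : ∃ x z, rows (X ++ W ++ Z) = x ++ rows W ++ z :=
  ⟨_, _, by rw [List.append_assoc, rows_append, rows_append W, List.append_assoc (rows W),
    ← List.append_assoc]⟩

theorem rows_two_inside (X Y Z : List ℕ) {V W : List ℕ} (hV : rows V ≠ []) (hW : rows W ≠ []) :
    ∃ x y z, y ≠ [] ∧ rows (X ++ V ++ Y ++ W ++ Z) = x ++ rows V ++ y ++ rows W ++ z := by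
  refine ⟨rows X ++ link (trail X) (lead (V ++ (Y ++ (W ++ Z)))),
    link (trail V) (lead (Y ++ (W ++ Z))) ++ rows Y ++ link (trail Y) (lead (W ++ Z)),
    link (trail W) (lead Z) ++ rows Z, ?_, ?_⟩
  · have h1 : trail V ≠ 0 := fun h => lead_ne_zero_of_rows hV ((trail_eq_zero_iff V).1 h)
    have h2 := lead_ne_zero_of_rows hW
    have h3 : lead (Y ++ (W ++ Z)) ≠ 0 := by
      rw [lead_append, lead_append W]
      split_ifs <;> omega
    simp [link, h1, h3]
  · rw [List.append_assoc, List.append_assoc, List.append_assoc, rows_append, rows_append V,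
      rows_append Y, rows_append W]
    simp only [List.append_assoc]

/-- The list `R` occurs, possibly reversed, in component `i` of `P` at position `a`. -/
def Placed (P : List (List ℤ)) (R : List ℕ) (i a : ℕ) : Prop :=
  ∃ κ : ℕ → ℕ, ∀ j < R.length, a ≤ κ j ∧ κ j < a + R.length ∧
    (P.getD i []).getD (κ j) 0 = -(R.getD j 0 : ℤ) ∧
    ∀ j' < R.length, (κ j = κ j' → j = j') ∧
      ((κ j + 1 = κ j' ∨ κ j' + 1 = κ j) ↔ (j + 1 = j' ∨ j' + 1 = j))

theorem Placed.of_inside {P : List (List ℤ)} {i : ℕ} {x R z : List ℕ}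
    (h : P.getD i [] = (x ++ R ++ z).map fun n : ℕ => -(n : ℤ)) : Placed P R i x.length := by
  refine ⟨fun j => x.length + j, fun j hj =>
    ⟨Nat.le_add_right _ _, Nat.add_lt_add_left hj _, ?_, fun j' _ => by dsimp only; omega⟩⟩
  have e : (0 : ℤ) = (fun n : ℕ => -(n : ℤ)) 0 := by simp
  rw [h, e, List.getD_map, List.append_assoc,
    List.getD_append_right _ _ _ _ (Nat.le_add_right _ _), Nat.add_sub_cancel_left,
    List.getD_append _ _ _ _ hj]

theorem Placed.reverse {P : List (List ℤ)} {R : List ℕ} {i a : ℕ} (h : Placed P R i a) :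
    Placed P R.reverse i a := by
  obtain ⟨κ, h⟩ := h
  refine ⟨fun j => κ (R.length - 1 - j), fun j hj => ?_⟩
  rw [List.length_reverse] at hj ⊢
  obtain ⟨h1, h2, h3, h4⟩ := h (R.length - 1 - j) (by omega)
  refine ⟨h1, h2, ?_, fun j' hj' => ?_⟩
  · rw [h3, List.getD_eq_getElem _ _ (by omega), List.getD_eq_getElem _ _ (by simpa using hj),
      List.getElem_reverse]
  · obtain ⟨h5, h6⟩ := h4 (R.length - 1 - j') (by omega)
    dsimp only
    omega

theorem Placed.realized {P : List (List ℤ)} {R R' : List ℕ} {i a i' a' : ℕ} (h : Placed P R i a)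
    (h' : Placed P R' i' a')
    (hd : R = [] ∨ R' = [] ∨ i ≠ i' ∨ a + R.length < a' ∨ a' + R'.length < a) :
    Realized P (R ++ 0 :: R') := by
  obtain ⟨κ, h⟩ := h
  obtain ⟨κ', h'⟩ := h'
  have hd' : R.length = 0 ∨ R'.length = 0 ∨ i ≠ i' ∨ a + R.length < a' ∨ a' + R'.length < a := by
    simpa using hd
  have e1 : ∀ j, (R ++ 0 :: R').getD j 0 ≠ 0 → j < R.length ∨
      (R.length < j ∧ j - R.length - 1 < R'.length) := by
    intro j hj
    by_contra hc
    refine hj ?_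
    rcases lt_trichotomy j R.length with h1 | rfl | h1
    · exact absurd (Or.inl h1) hc
    · simp
    · exact List.getD_eq_default _ _ (by simp; omega)
  have e2 : ∀ j, j < R.length → (R ++ 0 :: R').getD j 0 = R.getD j 0 := fun j hj =>
    List.getD_append _ _ _ _ hj
  have e3 : ∀ j, R.length < j → (R ++ 0 :: R').getD j 0 = R'.getD (j - R.length - 1) 0 := by
    intro j hj
    obtain ⟨k, rfl⟩ : ∃ k, j = R.length + (k + 1) := ⟨j - R.length - 1, by omega⟩
    rw [List.getD_append_right _ _ _ _ (by omega), Nat.add_sub_cancel_left, List.getD_cons_succ,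
      Nat.add_sub_cancel]
  refine ⟨fun j => if j < R.length then i else i',
    fun j => if j < R.length then κ j else κ' (j - R.length - 1), fun j hj => ⟨?_, fun k hk => ?_⟩⟩
  · rcases e1 j hj with h1 | ⟨h1, h2⟩
    · simp only [if_pos h1, e2 j h1, (h j h1).2.2.1]
    · simp only [if_neg h1.not_gt, e3 j h1, (h' _ h2).2.2.1]
  · rcases e1 j hj with h1 | ⟨h1, h2⟩ <;> rcases e1 k hk with h3 | ⟨h3, h4⟩
    · have := (h j h1).2.2.2 k h3
      simpa only [if_pos h1, if_pos h3, true_and, forall_true_left] using this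
    · have := h j h1
      have := h' _ h4
      simp only [if_pos h1, if_neg h3.not_gt]
      omega
    · have := h k h3
      have := h' _ h2
      simp only [if_pos h3, if_neg h1.not_gt]
      omega
    · have := (h' _ h2).2.2.2 _ h4
      simp only [if_neg h1.not_gt, if_neg h3.not_gt, true_and, forall_true_left]
      omega

/-- The adjusted weights of a path. -/
def adjusted (l : List ℤ) : List ℕ := incHead (tailAdjusted l)

/-- The position of a vertex on the integer line. -/
def pos (D : List (List ℤ)) (v : (ofList D).V) : ℤ :=
  ((totalLen D + 10 : ℕ) : ℤ) * (v.1 : ℕ) + (v.2 : ℕ)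

theorem length_le_totalLen {D : List (List ℤ)} {l : List ℤ} (h : l ∈ D) :
    l.length ≤ totalLen D :=
  List.single_le_sum (fun _ _ => Nat.zero_le _) _ (List.mem_map_of_mem h)

theorem eq_of_pos {D : List (List ℤ)} {v u : (ofList D).V} {t : ℤ} (h : pos D u = pos D v + t)
    (h1 : -10 < t) (h2 : t < 10) : (u.1 : ℕ) = v.1 ∧ ((u.2 : ℕ) : ℤ) = (v.2 : ℕ) + t := by
  have hv : ((v.2 : ℕ) : ℤ) < totalLen D := by
    exact_mod_cast v.2.2.trans_le (length_le_totalLen (List.get_mem D v.1))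
  have hu : ((u.2 : ℕ) : ℤ) < totalLen D := by
    exact_mod_cast u.2.2.trans_le (length_le_totalLen (List.get_mem D u.1))
  have e : ((totalLen D + 10 : ℕ) : ℤ) * ((u.1 : ℕ) - (v.1 : ℕ) : ℤ) =
      (v.2 : ℕ) - (u.2 : ℕ) + t := by
    unfold pos at h
    rw [mul_sub]
    linarith
  have hM : ((totalLen D + 10 : ℕ) : ℤ) = totalLen D + 10 := by push_cast; rfl
  have e0 : ((totalLen D + 10 : ℕ) : ℤ) * ((u.1 : ℕ) - (v.1 : ℕ) : ℤ) = 0 := by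
    refine Int.eq_zero_of_abs_lt_dvd (Dvd.intro _ rfl) ?_
    rw [e, hM, abs_lt]
    constructor <;> linarith [Int.natCast_nonneg (v.2 : ℕ), Int.natCast_nonneg (u.2 : ℕ)]
  rcases mul_eq_zero.1 e0 with h0 | h0
  · omega
  · rw [e0] at e
    omega

theorem pos_injective (D : List (List ℤ)) : Function.Injective (pos D) := fun u v h => by
  obtain ⟨h1, h2⟩ := eq_of_pos (u := u) (v := v) (t := 0) (by rw [h, add_zero])
    (by norm_num) (by norm_num)
  exact ofList_ext h1 (by omega)

open Classical in
/-- Transport a function on the vertices to the integer line. -/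
noncomputable def onLine {α : Type} (D : List (List ℤ)) (d : α) (f : (ofList D).V → α)
    (k : ℤ) : α :=
  if h : ∃ v, pos D v = k then f h.choose else d

theorem onLine_pos {α : Type} {D : List (List ℤ)} (d : α) (f : (ofList D).V → α)
    (v : (ofList D).V) : onLine D d f (pos D v) = f v := by
  have h : ∃ u, pos D u = pos D v := ⟨v, rfl⟩
  rw [onLine, dif_pos h, pos_injective D h.choose_spec]

theorem onLine_true {D : List (List ℤ)} {k : ℤ} (h : onLine D false (fun _ => true) k = true) :
    ∃ v, pos D v = k := by
  by_contra hc
  rw [onLine, dif_neg hc] at h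
  cases h

theorem onLine_succ {D : List (List ℤ)} (v : (ofList D).V) :
    onLine D false (fun _ => true) (pos D v + 1) = decide ((v.2 : ℕ) + 1 < (D.get v.1).length) := by
  rw [Bool.eq_iff_iff, decide_eq_true_iff]
  constructor
  · intro h
    obtain ⟨u, hu⟩ := onLine_true h
    obtain ⟨h1, h2⟩ := eq_of_pos hu (by norm_num) (by norm_num)
    obtain ⟨⟨i, hi⟩, ⟨j, hj⟩⟩ := u
    obtain ⟨⟨i', hi'⟩, ⟨j', hj'⟩⟩ := v
    simp only at h1 h2 hj hj' ⊢
    subst h1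
    omega
  · intro h
    have := onLine_pos false (fun _ => true) (⟨v.1, ⟨(v.2 : ℕ) + 1, h⟩⟩ : (ofList D).V)
    rwa [show pos D ⟨v.1, ⟨(v.2 : ℕ) + 1, h⟩⟩ = pos D v + 1 by simp [pos, add_assoc]] at this

theorem onLine_pred {D : List (List ℤ)} (v : (ofList D).V) :
    onLine D false (fun _ => true) (pos D v - 1) = decide (0 < (v.2 : ℕ)) := by
  rw [Bool.eq_iff_iff, decide_eq_true_iff]
  constructor
  · intro h
    obtain ⟨u, hu⟩ := onLine_true h
    obtain ⟨h1, h2⟩ := eq_of_pos (t := -1) (hu.trans (sub_eq_add_neg _ _)) (by norm_num)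
      (by norm_num)
    omega
  · intro h
    have := onLine_pos false (fun _ => true)
      (⟨v.1, ⟨(v.2 : ℕ) - 1, (Nat.sub_le _ _).trans_lt v.2.2⟩⟩ : (ofList D).V)
    have e : pos D ⟨v.1, ⟨(v.2 : ℕ) - 1, (Nat.sub_le _ _).trans_lt v.2.2⟩⟩ = pos D v - 1 := by
      simp only [pos]
      rw [Nat.cast_sub (show 1 ≤ (v.2 : ℕ) from h), Nat.cast_one, add_sub_assoc]
    rwa [e] at this

theorem forward_window {D : List (List ℤ)} {p : ℤ} {l : ℕ}
    (h : ∀ u ∈ win p 1 (l + 1), onLine D false (fun _ => true) u = true) :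
    ∃ v : (ofList D).V, pos D v = p ∧ (v.2 : ℕ) + l < (D.get v.1).length := by
  obtain ⟨v, hv⟩ := onLine_true (h p (mem_win.2 ⟨0, by omega, by simp⟩))
  refine ⟨v, hv, ?_⟩
  induction l with
  | zero => exact v.2.2
  | succ l ih =>
    have h1 := ih fun u hu => h u (by
      obtain ⟨i, hi, hu⟩ := mem_win.1 hu
      exact mem_win.2 ⟨i, by omega, hu⟩)
    have h2 := h (p + (l + 1 : ℕ)) (mem_win.2 ⟨l + 1, by omega, by simp⟩)
    have h3 := onLine_succ (⟨v.1, ⟨(v.2 : ℕ) + l, h1⟩⟩ : (ofList D).V)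
    rw [show pos D ⟨v.1, ⟨(v.2 : ℕ) + l, h1⟩⟩ + 1 = p + (l + 1 : ℕ) by
      rw [← hv]; simp [pos]; ring, h2] at h3
    exact of_decide_eq_true h3.symm

/-- The adjusted weight of a vertex. -/
def adjustedWeight (D : List (List ℤ)) (v : (ofList D).V) : ℕ :=
  (adjusted (D.get v.1)).getD v.2 0

theorem map_win {D : List (List ℤ)} {v : (ofList D).V} {l : ℕ}
    (h : (v.2 : ℕ) + l < (D.get v.1).length) :
    (win (pos D v) 1 (l + 1)).map (onLine D 0 (adjustedWeight D)) =
      ((adjusted (D.get v.1)).drop v.2).take (l + 1) := by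
  have hlen : (adjusted (D.get v.1)).length = (D.get v.1).length := by
    rw [adjusted, length_incHead, length_tailAdjusted]
  refine List.ext_getElem (by
    rw [List.length_map, length_win, List.length_take, List.length_drop, hlen]
    omega) fun i h1 h2 => ?_
  have hi : i < l + 1 := by simpa [length_win] using h1
  have := onLine_pos 0 (adjustedWeight D) (⟨v.1, ⟨(v.2 : ℕ) + i, by omega⟩⟩ : (ofList D).V)
  rw [show pos D ⟨v.1, ⟨(v.2 : ℕ) + i, by omega⟩⟩ = pos D v + 1 * (i : ℕ) by
    simp [pos, add_assoc]] at this
  simp only [win, List.getElem_map, List.getElem_range, this, adjustedWeight, List.getElem_take,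
    List.getElem_drop]
  rw [List.getD_eq_getElem]

theorem eq_rows_adjusted {P D : List (List ℤ)} (h : IsDualPair P D) {i : ℕ} (hi : i < D.length) :
    P.getD i [] = (rows (adjusted D[i])).map fun n : ℕ => -(n : ℤ) := by
  obtain ⟨hlen, h⟩ := h
  have h1 := eq_rows_of_dualSeqs (h ⟨i, by omega⟩)
  simp only [List.get_eq_getElem, Fin.val_cast] at h1
  have h2 := congrArg (List.map fun x : ℤ => -x) h1
  rw [List.getD_eq_getElem _ _ (by omega)]
  simpa [Function.comp_def, adjusted] using h2

theorem placed_of_le {P : List (List ℤ)} {A : List ℕ} {i a l a' l' : ℕ}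
    (h : P.getD i [] = (rows A).map fun n : ℕ => -(n : ℤ)) (h1 : a + l ≤ a')
    (h3 : rows ((A.drop a).take l) ≠ []) (h4 : rows ((A.drop a').take l') ≠ []) :
    ∃ b b', Placed P (rows ((A.drop a).take l)) i b ∧ Placed P (rows ((A.drop a').take l')) i b' ∧
      b + (rows ((A.drop a).take l)).length < b' := by
  obtain ⟨x, y, z, hy, e⟩ := rows_two_inside (A.take a) ((A.drop (a + l)).take (a' - (a + l)))
    (A.drop (a' + l')) h3 h4
  have hA : A.take a ++ (A.drop a).take l ++ (A.drop (a + l)).take (a' - (a + l)) ++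
      (A.drop a').take l' ++ A.drop (a' + l') = A := by
    rw [← List.take_add, ← List.take_add, Nat.add_sub_cancel' h1, ← List.take_add,
      List.take_append_drop]
  rw [hA] at e
  refine ⟨x.length, (x ++ rows ((A.drop a).take l) ++ y).length, Placed.of_inside (z := y ++
    rows ((A.drop a').take l') ++ z) ?_, Placed.of_inside (z := z) ?_, ?_⟩
  · rw [h, e]; simp only [List.append_assoc]
  · rw [h, e]
  · have := List.length_pos_iff.2 hy
    simp only [List.length_append]
    omega

theorem placed_pair {P D : List (List ℤ)} (h : IsDualPair P D) {p p' : ℤ} {l l' : ℕ}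
    (hl : ∀ u ∈ win p 1 l, onLine D false (fun _ => true) u = true)
    (hl' : ∀ u ∈ win p' 1 l', onLine D false (fun _ => true) u = true)
    (hd : ∀ u ∈ win p 1 l, u ∉ win p' 1 l') {R R' : List ℕ}
    (hR : R = rows ((win p 1 l).map (onLine D 0 (adjustedWeight D))))
    (hR' : R' = rows ((win p' 1 l').map (onLine D 0 (adjustedWeight D)))) :
    ∃ i a i' a', Placed P R i a ∧ Placed P R' i' a' ∧
      (R = [] ∨ R' = [] ∨ i ≠ i' ∨ a + R.length < a' ∨ a' + R'.length < a) := by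
  have key : ∀ {p l R}, (∀ u ∈ win p 1 l, onLine D false (fun _ => true) u = true) →
      R = rows ((win p 1 l).map (onLine D 0 (adjustedWeight D))) → R ≠ [] →
      ∃ v : (ofList D).V, pos D v = p ∧ (v.2 : ℕ) + l ≤ (D.get v.1).length ∧
        R = rows (((adjusted (D.get v.1)).drop v.2).take l) := by
    rintro p (_ | l) R hl rfl hR
    · exact absurd rfl hR
    · obtain ⟨v, rfl, hv⟩ := forward_window hl
      exact ⟨v, rfl, hv, by rw [map_win hv]⟩
  have one : ∀ (v : (ofList D).V) l, ∃ a,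
      Placed P (rows (((adjusted (D.get v.1)).drop v.2).take l)) v.1 a := by
    intro v l
    obtain ⟨x, z, e⟩ := rows_inside ((adjusted (D.get v.1)).take v.2)
      (((adjusted (D.get v.1)).drop v.2).take l) ((adjusted (D.get v.1)).drop (v.2 + l))
    rw [← List.take_add, List.take_append_drop] at e
    exact ⟨x.length, Placed.of_inside (z := z) (by rw [eq_rows_adjusted h v.1.2, ← e]; rfl)⟩
  have nil : Placed P [] 0 0 := ⟨id, by simp⟩
  by_cases h0 : R = []
  · by_cases h0' : R' = []
    · exact ⟨0, 0, 0, 0, by rwa [h0], by rwa [h0'], Or.inl h0⟩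
    · obtain ⟨v, -, -, rfl⟩ := key hl' hR' h0'
      obtain ⟨a, ha⟩ := one v l'
      exact ⟨0, 0, v.1, a, by rwa [h0], ha, Or.inl h0⟩
  obtain ⟨v, hp, hv, e⟩ := key hl hR h0
  obtain ⟨a, ha⟩ := one v l
  rw [← e] at ha
  by_cases h0' : R' = []
  · exact ⟨v.1, a, 0, 0, ha, by rwa [h0'], Or.inr (Or.inl h0')⟩
  obtain ⟨v', hp', hv', e'⟩ := key hl' hR' h0'
  obtain ⟨a', ha'⟩ := one v' l'
  rw [← e'] at ha'
  by_cases hi : (v.1 : ℕ) = v'.1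
  · have hl0 : 0 < l := by
      rcases Nat.eq_zero_or_pos l with rfl | hl0
      · exact absurd hR h0
      · exact hl0
    have hl0' : 0 < l' := by
      rcases Nat.eq_zero_or_pos l' with rfl | hl0'
      · exact absurd hR' h0'
      · exact hl0'
    have hpp : p - (v.2 : ℕ) = p' - (v'.2 : ℕ) := by
      rw [← hp, ← hp', pos, pos, hi]
      ring
    have hP := eq_rows_adjusted h v.1.2
    have e2 : R' = rows (((adjusted D[(v.1 : ℕ)]).drop v'.2).take l') := by
      have hg : D.get v'.1 = D.getD v'.1 [] := (List.getD_eq_getElem D _ v'.1.2).symm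
      rw [e', ← List.getD_eq_getElem D [] v.1.2, hi]
      exact congrArg (fun A => rows (((adjusted A).drop v'.2).take l')) hg
    clear e'
    subst e e2
    rcases le_or_gt ((v.2 : ℕ) + l) v'.2 with hc | hc
    · obtain ⟨b, b', h1, h2, h3⟩ := placed_of_le hP hc h0 h0'
      exact ⟨_, _, _, _, h1, h2, Or.inr (Or.inr (Or.inr (Or.inl h3)))⟩
    rcases le_or_gt ((v'.2 : ℕ) + l') v.2 with hc' | hc'
    · obtain ⟨b, b', h1, h2, h3⟩ := placed_of_le hP hc' h0' h0
      exact ⟨_, _, _, _, h2, h1, Or.inr (Or.inr (Or.inr (Or.inr h3)))⟩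
    exfalso
    rcases le_total (v.2 : ℕ) v'.2 with hle | hle
    · exact hd p' (mem_win.2 ⟨(v'.2 : ℕ) - v.2, by omega, by push_cast [hle]; linarith⟩)
        (mem_win.2 ⟨0, hl0', by simp⟩)
    · exact hd p (mem_win.2 ⟨0, hl0, by simp⟩)
        (mem_win.2 ⟨(v.2 : ℕ) - v'.2, by omega, by push_cast [hle]; linarith⟩)
  · exact ⟨_, _, _, _, ha, ha', Or.inr (Or.inr (Or.inl hi))⟩

theorem exists_forward (p : ℤ) {s : ℤ} (hs : s = 1 ∨ s = -1) (l : ℕ) :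
    ∃ q, win p s l = win q 1 l ∨ win p s l = (win q 1 l).reverse := by
  rcases hs with rfl | rfl
  · exact ⟨p, Or.inl rfl⟩
  · refine ⟨p + -1 * (l - 1), Or.inr ?_⟩
    rw [win_reverse]
    congr 1
    ring

theorem realized_windows {P D : List (List ℤ)} (h : IsDualPair P D) {p s p' s' : ℤ} {l l' : ℕ}
    (hs : s = 1 ∨ s = -1) (hs' : s' = 1 ∨ s' = -1)
    (hl : ∀ u ∈ win p s l, onLine D false (fun _ => true) u = true)
    (hl' : ∀ u ∈ win p' s' l', onLine D false (fun _ => true) u = true)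
    (hd : ∀ u ∈ win p s l, u ∉ win p' s' l') :
    Realized P (rows ((win p s l).map (onLine D 0 (adjustedWeight D))) ++
      0 :: rows ((win p' s' l').map (onLine D 0 (adjustedWeight D)))) := by
  obtain ⟨q, hq⟩ := exists_forward p hs l
  obtain ⟨q', hq'⟩ := exists_forward p' hs' l'
  have hm : ∀ u, u ∈ win p s l ↔ u ∈ win q 1 l := fun u => by rcases hq with e | e <;> simp [e]
  have hm' : ∀ u, u ∈ win p' s' l' ↔ u ∈ win q' 1 l' := fun u => by
    rcases hq' with e | e <;> simp [e]
  simp only [hm, hm'] at hl hl' hd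
  obtain ⟨i, a, i', a', h1, h2, h3⟩ := placed_pair h hl hl' hd rfl rfl
  have e : ∀ {w v : List ℤ}, (w = v ∨ w = v.reverse) → ∀ {i a},
      Placed P (rows (v.map (onLine D 0 (adjustedWeight D)))) i a →
      Placed P (rows (w.map (onLine D 0 (adjustedWeight D)))) i a ∧
        (rows (w.map (onLine D 0 (adjustedWeight D)))).length =
          (rows (v.map (onLine D 0 (adjustedWeight D)))).length := by
    rintro w v (rfl | rfl) i a hv
    · exact ⟨hv, rfl⟩
    · rw [List.map_reverse, rows_reverse]
      exact ⟨hv.reverse, List.length_reverse⟩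
  obtain ⟨h4, h5⟩ := e hq h1
  obtain ⟨h6, h7⟩ := e hq' h2
  refine h4.realized h6 ?_
  simpa only [← List.length_eq_zero_iff, h5, h7] using h3

theorem adj_iff_pos {D : List (List ℤ)} {v u : (ofList D).V} :
    (ofList D).graph.Adj v u ↔ pos D u = pos D v + 1 ∨ pos D v = pos D u + 1 := by
  change (v.1 = u.1 ∧ _) ↔ _
  rw [Fin.ext_iff]
  constructor
  · rintro ⟨h1, h2⟩
    unfold pos
    rw [h1, add_assoc, add_assoc, add_right_inj, add_right_inj]
    omega
  · rintro (h | h)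
    · obtain ⟨h1, h2⟩ := eq_of_pos h (by norm_num) (by norm_num)
      omega
    · obtain ⟨h1, h2⟩ := eq_of_pos h (by norm_num) (by norm_num)
      omega

theorem weight_eq {P D : List (List ℤ)} (h : IsDualPair P D) (v : (ofList D).V) :
    2 ≤ (ofList D).w v ∧ (ofList D).w v = (adjustedWeight D v +
      boolNat (onLine D false (fun _ => true) (pos D v - 1)) +
      boolNat (onLine D false (fun _ => true) (pos D v + 1)) : ℕ) := by
  obtain ⟨hlen, h⟩ := h
  have hb := (h ⟨v.1, by rw [hlen]; exact v.1.2⟩).2.2.2.1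
  change ∀ x ∈ D.get v.1, 2 ≤ x at hb
  have hw : 2 ≤ (D.get v.1)[(v.2 : ℕ)] := hb _ (List.getElem_mem v.2.2)
  have hlen' : (adjusted (D.get v.1)).length = (D.get v.1).length := by
    rw [adjusted, length_incHead, length_tailAdjusted]
  refine ⟨hw, ?_⟩
  change (D.get v.1)[(v.2 : ℕ)] = _
  rw [onLine_pred, onLine_succ, adjustedWeight,
    List.getD_eq_getElem _ _ (by rw [hlen']; exact v.2.2)]
  simp only [adjusted]
  rw [getElem_adjusted hb v.2.2]
  have e : ∀ (p : Prop) [Decidable p], boolNat (decide p) = if p then 1 else 0 := fun p _ => by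
    by_cases hp : p <;> simp [hp, boolNat]
  rw [e, e]
  split_ifs <;> omega

/-- The vertices of a configuration dual to one without forbidden configurations, placed on the
integer line. -/
noncomputable def dualLine {P D : List (List ℤ)} (hdual : IsDualPair P D)
    (h17 : ∀ F ∈ forbidden17, ¬ IsInducedSubgraph (ofList F) (ofList P))
    {φ : (ofList D).V → Fin N → ℤ} (hφ : (ofList D).IsEmbedding N φ) : Line N where
  ok := onLine D false fun _ => true
  X := onLine D 0 φ
  wp := onLine D 0 (adjustedWeight D)
  self k hk := by
    obtain ⟨v, rfl⟩ := onLine_true hk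
    rw [onLine_pos, onLine_pos, hφ, if_pos rfl, (weight_eq hdual v).2]
  two_le k hk := by
    obtain ⟨v, rfl⟩ := onLine_true hk
    rw [onLine_pos]
    have := weight_eq hdual v
    omega
  adj k hk hl := by
    obtain ⟨v, rfl⟩ := onLine_true hk
    obtain ⟨u, hu⟩ := onLine_true hl
    rw [← hu, onLine_pos, onLine_pos, hφ, if_neg (by rintro rfl; omega),
      if_pos (adj_iff_pos.2 (Or.inl hu))]
  far k l hk hl hkl := by
    obtain ⟨v, rfl⟩ := onLine_true hk
    obtain ⟨u, rfl⟩ := onLine_true hl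
    rw [onLine_pos, onLine_pos, hφ, if_neg (by rintro rfl; omega),
      if_neg (by rw [adj_iff_pos]; omega)]
  conv k m l hk hl hkm hml hlk := by
    obtain ⟨v, rfl⟩ := onLine_true hk
    obtain ⟨u, rfl⟩ := onLine_true hl
    obtain ⟨h1, h2⟩ := eq_of_pos (u := u) (v := v) (t := pos D u - pos D v) (by ring) (by omega)
      (by omega)
    obtain ⟨t, rfl⟩ : ∃ t : ℕ, m = pos D v + t := ⟨(m - pos D v).toNat, by omega⟩
    have hlt : (v.2 : ℕ) + t < (D.get v.1).length := by
      have h3 : (u.2 : ℕ) < (D.get u.1).length := u.2.2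
      have h4 : (D.get u.1).length = (D.get v.1).length :=
        congrArg (fun i => (D.get i).length) (Fin.ext h1)
      omega
    have := onLine_pos false (fun _ => true) (⟨v.1, ⟨(v.2 : ℕ) + t, hlt⟩⟩ : (ofList D).V)
    rwa [show pos D ⟨v.1, ⟨(v.2 : ℕ) + t, hlt⟩⟩ = pos D v + t by simp [pos, add_assoc]] at this
  nohit p s l p' s' l' hs hs' hl hl' hd R hR :=
    ((realized_windows hdual hs hs' hl hl' hd).suffix hR).not_hit h17

theorem deg_le {D : List (List ℤ)} (v : (ofList D).V) : (ofList D).deg v ≤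
    boolNat (onLine D false (fun _ => true) (pos D v - 1)) +
      boolNat (onLine D false (fun _ => true) (pos D v + 1)) := by
  have hs : ∀ k : ℤ, {u : (ofList D).V | pos D u = k}.ncard ≤
      boolNat (onLine D false (fun _ => true) k) := by
    intro k
    cases hk : onLine D false (fun _ => true) k with
    | false =>
      have : {u : (ofList D).V | pos D u = k} = ∅ := by
        ext u
        simp only [Set.mem_ofPred_eq, Set.mem_empty_iff_false, iff_false]
        rintro rfl
        rw [onLine_pos] at hk
        cases hk
      simp [this, boolNat]
    | true =>
      refine (Set.ncard_le_one_iff (Set.toFinite _)).2 fun {a b} ha hb => ?_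
      exact pos_injective D (ha.trans hb.symm)
  refine le_trans (Set.ncard_le_ncard (t := {u | pos D u = pos D v - 1} ∪
    {u | pos D u = pos D v + 1}) (fun u hu => ?_) (Set.toFinite _)) ((Set.ncard_union_le _ _).trans
      (Nat.add_le_add (hs _) (hs _)))
  rcases adj_iff_pos.1 hu with h | h
  · exact Or.inr h
  · exact Or.inl (eq_sub_of_add_eq h.symm)

end

end Search

open Search in
/-- If the canonical plumbing graph contains none of the seventeen forbidden
configurations, then every embedding of its dual is either standard or
semi-standard. -/
theorem statement13 (P D : List (List ℤ)) (hdual : IsDualPair P D)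
    (h17 : ∀ F ∈ forbidden17, ¬ IsInducedSubgraph (ofList F) (ofList P))
    (N : ℕ) (hN : 0 < N) (φ : (ofList D).V → Fin N → ℤ)
    (hφ : (ofList D).IsEmbedding N φ) :
    (ofList D).IsStandard N φ ∨ (ofList D).IsSemiStandard N φ := by
  let L := dualLine hdual h17 hφ
  have ok : ∀ v, L.ok (pos D v) = true := onLine_pos false fun _ => true
  have X : ∀ v, L.X (pos D v) = φ v := onLine_pos 0 φ
  have wp : ∀ v, L.wp (pos D v) = adjustedWeight D v := onLine_pos 0 (adjustedWeight D)
  have self : ∀ v, ((supp (φ v) ∩ supp (φ v)).card : ℤ) = (ofList D).w v := fun v => by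
    rw [Finset.inter_self, ← X, L.card_supp (ok v), X, hφ, if_pos rfl]
  have adj : ∀ v u, (ofList D).graph.Adj v u → ((supp (φ v) ∩ supp (φ u)).card : ℤ) = 1 := by
    have one : ∀ v u, pos D u = pos D v + 1 → (supp (φ v) ∩ supp (φ u)).card = 1 := by
      intro v u h
      have := L.hyp_two.two le_rfl (pos D v) (ok v) (by rw [← h]; exact ok u)
      rwa [← h, X, X] at this
    intro v u h
    rcases adj_iff_pos.1 h with h | h
    · exact_mod_cast one v u h
    · rw [Finset.inter_comm]
      exact_mod_cast one u v h
  have far : ∀ v u, v ≠ u → ¬ (ofList D).graph.Adj v u →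
      (∀ x, L.Crossed (pos D x) → ¬ ((ofList D).graph.Adj x v ∧ (ofList D).graph.Adj x u)) →
      ((supp (φ v) ∩ supp (φ u)).card : ℤ) = 0 := by
    have zero : ∀ v u, pos D v + 2 ≤ pos D u →
        (∀ x, L.Crossed (pos D x) → ¬ ((ofList D).graph.Adj x v ∧ (ofList D).graph.Adj x u)) →
        (supp (φ v) ∩ supp (φ u)).card = 0 := by
      intro v u h hx
      rcases h.eq_or_lt with h | h
      · by_contra hc
        have hcr : L.Crossed (pos D v + 1) := by
          refine ⟨?_, ?_, ?_⟩
          · rw [add_sub_cancel_right]; exact ok v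
          · rw [add_assoc, one_add_one_eq_two, h]; exact ok u
          · rw [add_sub_cancel_right, add_assoc, one_add_one_eq_two, h, X, X]; exact hc
        obtain ⟨x, hx'⟩ := onLine_true hcr.ok
        refine hx x (by rwa [hx']) ⟨?_, ?_⟩ <;> rw [adj_iff_pos] <;> omega
      · have := L.disjoint_of_far (ok v) (ok u) (by omega)
        rwa [X, X] at this
    intro v u hne hadj hx
    have h1 : pos D v ≠ pos D u := fun h => hne (pos_injective D h)
    rw [adj_iff_pos] at hadj
    rcases lt_or_gt_of_ne h1 with h | h
    · exact_mod_cast zero v u (by omega) hx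
    · rw [Finset.inter_comm]
      exact_mod_cast zero u v (by omega) fun x hxc hxa => hx x hxc hxa.symm
  by_cases hc : ∃ k, L.Crossed k
  · right
    obtain ⟨k, hk⟩ := hc
    obtain ⟨x, rfl⟩ := onLine_true hk.ok
    obtain ⟨v, hv⟩ := onLine_true hk.1
    obtain ⟨u, hu⟩ := onLine_true hk.2.1
    obtain ⟨h1, h2, h3, h4⟩ := hk.two
    rw [← hv, ← hu, X, X] at h3
    rw [← hv, ← hu, X, X, X] at h4
    rw [← hv, wp] at h1
    rw [← hu, wp] at h2
    have hpos : ∀ v, 0 < adjustedWeight D v → 0 < (ofList D).adjw v := fun v h => by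
      have := deg_le v
      have := (weight_eq hdual v).2
      unfold Config.adjw
      omega
    have ends : ∀ a b, a ≠ b → (ofList D).graph.Adj x a → (ofList D).graph.Adj x b →
        (a = v ∧ b = u) ∨ (a = u ∧ b = v) := by
      intro a b hab ha hb
      have hab' : pos D a ≠ pos D b := fun h => hab (pos_injective D h)
      rw [adj_iff_pos] at ha hb
      simp only [← (pos_injective D).eq_iff]
      omega
    refine ⟨x, ⟨v, u, ?_, adj_iff_pos.2 (by omega), adj_iff_pos.2 (by omega), hpos v h1, hpos u h2⟩,
      fun a _ b _ => ?_, fun a _ b _ hab ha hb => ?_⟩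
    · rintro rfl
      omega
    · split_ifs with h5 h6 h7
      · rw [h5]; exact self b
      · exact adj a b h6
      · rcases ends a b h5 h7.1 h7.2 with ⟨rfl, rfl⟩ | ⟨rfl, rfl⟩
        · exact_mod_cast h3
        · rw [Finset.inter_comm]
          exact_mod_cast h3
      · refine far a b h5 h6 fun y hy => ?_
        rwa [pos_injective D (hy.unique hk)]
    · rcases ends a b hab ha hb with ⟨rfl, rfl⟩ | ⟨rfl, rfl⟩
      · exact h4
      · rwa [Finset.inter_comm, Finset.inter_comm (supp (φ a)), ← Finset.inter_assoc]
  · left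
    intro a _ b _
    split_ifs with h5 h6
    · rw [h5]; exact self b
    · exact adj a b h6
    · exact far a b h5 h6 fun y hy => absurd ⟨_, hy⟩ hc

end LensPaper
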